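/- arXiv:1907.10760 — 3 statements merged into one kernel-verified Lean document; each statement's English description precedes it below -/
import Mathlib

section
/- Let T be a partial Steiner triple system of order 12 having three pairwise disjoint blocks B₁, B₂, B₃ but no four pairwise disjoint blocks, and let L be the set of the three points not in B₁ ∪ B₂ ∪ B₃. Then there exists a point a ∈ L, with L ∖ {a} = {b, c}, such that for each i ∈ {1, 2, 3} the block Bᵢ contains at least two points α for which {b, c, α} is a good set, i.e., V ∖ {b, c, α} cannot be partitioned into three pairwise disjoint blocks. -/
/-- A partial Steiner triple system on point set `V` with block set `B`:
each block is a 3-element subset of `V`, and two distinct blocks meet in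
at most one point. -/
def IsPSTS {α : Type*} [DecidableEq α] (V : Finset α) (B : Finset (Finset α)) : Prop :=
  (∀ b ∈ B, b ⊆ V ∧ b.card = 3) ∧
    ∀ b₁ ∈ B, ∀ b₂ ∈ B, b₁ ≠ b₂ → (b₁ ∩ b₂).card ≤ 1

/-- `B` contains `k` pairwise disjoint blocks. -/
def HasDisjointBlocks {α : Type*} [DecidableEq α] (B : Finset (Finset α))
    (k : ℕ) : Prop :=
  ∃ P : Finset (Finset α), P ⊆ B ∧ P.card = k ∧
    (P : Set (Finset α)).Pairwise Disjoint

/-- `S` is the union of three pairwise disjoint blocks of `B`. -/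
def PartitionsInto3 {α : Type*} [DecidableEq α] (B : Finset (Finset α))
    (S : Finset α) : Prop :=
  ∃ C₁ ∈ B, ∃ C₂ ∈ B, ∃ C₃ ∈ B,
    Disjoint C₁ C₂ ∧ Disjoint C₁ C₃ ∧ Disjoint C₂ C₃ ∧ C₁ ∪ C₂ ∪ C₃ = S


theorem meet_or {α : Type*} [DecidableEq α] {V : Finset α} {B : Finset (Finset α)}
    (hT : IsPSTS V B) {C X : Finset α} (hC : C ∈ B) (hX : X ∈ B) :
    (C ∩ X).card ≤ 1 ∨ (C ∩ X).card = 3 := by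
  by_cases h : C = X
  · right; subst h; simpa using (hT.1 C hC).2
  · left; exact hT.2 C hC X hX h

theorem struct_aux {α : Type*} [DecidableEq α] {V : Finset α} {B : Finset (Finset α)}
    (hT : IsPSTS V B) {B₁ B₂ B₃ : Finset α}
    (h₁ : B₁ ∈ B) (h₂ : B₂ ∈ B) (h₃ : B₃ ∈ B)
    (hd₁₂ : Disjoint B₁ B₂) (hd₁₃ : Disjoint B₁ B₃) (hd₂₃ : Disjoint B₂ B₃)
    {a x : α} (ha : a ∉ B₁ ∪ B₂ ∪ B₃) (hx : x ∈ B₁)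
    {C₁ C₂ C₃ : Finset α} (k₁ : C₁ ∈ B) (k₂ : C₂ ∈ B) (k₃ : C₃ ∈ B)
    (e₁₂ : Disjoint C₁ C₂) (e₁₃ : Disjoint C₁ C₃) (e₂₃ : Disjoint C₂ C₃)
    (hS : C₁ ∪ C₂ ∪ C₃ = insert a ((B₁ ∪ B₂ ∪ B₃).erase x)) (haC : a ∈ C₁) :
    ∃ p p' y q q' z r r', B₁ = {x, p, p'} ∧ B₂ = {y, q, q'} ∧ B₃ = {z, r, r'} ∧
      {a, y, z} ∈ B ∧ {p, q, r} ∈ B ∧ {p', q', r'} ∈ B := by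
  have memS : ∀ t, (t ∈ C₁ ∨ t ∈ C₂ ∨ t ∈ C₃) ↔
      (t = a ∨ (t ≠ x ∧ (t ∈ B₁ ∨ t ∈ B₂ ∨ t ∈ B₃))) := by
    intro t
    have := congrArg (t ∈ ·) hS
    simp only [Finset.mem_union, Finset.mem_insert, Finset.mem_erase, or_assoc, eq_iff_iff] at this
    exact this
  rw [Finset.disjoint_left] at hd₁₂ hd₁₃ hd₂₃ e₁₂ e₁₃ e₂₃
  simp only [Finset.mem_union, not_or] at ha
  obtain ⟨⟨ha1, ha2⟩, ha3⟩ := ha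
  have row : ∀ C : Finset α, C.card = 3 → (∀ t ∈ C, t = a ∨ t ∈ B₁ ∨ t ∈ B₂ ∨ t ∈ B₃) →
      3 = (C ∩ B₁).card + (C ∩ B₂).card + (C ∩ B₃).card + (C ∩ {a}).card := by
    intro C hC h
    rw [← Finset.card_union_of_disjoint, ← Finset.card_union_of_disjoint,
      ← Finset.card_union_of_disjoint, ← hC]
    · congr 1; ext t; simp only [Finset.mem_union, Finset.mem_inter, Finset.mem_singleton]; grind
    all_goals
      rw [Finset.disjoint_left]
      simp only [Finset.mem_union, Finset.mem_inter, Finset.mem_singleton]; grind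
  have col : ∀ X : Finset α, (∀ t ∈ X, t ∈ C₁ ∨ t ∈ C₂ ∨ t ∈ C₃) →
      X.card = (C₁ ∩ X).card + (C₂ ∩ X).card + (C₃ ∩ X).card := by
    intro X h
    rw [← Finset.card_union_of_disjoint, ← Finset.card_union_of_disjoint]
    · congr 1; ext t; simp only [Finset.mem_union, Finset.mem_inter]; grind
    all_goals
      rw [Finset.disjoint_left]
      simp only [Finset.mem_union, Finset.mem_inter]; grind
  have r1 := row C₁ (hT.1 _ k₁).2 (by grind)
  have r2 := row C₂ (hT.1 _ k₂).2 (by grind)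
  have r3 := row C₃ (hT.1 _ k₃).2 (by grind)
  have c1 := col (B₁.erase x) (by grind)
  have c2 := col B₂ (by grind)
  have c3 := col B₃ (by grind)
  have ex : ∀ C : Finset α, x ∉ C → C ∩ B₁.erase x = C ∩ B₁ := by
    intro C h; ext t; simp only [Finset.mem_inter, Finset.mem_erase]; grind
  rw [ex C₁ (by grind), ex C₂ (by grind), ex C₃ (by grind), Finset.card_erase_of_mem hx,
    (hT.1 _ h₁).2] at c1
  rw [(hT.1 _ h₂).2] at c2
  rw [(hT.1 _ h₃).2] at c3
  have a1 : (C₁ ∩ {a}).card = 1 := by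
    rw [Finset.inter_singleton_of_mem haC]; simp
  have a2 : (C₂ ∩ {a}).card = 0 := by
    rw [Finset.inter_singleton_of_notMem (by grind)]; simp
  have a3 : (C₃ ∩ {a}).card = 0 := by
    rw [Finset.inter_singleton_of_notMem (by grind)]; simp
  have m11 := meet_or hT k₁ h₁
  have m12 := meet_or hT k₁ h₂
  have m13 := meet_or hT k₁ h₃
  have m21 := meet_or hT k₂ h₁
  have m22 := meet_or hT k₂ h₂
  have m23 := meet_or hT k₂ h₃
  have m31 := meet_or hT k₃ h₁
  have m32 := meet_or hT k₃ h₂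
  have m33 := meet_or hT k₃ h₃
  have z11 : (C₁ ∩ B₁).card = 0 := by omega
  have z12 : (C₁ ∩ B₂).card = 1 := by omega
  have z13 : (C₁ ∩ B₃).card = 1 := by omega
  have z21 : (C₂ ∩ B₁).card = 1 := by omega
  have z22 : (C₂ ∩ B₂).card = 1 := by omega
  have z23 : (C₂ ∩ B₃).card = 1 := by omega
  have z31 : (C₃ ∩ B₁).card = 1 := by omega
  have z32 : (C₃ ∩ B₂).card = 1 := by omega
  have z33 : (C₃ ∩ B₃).card = 1 := by omega
  clear m11 m12 m13 m21 m22 m23 m31 m32 m33 a1 a2 a3 c1 c2 c3 r1 r2 r3 ex row col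
  have key : ∀ C X : Finset α, ∀ p, C ∩ X = {p} → ∀ t, (t ∈ C ∧ t ∈ X) ↔ t = p := by
    intro C X p h t
    rw [← Finset.mem_inter, h, Finset.mem_singleton]
  rw [Finset.card_eq_zero] at z11
  have z11' : ∀ t, t ∈ C₁ → t ∈ B₁ → False := by
    intro t h h'
    have : t ∈ C₁ ∩ B₁ := Finset.mem_inter.2 ⟨h, h'⟩
    simp [z11] at this
  obtain ⟨y, hy⟩ := Finset.card_eq_one.1 z12
  obtain ⟨z, hz⟩ := Finset.card_eq_one.1 z13
  obtain ⟨p, hp⟩ := Finset.card_eq_one.1 z21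
  obtain ⟨q, hq⟩ := Finset.card_eq_one.1 z22
  obtain ⟨r, hr⟩ := Finset.card_eq_one.1 z23
  obtain ⟨p', hp'⟩ := Finset.card_eq_one.1 z31
  obtain ⟨q', hq'⟩ := Finset.card_eq_one.1 z32
  obtain ⟨r', hr'⟩ := Finset.card_eq_one.1 z33
  replace hy := key _ _ _ hy
  replace hz := key _ _ _ hz
  replace hp := key _ _ _ hp
  replace hq := key _ _ _ hq
  replace hr := key _ _ _ hr
  replace hp' := key _ _ _ hp'
  replace hq' := key _ _ _ hq'
  replace hr' := key _ _ _ hr'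
  refine ⟨p, p', y, q, q', z, r, r', ?_, ?_, ?_, ?_, ?_, ?_⟩
  · ext t; simp only [Finset.mem_insert, Finset.mem_singleton]; grind
  · ext t; simp only [Finset.mem_insert, Finset.mem_singleton]; grind
  · ext t; simp only [Finset.mem_insert, Finset.mem_singleton]; grind
  · convert k₁ using 1; ext t; simp only [Finset.mem_insert, Finset.mem_singleton]; grind
  · convert k₂ using 1; ext t; simp only [Finset.mem_insert, Finset.mem_singleton]; grind
  · convert k₃ using 1; ext t; simp only [Finset.mem_insert, Finset.mem_singleton]; grind

theorem struct_main {α : Type*} [DecidableEq α] {V : Finset α} {B : Finset (Finset α)}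
    (hT : IsPSTS V B) {B₁ B₂ B₃ : Finset α}
    (h₁ : B₁ ∈ B) (h₂ : B₂ ∈ B) (h₃ : B₃ ∈ B)
    (hd₁₂ : Disjoint B₁ B₂) (hd₁₃ : Disjoint B₁ B₃) (hd₂₃ : Disjoint B₂ B₃)
    {a x : α} (ha : a ∉ B₁ ∪ B₂ ∪ B₃) (hx : x ∈ B₁)
    (hS : PartitionsInto3 B (insert a ((B₁ ∪ B₂ ∪ B₃).erase x))) :
    ∃ p p' y q q' z r r', B₁ = {x, p, p'} ∧ B₂ = {y, q, q'} ∧ B₃ = {z, r, r'} ∧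
      {a, y, z} ∈ B ∧ {p, q, r} ∈ B ∧ {p', q', r'} ∈ B := by
  obtain ⟨C₁, k₁, C₂, k₂, C₃, k₃, e₁₂, e₁₃, e₂₃, hS⟩ := hS
  have : a ∈ C₁ ∪ C₂ ∪ C₃ := by rw [hS]; simp
  simp only [Finset.mem_union] at this
  rcases this with (h | h) | h
  · exact struct_aux hT h₁ h₂ h₃ hd₁₂ hd₁₃ hd₂₃ ha hx k₁ k₂ k₃ e₁₂ e₁₃ e₂₃ hS h
  · exact struct_aux hT h₁ h₂ h₃ hd₁₂ hd₁₃ hd₂₃ ha hx k₂ k₁ k₃ e₁₂.symm e₂₃ e₁₃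
      (by rw [← hS, Finset.union_comm C₂]) h
  · exact struct_aux hT h₁ h₂ h₃ hd₁₂ hd₁₃ hd₂₃ ha hx k₃ k₁ k₂ e₁₃.symm e₂₃.symm e₁₂
      (by rw [← hS, Finset.union_assoc, Finset.union_comm C₃]) h

def okm (m n : ℕ) : Bool :=
  m == n || (m &&& n) == 0 || (m &&& n) == 2 ^ (Nat.log2 (m &&& n))

def mk3 (x y z : ℕ) : ℕ := 2 ^ x ||| 2 ^ y ||| 2 ^ z

def perms3 : List (ℕ × ℕ × ℕ) :=
  [(0,1,2), (0,2,1), (1,0,2), (1,2,0), (2,0,1), (2,1,0)]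

/-- first block row of `Bᵢ` minus point, offsets `j k` of the other two blocks -/
def sg (l x₁ x₂ j k : ℕ) : List (List ℕ) :=
  perms3.flatMap fun s => perms3.map fun t =>
    [mk3 l (j + s.1) (k + t.1), mk3 x₁ (j + s.2.1) (k + t.2.1),
      mk3 x₂ (j + s.2.2) (k + t.2.2)]

def extd (cur : List ℕ) (alts : List (List ℕ)) (k : List ℕ → Bool) : Bool :=
  alts.all fun s => !(s.all fun m => cur.all fun n => okm m n) || k (s ++ cur)

def two (l : ℕ) (cur : List ℕ) (k : List ℕ → Bool) : Bool :=
  [(0, 3, 6), (3, 0, 6), (6, 0, 3)].all fun u =>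
    (extd cur (sg l (u.1 + 1) (u.1 + 2) u.2.1 u.2.2) fun c =>
      extd c (sg l u.1 (u.1 + 2) u.2.1 u.2.2) k) &&
    (extd cur (sg l (u.1 + 1) (u.1 + 2) u.2.1 u.2.2) fun c =>
      extd c (sg l u.1 (u.1 + 1) u.2.1 u.2.2) k) &&
    (extd cur (sg l u.1 (u.1 + 2) u.2.1 u.2.2) fun c =>
      extd c (sg l u.1 (u.1 + 1) u.2.1 u.2.2) k)

def fullCheck : Bool :=
  extd [mk3 9 3 6, mk3 1 4 7, mk3 2 5 8] (sg 9 0 2 3 6 ++ sg 9 0 1 3 6) fun c =>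
    two 10 c fun c => two 11 c fun _ => false

theorem fullCheck_true : fullCheck = true := by decide +kernel

def QQ {α : Type*} [DecidableEq α] (B : Finset (Finset α)) (f : ℕ → α) (m : ℕ) : Prop :=
  ∃ x y z, x < 12 ∧ y < 12 ∧ z < 12 ∧ m = mk3 x y z ∧ {f x, f y, f z} ∈ B

theorem testBit_mk3 (x y z i : ℕ) :
    (mk3 x y z).testBit i = true ↔ (i = x ∨ i = y ∨ i = z) := by
  simp only [mk3, Nat.testBit_or, Nat.testBit_two_pow, Bool.or_eq_true, decide_eq_true_eq]
  grind

theorem QQ_ok {α : Type*} [DecidableEq α] {V : Finset α} {B : Finset (Finset α)}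
    (hT : IsPSTS V B) {f : ℕ → α} (hf : ∀ i < 12, ∀ j < 12, f i = f j → i = j)
    {m n : ℕ} (hm : QQ B f m) (hn : QQ B f n) : okm m n = true := by
  obtain ⟨x, y, z, hx, hy, hz, rfl, hb⟩ := hm
  obtain ⟨x', y', z', hx', hy', hz', rfl, hb'⟩ := hn
  by_contra hok
  simp only [okm, Bool.or_eq_true, beq_iff_eq, not_or] at hok
  obtain ⟨⟨hne, h0⟩, hp⟩ := hok
  set k := mk3 x y z &&& mk3 x' y' z' with hk
  have hi := Nat.testBit_log2 h0
  set i := Nat.log2 k with hidef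
  have : ∃ j, k.testBit j ≠ (2 ^ i).testBit j := by
    by_contra h
    push Not at h
    exact hp (Nat.eq_of_testBit_eq h)
  obtain ⟨j, hj⟩ := this
  have hij : i ≠ j := by
    rintro h
    rw [← h, hi, Nat.testBit_two_pow] at hj
    simp at hj
  rw [Nat.testBit_two_pow, decide_eq_false hij] at hj
  have hj : k.testBit j = true := by simpa using hj
  rw [hk, Nat.testBit_and, Bool.and_eq_true, testBit_mk3, testBit_mk3] at hi hj
  have hi12 : i < 12 := by omega
  have hj12 : j < 12 := by omega
  have heq : ({f x, f y, f z} : Finset α) = {f x', f y', f z'} := by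
    by_contra hc
    have h1 := hT.2 _ hb _ hb' hc
    rw [Finset.card_le_one] at h1
    refine hij (hf i hi12 j hj12 (h1 _ ?_ _ ?_))
    · simp only [Finset.mem_inter, Finset.mem_insert, Finset.mem_singleton]; grind
    · simp only [Finset.mem_inter, Finset.mem_insert, Finset.mem_singleton]; grind
  apply hne
  have mem : ∀ t, (t = f x ∨ t = f y ∨ t = f z) ↔ (t = f x' ∨ t = f y' ∨ t = f z') := by
    intro t
    have := congrArg (t ∈ ·) heq
    simpa only [Finset.mem_insert, Finset.mem_singleton, eq_iff_iff] using this
  apply Nat.eq_of_testBit_eq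
  intro t
  rw [Bool.eq_iff_iff, testBit_mk3, testBit_mk3]
  constructor
  · intro h
    have ht : t < 12 := by omega
    have := (mem (f t)).1 (by grind)
    grind
  · intro h
    have ht : t < 12 := by omega
    have := (mem (f t)).2 (by grind)
    grind

theorem extd_sound {Q : ℕ → Prop} (hQ : ∀ m n, Q m → Q n → okm m n = true)
    {cur : List ℕ} {alts : List (List ℕ)} {k : List ℕ → Bool}
    (hc : ∀ m ∈ cur, Q m) (ha : ∃ s ∈ alts, ∀ m ∈ s, Q m) (h : extd cur alts k = true) :
    ∃ c : List ℕ, (∀ m ∈ c, Q m) ∧ k c = true := by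
  obtain ⟨s, hs, hm⟩ := ha
  rw [extd, List.all_eq_true] at h
  have := h s hs
  have h1 : (s.all fun m => cur.all fun n => okm m n) = true := by
    simp only [List.all_eq_true]
    intro m h1 n h2
    exact hQ _ _ (hm _ h1) (hc _ h2)
  rw [h1] at this
  refine ⟨s ++ cur, ?_, by simpa using this⟩
  intro m h
  rcases List.mem_append.1 h with h | h
  · exact hm _ h
  · exact hc _ h

theorem two_sound {Q : ℕ → Prop} (hQ : ∀ m n, Q m → Q n → okm m n = true)
    {l : ℕ} {cur : List ℕ} {k : List ℕ → Bool}
    (hc : ∀ m ∈ cur, Q m)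
    (ha : ∃ u ∈ [(0, 3, 6), (3, 0, 6), (6, 0, 3)],
      ((∃ s ∈ sg l (u.1 + 1) (u.1 + 2) u.2.1 u.2.2, ∀ m ∈ s, Q m) ∧
        (∃ s ∈ sg l u.1 (u.1 + 2) u.2.1 u.2.2, ∀ m ∈ s, Q m)) ∨
      ((∃ s ∈ sg l (u.1 + 1) (u.1 + 2) u.2.1 u.2.2, ∀ m ∈ s, Q m) ∧
        (∃ s ∈ sg l u.1 (u.1 + 1) u.2.1 u.2.2, ∀ m ∈ s, Q m)) ∨
      ((∃ s ∈ sg l u.1 (u.1 + 2) u.2.1 u.2.2, ∀ m ∈ s, Q m) ∧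
        (∃ s ∈ sg l u.1 (u.1 + 1) u.2.1 u.2.2, ∀ m ∈ s, Q m)))
    (h : two l cur k = true) :
    ∃ c : List ℕ, (∀ m ∈ c, Q m) ∧ k c = true := by
  obtain ⟨u, hu, ha⟩ := ha
  rw [two, List.all_eq_true] at h
  have := h u hu
  simp only [Bool.and_eq_true] at this
  obtain ⟨⟨t1, t2⟩, t3⟩ := this
  rcases ha with ⟨s1, s2⟩ | ⟨s1, s2⟩ | ⟨s1, s2⟩
  · obtain ⟨c, hc', hk⟩ := extd_sound hQ hc s1 t1
    exact extd_sound hQ hc' s2 hk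
  · obtain ⟨c, hc', hk⟩ := extd_sound hQ hc s1 t2
    exact extd_sound hQ hc' s2 hk
  · obtain ⟨c, hc', hk⟩ := extd_sound hQ hc s1 t3
    exact extd_sound hQ hc' s2 hk

theorem perms_of {α : Type*} [DecidableEq α] {f : ℕ → α} {j : ℕ} {Y : Finset α}
    (hY : Y = {f j, f (j + 1), f (j + 2)}) (hc : Y.card = 3) {y q q' : α}
    (h : Y = {y, q, q'}) :
    ∃ s ∈ perms3, y = f (j + s.1) ∧ q = f (j + s.2.1) ∧ q' = f (j + s.2.2) := by
  have hne : y ≠ q ∧ y ≠ q' ∧ q ≠ q' := by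
    rw [h] at hc
    refine ⟨?_, ?_, ?_⟩ <;> rintro rfl
    · have := Finset.card_le_two (a := y) (b := q'); simp at hc; omega
    · have := Finset.card_le_two (a := q) (b := y)
      rw [show ({y, q, y} : Finset α) = {q, y} by ext; simp] at hc; omega
    · have := Finset.card_le_two (a := y) (b := q); simp at hc; omega
  have mem : ∀ t, t ∈ Y → ∃ i < 3, t = f (j + i) := by
    intro t ht
    rw [hY] at ht
    simp only [Finset.mem_insert, Finset.mem_singleton] at ht
    rcases ht with h | h | h
    · exact ⟨0, by omega, h⟩
    · exact ⟨1, by omega, h⟩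
    · exact ⟨2, by omega, h⟩
  obtain ⟨a, ha, rfl⟩ := mem y (by rw [h]; simp)
  obtain ⟨b, hb, rfl⟩ := mem q (by rw [h]; simp)
  obtain ⟨c, hc', rfl⟩ := mem q' (by rw [h]; simp)
  refine ⟨(a, b, c), ?_, rfl, rfl, rfl⟩
  have h1 : a ≠ b := fun e => hne.1 (by rw [e])
  have h2 : a ≠ c := fun e => hne.2.1 (by rw [e])
  have h3 : b ≠ c := fun e => hne.2.2 (by rw [e])
  simp only [perms3, List.mem_cons, Prod.mk.injEq, List.not_mem_nil]
  omega

theorem sg_mem {α : Type*} [DecidableEq α] {B : Finset (Finset α)} {f : ℕ → α}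
    {l x₀ x₁ x₂ j k : ℕ} (hl : l < 12) (hx₁ : x₁ < 12) (hx₂ : x₂ < 12)
    (hj : j + 2 < 12) (hk : k + 2 < 12) {X Y Z : Finset α} {p p' y q q' z r r' : α}
    (hX : X = {f x₀, f x₁, f x₂}) (hXc : X.card = 3)
    (hY : Y = {f j, f (j + 1), f (j + 2)}) (hYc : Y.card = 3)
    (hZ : Z = {f k, f (k + 1), f (k + 2)}) (hZc : Z.card = 3)
    (eX : X = {f x₀, p, p'}) (eY : Y = {y, q, q'}) (eZ : Z = {z, r, r'})
    (b1 : {f l, y, z} ∈ B) (b2 : {p, q, r} ∈ B) (b3 : {p', q', r'} ∈ B) :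
    ∃ s ∈ sg l x₁ x₂ j k, ∀ m ∈ s, QQ B f m := by
  have hpp : (p = f x₁ ∧ p' = f x₂) ∨ (p = f x₂ ∧ p' = f x₁) := by
    set g : ℕ → α := fun n => if n = 0 then f x₀ else if n = 1 then f x₁ else f x₂ with hg
    obtain ⟨s, hs, e1, e2, e3⟩ := perms_of (f := g) (j := 0) (by simpa [hg] using hX) hXc eX
    obtain ⟨t, ht, d1, d2, d3⟩ := perms_of (f := g) (j := 0) (by simpa [hg] using hX) hXc hX
    have c3 : f x₀ ≠ f x₁ ∧ f x₀ ≠ f x₂ := by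
      rw [hX] at hXc
      constructor <;> intro h
      · have := Finset.card_le_two (a := f x₁) (b := f x₂); simp [h] at hXc; omega
      · have := Finset.card_le_two (a := f x₁) (b := f x₂); simp [h] at hXc; omega
    simp only [perms3, List.mem_cons, List.not_mem_nil, or_false] at hs
    rcases hs with rfl | rfl | rfl | rfl | rfl | rfl <;> simp [hg] at e1 e2 e3 <;> grind
  have main : ∀ {q q' r r' : α}, Y = {y, q, q'} → Z = {z, r, r'} → {f x₁, q, r} ∈ B →
      {f x₂, q', r'} ∈ B → ∃ s ∈ sg l x₁ x₂ j k, ∀ m ∈ s, QQ B f m := by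
    intro q q' r r' eY eZ b2 b3
    obtain ⟨s, hs, rfl, rfl, rfl⟩ := perms_of hY hYc eY
    obtain ⟨t, ht, rfl, rfl, rfl⟩ := perms_of hZ hZc eZ
    refine ⟨_, List.mem_flatMap.2 ⟨s, hs, List.mem_map.2 ⟨t, ht, rfl⟩⟩, ?_⟩
    have lt : ∀ s ∈ perms3, s.1 < 3 ∧ s.2.1 < 3 ∧ s.2.2 < 3 := by decide
    have ls := lt s hs
    have l_t := lt t ht
    intro m hm
    simp only [List.mem_cons, List.not_mem_nil, or_false] at hm
    rcases hm with rfl | rfl | rfl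
    · exact ⟨_, _, _, hl, by omega, by omega, rfl, b1⟩
    · exact ⟨_, _, _, hx₁, by omega, by omega, rfl, b2⟩
    · exact ⟨_, _, _, hx₂, by omega, by omega, rfl, b3⟩
  rcases hpp with ⟨rfl, rfl⟩ | ⟨rfl, rfl⟩
  · exact main eY eZ b2 b3
  · exact main (by rw [eY, Finset.pair_comm]) (by rw [eZ, Finset.pair_comm]) b3 b2

def DD {α : Type*} [DecidableEq α] (B : Finset (Finset α)) (U X : Finset α) (a : α) : Prop :=
  ∃ x ∈ X, ∃ y ∈ X, x ≠ y ∧ PartitionsInto3 B (insert a (U.erase x)) ∧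
    PartitionsInto3 B (insert a (U.erase y))

theorem tri₁ {α : Type*} [DecidableEq α] (x y z : α) :
    ({x, y, z} : Finset α) = {y, x, z} := Finset.insert_comm x y {z}

theorem tri₂ {α : Type*} [DecidableEq α] (x y z : α) :
    ({x, y, z} : Finset α) = {z, x, y} := by
  rw [Finset.pair_comm y z, Finset.insert_comm]

theorem dd_sg {α : Type*} [DecidableEq α] {V : Finset α} {B : Finset (Finset α)}
    (hT : IsPSTS V B) {X Y Z U : Finset α}
    (h₁ : X ∈ B) (h₂ : Y ∈ B) (h₃ : Z ∈ B)
    (hd₁₂ : Disjoint X Y) (hd₁₃ : Disjoint X Z) (hd₂₃ : Disjoint Y Z)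
    (hU : U = X ∪ Y ∪ Z) {f : ℕ → α} {l i j k : ℕ} (hl : l < 12) (hi : i + 2 < 12)
    (hj : j + 2 < 12) (hk : k + 2 < 12)
    (hX : X = {f i, f (i + 1), f (i + 2)}) (hY : Y = {f j, f (j + 1), f (j + 2)})
    (hZ : Z = {f k, f (k + 1), f (k + 2)}) (ha : f l ∉ U) (hD : DD B U X (f l)) :
      ((∃ s ∈ sg l (i + 1) (i + 2) j k, ∀ m ∈ s, QQ B f m) ∧
        (∃ s ∈ sg l i (i + 2) j k, ∀ m ∈ s, QQ B f m)) ∨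
      ((∃ s ∈ sg l (i + 1) (i + 2) j k, ∀ m ∈ s, QQ B f m) ∧
        (∃ s ∈ sg l i (i + 1) j k, ∀ m ∈ s, QQ B f m)) ∨
      ((∃ s ∈ sg l i (i + 2) j k, ∀ m ∈ s, QQ B f m) ∧
        (∃ s ∈ sg l i (i + 1) j k, ∀ m ∈ s, QQ B f m)) := by
  obtain ⟨x, hx, y, hy, hxy, px, py⟩ := hD
  subst hU
  have hXc := (hT.1 _ h₁).2
  have hYc := (hT.1 _ h₂).2
  have hZc := (hT.1 _ h₃).2
  have key : ∀ x₀ x₁ x₂, x₀ < 12 → x₁ < 12 → x₂ < 12 → X = {f x₀, f x₁, f x₂} →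
      PartitionsInto3 B (insert (f l) ((X ∪ Y ∪ Z).erase (f x₀))) →
      ∃ s ∈ sg l x₁ x₂ j k, ∀ m ∈ s, QQ B f m := by
    intro x₀ x₁ x₂ l0 l1 l2 e hP
    obtain ⟨p, p', y, q, q', z, r, r', eX, eY, eZ, b1, b2, b3⟩ :=
      struct_main hT h₁ h₂ h₃ hd₁₂ hd₁₃ hd₂₃ ha (by rw [e]; simp) hP
    exact sg_mem hl l1 l2 hj hk e hXc hY hYc hZ hZc eX eY eZ b1 b2 b3
  have k0 := key i (i + 1) (i + 2) (by omega) (by omega) (by omega) hX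
  have k1 := key (i + 1) i (i + 2) (by omega) (by omega) (by omega)
    (by rw [hX]; exact tri₁ _ _ _)
  have k2 := key (i + 2) i (i + 1) (by omega) (by omega) (by omega)
    (by rw [hX]; exact tri₂ _ _ _)
  rw [hX] at hx hy
  simp only [Finset.mem_insert, Finset.mem_singleton] at hx hy
  clear key
  rcases hx with rfl | rfl | rfl <;> rcases hy with rfl | rfl | rfl
  · exact absurd rfl hxy
  · exact Or.inl ⟨k0 px, k1 py⟩
  · exact Or.inr (Or.inl ⟨k0 px, k2 py⟩)
  · exact Or.inl ⟨k0 py, k1 px⟩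
  · exact absurd rfl hxy
  · exact Or.inr (Or.inr ⟨k1 px, k2 py⟩)
  · exact Or.inr (Or.inl ⟨k0 py, k2 px⟩)
  · exact Or.inr (Or.inr ⟨k1 py, k2 px⟩)
  · exact absurd rfl hxy

theorem core {α : Type*} [DecidableEq α] {V : Finset α} {B : Finset (Finset α)}
    (hT : IsPSTS V B) (h12 : V.card = 12) {B₁ B₂ B₃ U : Finset α}
    (h₁ : B₁ ∈ B) (h₂ : B₂ ∈ B) (h₃ : B₃ ∈ B)
    (hd₁₂ : Disjoint B₁ B₂) (hd₁₃ : Disjoint B₁ B₃) (hd₂₃ : Disjoint B₂ B₃)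
    (hU : U = B₁ ∪ B₂ ∪ B₃) {a b c : α} (hV : V = U ∪ {a, b, c})
    (ha : a ∉ U) (hb : b ∉ U) (hc : c ∉ U)
    (Da : DD B U B₁ a) (Db : DD B U B₁ b ∨ DD B U B₂ b ∨ DD B U B₃ b)
    (Dc : DD B U B₁ c ∨ DD B U B₂ c ∨ DD B U B₃ c) : False := by
  obtain ⟨x, hx, x', hx', hne, px, px'⟩ := Da
  have px0 := px
  rw [hU] at px
  obtain ⟨p, p', y, q, q', z, r, r', eX, eY, eZ, b1, b2, b3⟩ :=
      struct_main hT h₁ h₂ h₃ hd₁₂ hd₁₃ hd₂₃ (hU ▸ ha) hx px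
  set f : ℕ → α := fun n => [x, p, p', y, q, q', z, r, r', a, b, c].getD n a with hfdef
  have hVf : V = (Finset.range 12).image f := by
    rw [hV, hU, eX, eY, eZ]
    ext t
    simp only [Finset.range_eq_Ico, Finset.mem_union, Finset.mem_insert, Finset.mem_singleton,
      Finset.mem_image, Finset.mem_Ico]
    constructor
    · intro h
      rcases h with (((h | h | h) | h | h | h) | h | h | h) | h | h | h
      · exact ⟨0, by omega, h.symm⟩
      · exact ⟨1, by omega, h.symm⟩
      · exact ⟨2, by omega, h.symm⟩
      · exact ⟨3, by omega, h.symm⟩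
      · exact ⟨4, by omega, h.symm⟩
      · exact ⟨5, by omega, h.symm⟩
      · exact ⟨6, by omega, h.symm⟩
      · exact ⟨7, by omega, h.symm⟩
      · exact ⟨8, by omega, h.symm⟩
      · exact ⟨9, by omega, h.symm⟩
      · exact ⟨10, by omega, h.symm⟩
      · exact ⟨11, by omega, h.symm⟩
    · rintro ⟨n, ⟨-, hn⟩, rfl⟩
      interval_cases n <;> simp [hfdef]
  have hinj : Set.InjOn f (Finset.range 12 : Finset ℕ) := by
    rw [← Finset.card_image_iff, ← hVf, h12, Finset.card_range]
  have hf : ∀ i < 12, ∀ j < 12, f i = f j → i = j := by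
    intro i hi j hj h
    exact hinj (by simpa using hi) (by simpa using hj) h
  have hQ : ∀ m n, QQ B f m → QQ B f n → okm m n = true := fun m n => QQ_ok hT hf
  have fX : B₁ = {f 0, f (0 + 1), f (0 + 2)} := eX
  have fY : B₂ = {f 3, f (3 + 1), f (3 + 2)} := eY
  have fZ : B₃ = {f 6, f (6 + 1), f (6 + 2)} := eZ
  have hU2 : U = B₂ ∪ B₁ ∪ B₃ := by rw [hU, Finset.union_comm B₂]
  have hU3 : U = B₃ ∪ B₁ ∪ B₂ := by rw [hU, Finset.union_assoc B₃, Finset.union_comm B₃]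
  have sel : ∀ l < 12, f l ∉ U → (DD B U B₁ (f l) ∨ DD B U B₂ (f l) ∨ DD B U B₃ (f l)) →
      ∃ u ∈ [(0, 3, 6), (3, 0, 6), (6, 0, 3)],
      ((∃ s ∈ sg l (u.1 + 1) (u.1 + 2) u.2.1 u.2.2, ∀ m ∈ s, QQ B f m) ∧
        (∃ s ∈ sg l u.1 (u.1 + 2) u.2.1 u.2.2, ∀ m ∈ s, QQ B f m)) ∨
      ((∃ s ∈ sg l (u.1 + 1) (u.1 + 2) u.2.1 u.2.2, ∀ m ∈ s, QQ B f m) ∧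
        (∃ s ∈ sg l u.1 (u.1 + 1) u.2.1 u.2.2, ∀ m ∈ s, QQ B f m)) ∨
      ((∃ s ∈ sg l u.1 (u.1 + 2) u.2.1 u.2.2, ∀ m ∈ s, QQ B f m) ∧
        (∃ s ∈ sg l u.1 (u.1 + 1) u.2.1 u.2.2, ∀ m ∈ s, QQ B f m)) := by
    intro l hl hlU hD
    rcases hD with hD | hD | hD
    · exact ⟨(0, 3, 6), by simp, dd_sg hT h₁ h₂ h₃ hd₁₂ hd₁₃ hd₂₃ hU hl (by simp) (by simp)
        (by simp) fX fY fZ hlU hD⟩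
    · exact ⟨(3, 0, 6), by simp, dd_sg hT h₂ h₁ h₃ hd₁₂.symm hd₂₃ hd₁₃ hU2 hl (by simp)
        (by simp) (by simp) fY fX fZ hlU hD⟩
    · exact ⟨(6, 0, 3), by simp, dd_sg hT h₃ h₁ h₂ hd₁₃.symm hd₂₃.symm hd₁₂ hU3 hl (by simp)
        (by simp) (by simp) fZ fX fY hlU hD⟩
  have hstart : ∀ m ∈ [mk3 9 3 6, mk3 1 4 7, mk3 2 5 8], QQ B f m := by
    intro m hm
    simp only [List.mem_cons, List.not_mem_nil, or_false] at hm
    rcases hm with rfl | rfl | rfl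
    · exact ⟨9, 3, 6, by omega, by omega, by omega, rfl, b1⟩
    · exact ⟨1, 4, 7, by omega, by omega, by omega, rfl, b2⟩
    · exact ⟨2, 5, 8, by omega, by omega, by omega, rfl, b3⟩
  have hsec : ∃ s ∈ sg 9 0 2 3 6 ++ sg 9 0 1 3 6, ∀ m ∈ s, QQ B f m := by
    rw [hU] at px'
    obtain ⟨P, P', Y, Q, Q', Z, R, R', EX, EY, EZ, c1, c2, c3⟩ :=
      struct_main hT h₁ h₂ h₃ hd₁₂ hd₁₃ hd₂₃ (hU ▸ ha) hx' px'
    have hXc := (hT.1 _ h₁).2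
    have hYc := (hT.1 _ h₂).2
    have hZc := (hT.1 _ h₃).2
    have hx2 := hx'
    rw [eX] at hx2
    simp only [Finset.mem_insert, Finset.mem_singleton] at hx2
    rcases hx2 with h | h | h
    · exact absurd h.symm hne
    · have hh : x' = f 1 := h
      rw [hh] at EX
      obtain ⟨s, hs, hm⟩ := sg_mem (l := 9) (x₀ := 1) (x₁ := 0) (x₂ := 2) (j := 3) (k := 6)
        (by omega) (by omega) (by omega) (by omega) (by omega)
        (by rw [fX]; exact tri₁ _ _ _)
        hXc fY hYc fZ hZc EX EY EZ c1 c2 c3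
      exact ⟨s, List.mem_append_left _ hs, hm⟩
    · have hh : x' = f 2 := h
      rw [hh] at EX
      obtain ⟨s, hs, hm⟩ := sg_mem (l := 9) (x₀ := 2) (x₁ := 0) (x₂ := 1) (j := 3) (k := 6)
        (by omega) (by omega) (by omega) (by omega) (by omega)
        (by rw [fX]; exact tri₂ _ _ _)
        hXc fY hYc fZ hZc EX EY EZ c1 c2 c3
      exact ⟨s, List.mem_append_right _ hs, hm⟩
  have hfull := fullCheck_true
  rw [fullCheck] at hfull
  obtain ⟨w1, hw1, hk1⟩ := extd_sound hQ hstart hsec hfull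
  obtain ⟨w2, hw2, hk2⟩ := two_sound hQ hw1 (sel 10 (by omega) hb Db) hk1
  obtain ⟨w3, hw3, hk3⟩ := two_sound hQ hw2 (sel 11 (by omega) hc Dc) hk2
  simp at hk3

theorem dd_of {α : Type*} [DecidableEq α] {V : Finset α} {B : Finset (Finset α)}
    (hT : IsPSTS V B) {U X : Finset α} (hX : X ∈ B) (hXU : X ⊆ U) {a b c : α}
    (hV : V = U ∪ {a, b, c}) (ha : a ∉ U) (hb : b ∉ U) (hc : c ∉ U) (hab : a ≠ b) (hac : a ≠ c)
    (h : ¬ ∃ α₁ ∈ X, ∃ α₂ ∈ X, α₁ ≠ α₂ ∧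
          ¬ PartitionsInto3 B (V \ {b, c, α₁}) ∧
          ¬ PartitionsInto3 B (V \ {b, c, α₂})) : DD B U X a := by
  have e : ∀ x ∈ X, V \ {b, c, x} = insert a (U.erase x) := by
    intro x hx
    have := hXU hx
    rw [hV]
    ext t
    simp only [Finset.mem_sdiff, Finset.mem_union, Finset.mem_insert, Finset.mem_singleton,
      Finset.mem_erase]
    grind
  obtain ⟨x, y, z, hxy, hxz, hyz, rfl⟩ := Finset.card_eq_three.1 (hT.1 _ hX).2
  have mx : x ∈ ({x, y, z} : Finset α) := by simp
  have my : y ∈ ({x, y, z} : Finset α) := by simp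
  have mz : z ∈ ({x, y, z} : Finset α) := by simp
  push Not at h
  have i1 := h x mx y my hxy
  have i2 := h x mx z mz hxz
  have i3 := h y my z mz hyz
  rw [e x mx, e y my] at i1
  rw [e x mx, e z mz] at i2
  rw [e y my, e z mz] at i3
  by_cases qx : PartitionsInto3 B (insert a (U.erase x))
  · by_cases qy : PartitionsInto3 B (insert a (U.erase y))
    · exact ⟨x, mx, y, my, hxy, qx, qy⟩
    · exact ⟨x, mx, z, mz, hxz, qx, i3 qy⟩
  · exact ⟨y, my, z, mz, hyz, i1 qx, i2 qx⟩

/-- In a partial Steiner triple system of order 12 with three pairwise disjoint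
blocks `B₁, B₂, B₃` but no four pairwise disjoint blocks, there is a point
`a` of the set `L` of the three remaining points, with `L \ {a} = {b, c}`, such
that each `Bᵢ` contains at least two points `α` for which `{b, c, α}` is good,
i.e. `V \ {b, c, α}` has no partition into three pairwise disjoint blocks. -/
theorem two_replacements_exist {α : Type*} [DecidableEq α]
    (V : Finset α) (B : Finset (Finset α)) (hT : IsPSTS V B)
    (h12 : V.card = 12) (B₁ B₂ B₃ : Finset α)
    (h₁ : B₁ ∈ B) (h₂ : B₂ ∈ B) (h₃ : B₃ ∈ B)
    (hd₁₂ : Disjoint B₁ B₂) (hd₁₃ : Disjoint B₁ B₃) (hd₂₃ : Disjoint B₂ B₃)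
    (h4 : ¬ HasDisjointBlocks B 4) (L : Finset α)
    (hL : L = V \ (B₁ ∪ B₂ ∪ B₃)) :
    ∃ a ∈ L, ∃ b c : α, b ≠ c ∧ L = {a, b, c} ∧
      ∀ Bi ∈ ({B₁, B₂, B₃} : Finset (Finset α)),
        ∃ α₁ ∈ Bi, ∃ α₂ ∈ Bi, α₁ ≠ α₂ ∧
          ¬ PartitionsInto3 B (V \ {b, c, α₁}) ∧
          ¬ PartitionsInto3 B (V \ {b, c, α₂}) := by
  by_contra hcon
  push Not at hcon
  set U := B₁ ∪ B₂ ∪ B₃ with hU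
  have hUV : U ⊆ V :=
    Finset.union_subset (Finset.union_subset (hT.1 _ h₁).1 (hT.1 _ h₂).1) (hT.1 _ h₃).1
  have hUc : U.card = 9 := by
    rw [hU, Finset.card_union_of_disjoint, Finset.card_union_of_disjoint hd₁₂,
      (hT.1 _ h₁).2, (hT.1 _ h₂).2, (hT.1 _ h₃).2]
    exact Finset.disjoint_union_left.2 ⟨hd₁₃, hd₂₃⟩
  have hLc : L.card = 3 := by
    rw [hL, Finset.card_sdiff_of_subset hUV, h12, hUc]
  obtain ⟨a, b, c, hab, hac, hbc, hLe⟩ := Finset.card_eq_three.1 hLc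
  have hV : V = U ∪ {a, b, c} := by
    rw [← hLe, hL, Finset.union_sdiff_of_subset hUV]
  have nU : ∀ t ∈ L, t ∉ U := by
    intro t ht
    rw [hL] at ht
    exact (Finset.mem_sdiff.1 ht).2
  have ha : a ∉ U := nU a (by rw [hLe]; simp)
  have hb : b ∉ U := nU b (by rw [hLe]; simp)
  have hc : c ∉ U := nU c (by rw [hLe]; simp)
  have s1 : B₁ ⊆ U := fun t ht => by simp [hU, ht]
  have s2 : B₂ ⊆ U := fun t ht => by simp [hU, ht]
  have s3 : B₃ ⊆ U := fun t ht => by simp [hU, ht]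
  have step : ∀ a b c : α, L = {a, b, c} → a ∉ U → b ∉ U → c ∉ U → a ≠ b → a ≠ c → b ≠ c →
      DD B U B₁ a ∨ DD B U B₂ a ∨ DD B U B₃ a := by
    intro a b c hLe ha hb hc hab hac hbc
    have hV : V = U ∪ {a, b, c} := by
      rw [← hLe, hL, Finset.union_sdiff_of_subset hUV]
    obtain ⟨Bi, hBi, h⟩ := hcon a (by rw [hLe]; simp) b c hbc hLe
    have h' : ¬ ∃ α₁ ∈ Bi, ∃ α₂ ∈ Bi, α₁ ≠ α₂ ∧
          ¬ PartitionsInto3 B (V \ {b, c, α₁}) ∧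
          ¬ PartitionsInto3 B (V \ {b, c, α₂}) := by
      push Not
      exact h
    simp only [Finset.mem_insert, Finset.mem_singleton] at hBi
    rcases hBi with rfl | rfl | rfl
    · exact Or.inl (dd_of hT h₁ s1 hV ha hb hc hab hac h')
    · exact Or.inr (Or.inl (dd_of hT h₂ s2 hV ha hb hc hab hac h'))
    · exact Or.inr (Or.inr (dd_of hT h₃ s3 hV ha hb hc hab hac h'))
  have Da := step a b c hLe ha hb hc hab hac hbc
  have Db := step b a c (by rw [hLe, Finset.insert_comm]) hb ha hc hab.symm hbc hac
  have Dc := step c a b (by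
    rw [hLe]; exact tri₂ _ _ _)
    hc ha hb hac.symm hbc.symm hab
  rcases Da with Da | Da | Da
  · exact core hT h12 h₁ h₂ h₃ hd₁₂ hd₁₃ hd₂₃ hU hV ha hb hc Da Db Dc
  · exact core hT h12 h₂ h₁ h₃ hd₁₂.symm hd₂₃ hd₁₃
      (by rw [hU, Finset.union_comm B₂]) hV ha hb hc Da (or_left_comm.1 Db) (or_left_comm.1 Dc)
  · exact core hT h12 h₃ h₁ h₂ hd₁₃.symm hd₂₃.symm hd₁₂
      (by rw [hU, Finset.union_assoc B₃, Finset.union_comm B₃]) hV ha hb hc Da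
      (or_rotate.1 (or_rotate.1 Db)) (or_rotate.1 (or_rotate.1 Dc))
end

section
/- Every partial Steiner triple system that does not contain four pairwise disjoint blocks (that is, has at most three pairwise disjoint blocks) is sequenceable. -/
/-- `S` can be partitioned into pairwise disjoint blocks from `B`. -/
def IsBlockPartition {α : Type*} [DecidableEq α] (B : Finset (Finset α))
    (S : Finset α) : Prop :=
  ∃ P : Finset (Finset α), P ⊆ B ∧ (P : Set (Finset α)).Pairwise Disjoint ∧
    P.biUnion id = S

/-- A PSTS is sequenceable if some sequence listing each point of `V` exactly once
has no proper (nonempty, not the whole sequence) segment that can be partitioned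
into pairwise disjoint blocks. -/
def Sequenceable {α : Type*} [DecidableEq α] (V : Finset α)
    (B : Finset (Finset α)) : Prop :=
  ∃ l : List α, l.Nodup ∧ l.toFinset = V ∧
    ∀ i m : ℕ, (l.drop i).take m ≠ [] → ((l.drop i).take m).length < l.length →
      ¬ IsBlockPartition B ((l.drop i).take m).toFinset

namespace PSeq

/-- nibble `i` of `s` -/
def pt (s i : ℕ) : ℕ := Nat.land (Nat.shiftRight s (Nat.mul 4 i)) 15

/-- bit mask of a triple -/
def mk (x y z : ℕ) : ℕ := Nat.lor (Nat.lor (Nat.pow 2 x) (Nat.pow 2 y)) (Nat.pow 2 z)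

/-- bit mask of a triple given by a three-nibble code -/
def msk (t : ℕ) : ℕ := mk (pt t 2) (pt t 1) (pt t 0)

/-- bit mask of the image of a coded triple under the coded map `s` -/
def act (s t : ℕ) : ℕ := mk (pt s (pt t 2)) (pt s (pt t 1)) (pt s (pt t 0))

/-- two distinct masks sharing two bits -/
def conf (k r : ℕ) : Bool :=
  !(Nat.beq k r) && !(Nat.beq (Nat.land (Nat.land k r) (Nat.sub (Nat.land k r) 1)) 0)

/-- the list contains `n` pairwise disjoint masks, all disjoint from `u` -/
def dj : List ℕ → ℕ → ℕ → Bool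
  | _, 0, _ => true
  | [], _ + 1, _ => false
  | k :: l, n + 1, u =>
    (Nat.beq (Nat.land u k) 0 && dj l n (Nat.lor u k)) || dj l (n + 1) u

/-- all ways to split a list of points into triples compatible with `M` -/
def enumL (M : List ℕ) : ℕ → List ℕ → List (List ℕ)
  | 0, _ => [[]]
  | _ + 1, [] => [[]]
  | n + 1, x :: r => r.flatMap fun y => r.flatMap fun z =>
      bif Nat.blt y z && !(M.any (conf (mk x y z))) then
        (enumL M n (r.filter fun u => !(Nat.beq u y) && !(Nat.beq u z))).map (mk x y z :: ·)
      else []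

def mem (k : ℕ) (l : List ℕ) : Bool := l.any (Nat.beq k)

/-- a splitting `p` is impossible, or contains a listed pattern -/
def okSplit (d : ℕ) (M : List ℕ) (pats : List (List ℕ)) (p : List ℕ) : Bool :=
  dj (p ++ M) d 0 ||
    pats.any (fun q => q.all (fun k => mem k p))

def checkW (d : ℕ) (M seq : List ℕ) (pats : List (List ℕ)) : Bool :=
  (List.range (seq.length + 1)).all fun i => (List.range d).all fun q =>
    Nat.beq q 0 || Nat.ble seq.length (3 * q) || Nat.blt seq.length (i + 3 * q) ||
      (enumL M d ((seq.drop i).take (3 * q))).all (okSplit d M pats)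

def orAll (s : ℕ) : ℕ → ℕ
  | 0 => 0
  | n + 1 => Nat.lor (orAll s n) (Nat.pow 2 (pt s n))

def ltN (N t : ℕ) : Bool := Nat.blt (pt t 2) N && (Nat.blt (pt t 1) N && Nat.blt (pt t 0) N)

/-- the coded map `s` permutes the points and maps `R` into the masks `U` -/
def okMap (N s : ℕ) (R : List ℕ) (U : List ℕ) : Bool :=
  Nat.beq (orAll s N) (Nat.sub (Nat.pow 2 N) 1) && R.all (fun t => mem (act s t) U)

/-- code list, mask list, certificates -/
abbrev St := List ℕ × List ℕ × List (ℕ × ℕ)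

def okCert (N : ℕ) (Mc : List ℕ) (U : List ℕ) (tl : List St) (c : ℕ × ℕ) : Bool :=
  match tl[c.1]? with
  | none => false
  | some st => okMap N c.2 (Mc ++ st.1) U

def checkS (N : ℕ) (Mc M : List ℕ) (U : List ℕ) (tl : List St) :
    List (List ℕ) → List (ℕ × ℕ) → Bool
  | [], _ => true
  | p :: ps, cs =>
    bif p.any (fun k => U.any (conf k)) then checkS N Mc M U tl ps cs
    else match cs with
      | [] => false
      | c :: cs => okCert N Mc (p ++ (U ++ M)) tl c && checkS N Mc M U tl ps cs

/-- the masks of the second list come from the codes of the first one -/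
def eqL : List ℕ → List ℕ → Bool
  | _, [] => true
  | [], _ :: _ => false
  | t :: ts, k :: ks => Nat.beq (msk t) k && eqL ts ks

def check (N : ℕ) (Mc M : List ℕ) (pats : List (List ℕ)) : List St → Bool
  | [] => true
  | st :: tl => eqL st.1 st.2.1 && (st.1.all (ltN N) &&
      (checkS N Mc M st.2.1 tl pats st.2.2 && check N Mc M pats tl))

section
variable {α : Type*} [DecidableEq α]

/-- the mask `k` describes a block under the labelling `f` -/
def HK (B : Finset (Finset α)) (N : ℕ) (f : ℕ → α) (k : ℕ) : Prop :=
  ∃ x y z, x < N ∧ y < N ∧ z < N ∧ k = mk x y z ∧ ({f x, f y, f z} : Finset α) ∈ B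

theorem testBit_mk (x y z i : ℕ) : (mk x y z).testBit i = true ↔ i = x ∨ i = y ∨ i = z := by
  have : mk x y z = (2 ^ x ||| 2 ^ y) ||| 2 ^ z := rfl
  rw [this]
  simp only [Nat.testBit_or, Nat.testBit_two_pow, Bool.or_eq_true, decide_eq_true_eq]
  tauto

theorem HK_spec {B : Finset (Finset α)} {N : ℕ} {f : ℕ → α} {k : ℕ}
    (hf : Set.InjOn f (Set.Iio N)) (h : HK B N f k) :
    ∃ b ∈ B, (∀ i, k.testBit i = true → i < N ∧ f i ∈ b) ∧
      (∀ i, i < N → f i ∈ b → k.testBit i = true) ∧ (∀ v ∈ b, ∃ i, i < N ∧ f i = v) := by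
  obtain ⟨x, y, z, hx, hy, hz, rfl, hb⟩ := h
  refine ⟨_, hb, ?_, ?_, ?_⟩
  · intro i hi
    rw [testBit_mk] at hi
    rcases hi with rfl | rfl | rfl <;> simp [*]
  · intro i hi hib
    rw [testBit_mk]
    simp only [Finset.mem_insert, Finset.mem_singleton] at hib
    rcases hib with h | h | h
    · exact Or.inl (hf hi hx h)
    · exact Or.inr (Or.inl (hf hi hy h))
    · exact Or.inr (Or.inr (hf hi hz h))
  · intro v hv
    simp only [Finset.mem_insert, Finset.mem_singleton] at hv
    rcases hv with rfl | rfl | rfl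
    · exact ⟨x, hx, rfl⟩
    · exact ⟨y, hy, rfl⟩
    · exact ⟨z, hz, rfl⟩

theorem two_bits (v : ℕ) (h : Nat.land v (Nat.sub v 1) ≠ 0) :
    ∃ i j, i ≠ j ∧ v.testBit i = true ∧ v.testBit j = true := by
  by_contra hc
  push Not at hc
  apply h
  change v &&& (v - 1) = 0
  by_cases hv : v = 0
  · subst hv; simp
  obtain ⟨i, hi⟩ := Nat.exists_testBit_of_ne_zero hv
  have : v = 2 ^ i := by
    apply Nat.eq_of_testBit_eq
    intro j
    rw [Nat.testBit_two_pow]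
    by_cases hij : i = j
    · subst hij; simp [hi]
    · have := hc i j hij hi
      simp [hij, this]
  rw [this, Nat.and_two_pow_sub_one_eq_mod]
  simp

theorem conf_false {V : Finset α} {B : Finset (Finset α)} (hT : IsPSTS V B) {N : ℕ} {f : ℕ → α}
    (hf : Set.InjOn f (Set.Iio N)) {k r : ℕ} (hk : HK B N f k) (hr : HK B N f r)
    (hc : conf k r = true) : False := by
  obtain ⟨b, hb, hb1, hb2, -⟩ := HK_spec hf hk
  obtain ⟨c, hc', hc1, hc2, -⟩ := HK_spec hf hr
  simp only [conf, Bool.and_eq_true, Bool.not_eq_true', ← Bool.not_eq_true, Nat.beq_eq] at hc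
  obtain ⟨hne, h2⟩ := hc
  obtain ⟨i, j, hij, hi, hj⟩ := two_bits _ h2
  have hi' : (k &&& r).testBit i = true := hi
  have hj' : (k &&& r).testBit j = true := hj
  rw [Nat.testBit_and, Bool.and_eq_true] at hi' hj'
  have hbc : b ≠ c := by
    rintro rfl
    apply hne
    apply Nat.eq_of_testBit_eq
    intro l
    rw [Bool.eq_iff_iff]
    exact ⟨fun h => hc2 l (hb1 l h).1 (hb1 l h).2, fun h => hb2 l (hc1 l h).1 (hc1 l h).2⟩
  have hcard := hT.2 b hb c hc' hbc
  rw [Finset.card_le_one] at hcard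
  have := hcard (f i) (Finset.mem_inter.2 ⟨(hb1 i hi'.1).2, (hc1 i hi'.2).2⟩)
    (f j) (Finset.mem_inter.2 ⟨(hb1 j hj'.1).2, (hc1 j hj'.2).2⟩)
  exact hij (hf (hb1 i hi'.1).1 (hb1 j hj'.1).1 this)

theorem dj_spec {V : Finset α} {B : Finset (Finset α)} (hT : IsPSTS V B) {N : ℕ} {f : ℕ → α}
    (hf : Set.InjOn f (Set.Iio N)) (l : List ℕ) :
    ∀ (n u : ℕ) (P : Finset (Finset α)), P ⊆ B → (P : Set (Finset α)).Pairwise Disjoint →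
      (∀ b ∈ P, ∀ i, i < N → f i ∈ b → u.testBit i = true) →
      (∀ k ∈ l, HK B N f k) → dj l n u = true → HasDisjointBlocks B (P.card + n) := by
  induction l with
  | nil =>
    intro n u P hP hd hu hl h
    cases n with
    | zero => exact ⟨P, hP, rfl, hd⟩
    | succ n => simp [dj] at h
  | cons k l ih =>
    intro n u P hP hd hu hl h
    cases n with
    | zero => exact ⟨P, hP, rfl, hd⟩
    | succ n =>
      simp only [dj, Bool.or_eq_true, Bool.and_eq_true, Nat.beq_eq] at h
      rcases h with ⟨h0, h⟩ | h
      · obtain ⟨b, hb, hb1, hb2, hb3⟩ := HK_spec hf (hl k (by simp))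
        have h0' : u &&& k = 0 := h0
        have hdis : ∀ c ∈ P, Disjoint c b := by
          intro c hc
          rw [Finset.disjoint_left]
          intro v hvc hvb
          obtain ⟨i, hi, rfl⟩ := hb3 v hvb
          have e1 := hu c hc i hi hvc
          have e2 := hb2 i hi hvb
          have : (u &&& k).testBit i = true := by simp [Nat.testBit_and, e1, e2]
          rw [h0'] at this
          simp at this
        have hbP : b ∉ P := by
          intro hbP
          have := hdis b hbP
          rw [disjoint_self] at this
          have h3 := (hT.1 b hb).2
          rw [this] at h3
          simp at h3
        have := ih n (Nat.lor u k) (insert b P) ?_ ?_ ?_ (fun k hk => hl k (by simp [hk])) h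
        · rw [Finset.card_insert_of_notMem hbP] at this
          rwa [show P.card + (n + 1) = P.card + 1 + n by ring]
        · intro c hc
          rcases Finset.mem_insert.1 hc with rfl | hc
          · exact hb
          · exact hP hc
        · rw [Finset.coe_insert]
          refine hd.insert ?_
          intro c hc _
          exact ⟨(hdis c hc).symm, hdis c hc⟩
        · intro c hc i hi hic
          change (u ||| k).testBit i = true
          rw [Nat.testBit_or, Bool.or_eq_true]
          rcases Finset.mem_insert.1 hc with rfl | hc
          · exact Or.inr (hb2 i hi hic)
          · exact Or.inl (hu c hc i hi hic)
      · exact ih (n + 1) u P hP hd hu (fun k hk => hl k (by simp [hk])) h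

theorem enumL_spec {V : Finset α} {B : Finset (Finset α)} (hT : IsPSTS V B) {N : ℕ} {f : ℕ → α}
    (hf : Set.InjOn f (Set.Iio N)) (M : List ℕ) (hM : ∀ k ∈ M, HK B N f k) :
    ∀ (n : ℕ) (ws : List ℕ), ws.Nodup → (∀ x ∈ ws, x < N) → ∀ P : Finset (Finset α), P ⊆ B →
      (P : Set (Finset α)).Pairwise Disjoint → P.biUnion id = (ws.map f).toFinset →
      ∃ p ∈ enumL M n ws, ∀ k ∈ p, HK B N f k := by
  intro n
  induction n with
  | zero => intro ws _ _ P _ _ _; exact ⟨[], by simp [enumL], by simp⟩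
  | succ n ih =>
    intro ws hnd hN P hP hd hU
    cases ws with
    | nil => exact ⟨[], by simp [enumL], by simp⟩
    | cons x r =>
      have hx : f x ∈ P.biUnion id := by rw [hU]; simp
      obtain ⟨b, hbP, hxb⟩ := Finset.mem_biUnion.1 hx
      simp only [id] at hxb
      have hb3 := (hT.1 b (hP hbP)).2
      have hsub : ∀ v ∈ b, ∃ i ∈ x :: r, f i = v := by
        intro v hv
        have : v ∈ P.biUnion id := Finset.mem_biUnion.2 ⟨b, hbP, hv⟩
        rw [hU] at this
        simp only [List.mem_toFinset, List.mem_map] at this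
        exact this
      have hc2 : (b.erase (f x)).card = 2 := by rw [Finset.card_erase_of_mem hxb, hb3]
      obtain ⟨v, w, hvw, hb⟩ := Finset.card_eq_two.1 hc2
      have hbe : b = {f x, v, w} := by rw [← Finset.insert_erase hxb, hb]
      have hvb : v ∈ b.erase (f x) := by rw [hb]; simp
      have hwb : w ∈ b.erase (f x) := by rw [hb]; simp
      rw [Finset.mem_erase] at hvb hwb
      have hv' : ∃ y ∈ r, f y = v := by
        obtain ⟨y, hy, rfl⟩ := hsub v hvb.2
        rcases List.mem_cons.1 hy with rfl | hy
        · exact absurd rfl hvb.1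
        · exact ⟨y, hy, rfl⟩
      have hw' : ∃ y ∈ r, f y = w := by
        obtain ⟨y, hy, rfl⟩ := hsub w hwb.2
        rcases List.mem_cons.1 hy with rfl | hy
        · exact absurd rfl hwb.1
        · exact ⟨y, hy, rfl⟩
      obtain ⟨y0, hy0, rfl⟩ := hv'
      obtain ⟨z0, hz0, rfl⟩ := hw'
      have hyz : ∃ y z, y ∈ r ∧ z ∈ r ∧ y < z ∧ b = {f x, f y, f z} := by
        rcases lt_trichotomy y0 z0 with h | h | h
        · exact ⟨y0, z0, hy0, hz0, h, hbe⟩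
        · exact absurd (congrArg f h) hvw
        · refine ⟨z0, y0, hz0, hy0, h, ?_⟩
          rw [hbe, Finset.pair_comm]
      obtain ⟨y, z, hy, hz, hlt, hbe⟩ := hyz
      have hH : HK B N f (mk x y z) :=
        ⟨x, y, z, hN x (by simp), hN y (by simp [hy]), hN z (by simp [hz]), rfl,
          hbe ▸ hP hbP⟩
      have hnc : M.any (conf (mk x y z)) = false := by
        rw [← Bool.not_eq_true, List.any_eq_true]
        rintro ⟨k, hk, hc⟩
        exact conf_false hT hf hH (hM k hk) hc
      rw [List.nodup_cons] at hnd
      set r' := r.filter (fun u => !(Nat.beq u y) && !(Nat.beq u z)) with hr'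
      have hmem : ∀ u, u ∈ r' ↔ u ∈ r ∧ u ≠ y ∧ u ≠ z := by
        intro u
        simp only [hr', List.mem_filter, Bool.and_eq_true, Bool.not_eq_true',
          ← Bool.not_eq_true, Nat.beq_eq]
      obtain ⟨p, hp, hpk⟩ := ih r' (hnd.2.filter _)
        (fun u hu => hN u (by simp [((hmem u).1 hu).1])) (P.erase b)
        ((Finset.erase_subset _ _).trans hP)
        (hd.mono (by simp)) (by
          ext v
          simp only [Finset.mem_biUnion, Finset.mem_erase, id, List.mem_toFinset, List.mem_map]
          constructor
          · rintro ⟨c, ⟨hcb, hcP⟩, hvc⟩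
            have hvU : v ∈ P.biUnion id := Finset.mem_biUnion.2 ⟨c, hcP, hvc⟩
            rw [hU] at hvU
            have hdv : v ∉ b := fun hvb =>
              (Finset.disjoint_left.1 (hd hcP hbP hcb)) hvc hvb
            simp only [List.mem_toFinset, List.mem_map, List.mem_cons] at hvU
            obtain ⟨u, hu, rfl⟩ := hvU
            refine ⟨u, ?_, rfl⟩
            rw [hmem]
            rw [hbe] at hdv
            simp only [Finset.mem_insert, Finset.mem_singleton, not_or] at hdv
            refine ⟨?_, fun h => hdv.2.1 (h ▸ rfl), fun h => hdv.2.2 (h ▸ rfl)⟩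
            rcases hu with rfl | hu
            · exact absurd rfl hdv.1
            · exact hu
          · rintro ⟨u, hu, rfl⟩
            rw [hmem] at hu
            have hvU : f u ∈ P.biUnion id := by
              rw [hU]
              simp only [List.mem_toFinset, List.mem_map]
              exact ⟨u, by simp [hu.1], rfl⟩
            obtain ⟨c, hcP, hvc⟩ := Finset.mem_biUnion.1 hvU
            refine ⟨c, ⟨?_, hcP⟩, hvc⟩
            rintro rfl
            simp only [id] at hvc
            rw [hbe] at hvc
            simp only [Finset.mem_insert, Finset.mem_singleton] at hvc
            have huN := hN u (by simp [hu.1])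
            rcases hvc with h | h | h
            · have := hf huN (hN x (by simp)) h
              subst this
              exact hnd.1 hu.1
            · exact hu.2.1 (hf huN (hN y (by simp [hy])) h)
            · exact hu.2.2 (hf huN (hN z (by simp [hz])) h))
      refine ⟨mk x y z :: p, ?_, ?_⟩
      · simp only [enumL, List.mem_flatMap]
        refine ⟨y, hy, z, hz, ?_⟩
        have hb : Nat.blt y z = true := by simpa [Nat.blt_eq] using hlt
        rw [hb, hnc]
        simp only [Bool.not_false, Bool.and_true, cond_true, List.mem_map]
        exact ⟨p, hp, rfl⟩
      · intro k hk
        rcases List.mem_cons.1 hk with rfl | hk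
        · exact hH
        · exact hpk k hk

def orL : List ℕ → ℕ
  | [] => 0
  | x :: l => Nat.lor (Nat.pow 2 x) (orL l)

theorem testBit_orL (l : List ℕ) (i : ℕ) : i ∈ l → (orL l).testBit i = true := by
  induction l with
  | nil => simp
  | cons x l ih =>
    intro h
    change (2 ^ x ||| orL l).testBit i = true
    rw [Nat.testBit_or, Bool.or_eq_true]
    rcases List.mem_cons.1 h with rfl | h
    · left; simp
    · exact Or.inr (ih h)

theorem mem_spec {k : ℕ} {l : List ℕ} (h : mem k l = true) : k ∈ l := by
  simp only [mem, List.any_eq_true, Nat.beq_eq] at h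
  obtain ⟨x, hx, rfl⟩ := h
  exact hx

theorem good {V : Finset α} {B : Finset (Finset α)} (hT : IsPSTS V B) {d : ℕ}
    (h4 : ¬ HasDisjointBlocks B d) {N : ℕ} {M seq : List ℕ} {pats : List (List ℕ)}
    (hW : checkW d M seq pats = true) (hnd : seq.Nodup) (hmem : ∀ x, x ∈ seq ↔ x < N)
    (hrest : V.card = N ∨ ∀ q, 1 ≤ q → q < d →
      3 * q < N ∧ dj M (d - q) (orL (seq.take (3 * q - 1))) = true)
    {f : ℕ → α} (hf : Set.InjOn f (Set.Iio N)) (hfV : ∀ i, i < N → f i ∈ V)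
    (hM : ∀ k ∈ M, HK B N f k) :
    Sequenceable V B ∨ ∃ p ∈ pats, ∀ k ∈ p, HK B N f k := by
  have hlen : seq.length = N := by
    have : seq.toFinset = Finset.range N := by ext x; simp [hmem]
    rw [← List.toFinset_card_of_nodup hnd, this, Finset.card_range]
  set I : Finset α := (Finset.range N).image f with hI
  have hIV : I ⊆ V := by
    intro v hv
    simp only [hI, Finset.mem_image, Finset.mem_range] at hv
    obtain ⟨i, hi, rfl⟩ := hv
    exact hfV i hi
  have hIc : I.card = N := by
    rw [hI, Finset.card_image_of_injOn, Finset.card_range]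
    intro a ha b hb h
    exact hf (by simpa using ha) (by simpa using hb) h
  set rest := (V \ I).toList with hrestdef
  have hrestI : ∀ v, v ∈ rest ↔ v ∈ V ∧ v ∉ I := by intro v; simp [hrestdef]
  have hmapI : ∀ v, v ∈ seq.map f ↔ v ∈ I := by
    intro v; simp [hI, hmem]
  have hmapnd : (seq.map f).Nodup := by
    refine List.Nodup.map_on ?_ hnd
    intro x hx y hy h
    exact hf ((hmem x).1 hx) ((hmem y).1 hy) h
  have hlnd : (rest ++ seq.map f).Nodup := by
    refine List.Nodup.append (Finset.nodup_toList _) hmapnd ?_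
    intro v hv hv'
    exact ((hrestI v).1 hv).2 ((hmapI v).1 hv')
  by_cases H : ∀ i m : ℕ, ((rest ++ seq.map f).drop i).take m ≠ [] →
      (((rest ++ seq.map f).drop i).take m).length < (rest ++ seq.map f).length →
      ¬ IsBlockPartition B (((rest ++ seq.map f).drop i).take m).toFinset
  · left
    refine ⟨rest ++ seq.map f, hlnd, ?_, H⟩
    ext v
    rw [List.mem_toFinset, List.mem_append, hrestI, hmapI]
    constructor
    · rintro (h | h)
      · exact h.1
      · exact hIV h
    · intro h
      by_cases hv : v ∈ I
      · exact Or.inr hv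
      · exact Or.inl ⟨h, hv⟩
  right
  push Not at H
  obtain ⟨i, m, hne, hlt, P, hP, hd, hU⟩ := H
  set W := ((rest ++ seq.map f).drop i).take m with hWdef
  have hWnd : W.Nodup :=
    hlnd.sublist ((List.take_sublist _ _).trans (List.drop_sublist _ _))
  have hWlen : W.length = 3 * P.card := by
    rw [← List.toFinset_card_of_nodup hWnd, ← hU, Finset.card_biUnion]
    · exact (Finset.sum_const_nat (m := 3) (fun b hb => (hT.1 b (hP hb)).2)).trans (mul_comm _ _)
    · intro x hx y hy hxy
      exact hd hx hy hxy
  have hq1 : 1 ≤ P.card := by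
    have : 0 < W.length := List.length_pos_iff.2 hne
    omega
  have hqd : P.card < d := by
    by_contra hc
    push Not at hc
    obtain ⟨Q, hQ, hQc⟩ := Finset.exists_subset_card_eq hc
    exact h4 ⟨Q, hQ.trans hP, hQc, hd.mono (by exact_mod_cast hQ)⟩
  by_cases hi : i < rest.length
  · exfalso
    rcases hrest with hN | hrest
    · have hIeq : I = V := Finset.eq_of_subset_of_card_le hIV (by omega)
      have : rest = [] := by simp [hrestdef, hIeq]
      rw [this] at hi
      simp at hi
    obtain ⟨-, hdj⟩ := hrest _ hq1 hqd
    have hM4 := dj_spec hT hf M _ _ P hP hd ?_ hM hdj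
    · rw [show P.card + (d - P.card) = d by omega] at hM4
      exact h4 hM4
    intro b hb j hj hjb
    have hjW : f j ∈ W := by
      rw [← List.mem_toFinset, ← hU]
      exact Finset.mem_biUnion.2 ⟨b, hb, hjb⟩
    have hfI : f j ∈ I := by
      rw [hI]; exact Finset.mem_image.2 ⟨j, by simpa using hj, rfl⟩
    apply testBit_orL
    have hWs : W = (rest.drop i).take m ++ (seq.map f).take (m - (rest.drop i).length) := by
      rw [hWdef, List.drop_append_of_le_length hi.le, List.take_append]
    have hlen2 := congrArg List.length hWs
    rw [List.length_append] at hlen2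
    rw [hWs, List.mem_append] at hjW
    rcases hjW with h | h
    · exact absurd hfI ((hrestI _).1 (List.mem_of_mem_drop (List.mem_of_mem_take h))).2
    rw [List.mem_take_iff_getElem] at h
    obtain ⟨e, he, hej⟩ := h
    rw [List.getElem_map] at hej
    simp only [List.length_map, List.length_take, List.length_drop] at he hlen2
    have hje : seq[e]'(by omega) = j := hf ((hmem _).1 (List.getElem_mem _)) hj hej
    rw [List.mem_take_iff_getElem]
    exact ⟨e, by omega, hje⟩
  · push Not at hi
    set i' := i - rest.length with hi'
    have hdrop : (rest ++ seq.map f).drop i = (seq.map f).drop i' := by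
      rw [List.drop_append]
      simp [List.drop_eq_nil_of_le hi, hi']
    have hWm : W = ((seq.drop i').take m).map f := by
      rw [hWdef, hdrop, List.map_take, List.map_drop]
    have hl1 : ((seq.drop i').take m).length = 3 * P.card := by
      rw [← hWlen, hWm, List.length_map]
    have hl2 := hl1
    rw [List.length_take, List.length_drop] at hl2
    have hws : (seq.drop i').take m = (seq.drop i').take (3 * P.card) := by
      rw [List.take_eq_take_iff, List.length_drop]
      omega
    have h3N : 3 * P.card < N := by
      rcases hrest with hN | hrest
      · have hIeq : I = V := Finset.eq_of_subset_of_card_le hIV (by omega)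
        have : rest = [] := by simp [hrestdef, hIeq]
        rw [this, List.nil_append, List.length_map] at hlt
        omega
      · exact (hrest _ hq1 hqd).1
    obtain ⟨p, hp, hpk⟩ := enumL_spec hT hf M hM d ((seq.drop i').take (3 * P.card))
      (hnd.sublist ((List.take_sublist _ _).trans (List.drop_sublist _ _)))
      (fun x hx => (hmem x).1 (List.mem_of_mem_drop (List.mem_of_mem_take hx)))
      P hP hd (by rw [hU, hWm, hws])
    simp only [checkW, List.all_eq_true, List.mem_range] at hW
    have hc := hW i' (by omega) P.card hqd
    simp only [Bool.or_eq_true, Nat.beq_eq, Nat.ble_eq, Nat.blt_eq, List.all_eq_true] at hc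
    rcases hc with ((hc | hc) | hc) | hc
    · omega
    · omega
    · omega
    have hs := hc p hp
    simp only [okSplit, Bool.or_eq_true, List.any_eq_true, List.all_eq_true] at hs
    rcases hs with hs | ⟨q, hq, hqp⟩
    · exfalso
      have := dj_spec hT hf (p ++ M) d 0 ∅ (by simp) (by simp) (by simp) (by
        intro k hk
        rcases List.mem_append.1 hk with hk | hk
        · exact hpk k hk
        · exact hM k hk) hs
      simp only [Finset.card_empty, zero_add] at this
      exact h4 this
    · exact ⟨q, hq, fun k hk => hpk k (mem_spec (hqp k hk))⟩

theorem mk_eq {x y z x' y' z' : ℕ} (h : mk x y z = mk x' y' z') :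
    ({x, y, z} : Finset ℕ) = {x', y', z'} := by
  ext i
  simp only [Finset.mem_insert, Finset.mem_singleton]
  rw [← testBit_mk, ← testBit_mk, h]

theorem orAll_spec (s n i : ℕ) : (orAll s n).testBit i = true ↔ ∃ j, j < n ∧ pt s j = i := by
  induction n with
  | zero => simp [orAll]
  | succ n ih =>
    change (orAll s n ||| 2 ^ (pt s n)).testBit i = true ↔ _
    rw [Nat.testBit_or, Bool.or_eq_true, ih, Nat.testBit_two_pow, decide_eq_true_eq]
    constructor
    · rintro (⟨j, hj, h⟩ | h)
      · exact ⟨j, by omega, h⟩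
      · exact ⟨n, by omega, h⟩
    · rintro ⟨j, hj, h⟩
      by_cases hjn : j = n
      · subst hjn; exact Or.inr h
      · exact Or.inl ⟨j, by omega, h⟩

theorem perm_spec {s N : ℕ} (h : Nat.beq (orAll s N) (Nat.sub (Nat.pow 2 N) 1) = true) :
    (∀ i, i < N → pt s i < N) ∧ Set.InjOn (pt s) (Set.Iio N) := by
  rw [Nat.beq_eq] at h
  have h' : orAll s N = 2 ^ N - 1 := h
  have key : ∀ i, i < N ↔ ∃ j, j < N ∧ pt s j = i := by
    intro i
    rw [← orAll_spec, h', Nat.testBit_two_pow_sub_one, decide_eq_true_eq]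
  have himg : (Finset.range N).image (pt s) = Finset.range N := by
    ext i
    simp only [Finset.mem_image, Finset.mem_range]
    exact (key i).symm
  refine ⟨fun i hi => (key _).2 ⟨i, hi, rfl⟩, ?_⟩
  have : Set.InjOn (pt s) (Finset.range N : Set ℕ) := by
    rw [← Finset.card_image_iff, himg]
  simpa using this

theorem okMap_spec {B : Finset (Finset α)} {N s : ℕ} {R U : List ℕ} {f : ℕ → α}
    (h : R.all (fun t => mem (act s t) U) = true) (hR : ∀ t ∈ R, ltN N t = true)
    (hU : ∀ k ∈ U, HK B N f k) : ∀ t ∈ R, HK B N (fun i => f (pt s i)) (msk t) := by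
  intro t ht
  rw [List.all_eq_true] at h
  obtain ⟨x, y, z, -, -, -, he, hb⟩ := hU _ (mem_spec (h t ht))
  have hl := hR t ht
  simp only [ltN, Bool.and_eq_true, Nat.blt_eq] at hl
  refine ⟨pt t 2, pt t 1, pt t 0, hl.1, hl.2.1, hl.2.2, rfl, ?_⟩
  have h2 := congrArg (Finset.image f) (mk_eq he)
  simp only [Finset.image_insert, Finset.image_singleton] at h2
  rw [h2]
  exact hb

theorem eqL_spec : ∀ {ts ks : List ℕ}, eqL ts ks = true → ∀ k ∈ ks, ∃ t ∈ ts, k = msk t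
  | _, [], _ => by simp
  | [], _ :: _, h => by simp [eqL] at h
  | t :: ts, k :: ks, h => by
    simp only [eqL, Bool.and_eq_true, Nat.beq_eq] at h
    intro k' hk
    rcases List.mem_cons.1 hk with rfl | hk
    · exact ⟨t, by simp, h.1.symm⟩
    · obtain ⟨t', ht', e⟩ := eqL_spec h.2 k' hk
      exact ⟨t', by simp [ht'], e⟩

theorem checkS_spec {N : ℕ} {Mc M U : List ℕ} {tl : List St} :
    ∀ {pats : List (List ℕ)} {cs : List (ℕ × ℕ)}, checkS N Mc M U tl pats cs = true →
      ∀ p ∈ pats, (∃ k ∈ p, ∃ r ∈ U, conf k r = true) ∨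
        ∃ st ∈ tl, ∃ s, okMap N s (Mc ++ st.1) (p ++ (U ++ M)) = true := by
  intro pats
  induction pats with
  | nil => simp
  | cons p ps ih =>
    intro cs h q hq
    rw [checkS.eq_def] at h
    simp only at h
    cases hb : p.any (fun k => U.any (conf k)) with
    | true =>
      rw [hb, cond_true] at h
      rcases List.mem_cons.1 hq with rfl | hq
      · left
        simp only [List.any_eq_true] at hb
        exact hb
      · exact ih h q hq
    | false =>
      rw [hb, cond_false] at h
      cases cs with
      | nil => simp at h
      | cons c cs =>
        simp only [Bool.and_eq_true] at h
        rcases List.mem_cons.1 hq with rfl | hq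
        · right
          have h1 := h.1
          unfold okCert at h1
          cases hc : tl[c.1]? with
          | none => rw [hc] at h1; simp at h1
          | some st =>
            rw [hc] at h1
            exact ⟨st, List.mem_of_getElem? hc, c.2, h1⟩
        · exact ih h.2 q hq

theorem engine {V : Finset α} {B : Finset (Finset α)} (hT : IsPSTS V B)
    {N : ℕ} {Mc M : List ℕ} {pats : List (List ℕ)}
    (hMM : M = Mc.map msk) (hMN : ∀ t ∈ Mc, ltN N t = true)
    (hgood : ∀ f : ℕ → α, Set.InjOn f (Set.Iio N) → (∀ i, i < N → f i ∈ V) →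
      (∀ k ∈ M, HK B N f k) → Sequenceable V B ∨ ∃ p ∈ pats, ∀ k ∈ p, HK B N f k)
    (sts : List St) (hc : check N Mc M pats sts = true) :
    ∀ st ∈ sts, (∀ t ∈ st.1, ltN N t = true) ∧
      ∀ f : ℕ → α, Set.InjOn f (Set.Iio N) → (∀ i, i < N → f i ∈ V) →
      (∀ t ∈ Mc ++ st.1, HK B N f (msk t)) → Sequenceable V B := by
  induction sts with
  | nil => simp
  | cons st tl ih =>
    simp only [check, Bool.and_eq_true] at hc
    obtain ⟨he, hl, hS, hc⟩ := hc
    have ih := ih hc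
    intro st' hst'
    rcases List.mem_cons.1 hst' with rfl | h
    swap
    · exact ih st' h
    rw [List.all_eq_true] at hl
    refine ⟨hl, ?_⟩
    intro f hf hfV hH
    have hMk : ∀ k ∈ M, HK B N f k := by
      intro k hk
      rw [hMM, List.mem_map] at hk
      obtain ⟨t, ht, rfl⟩ := hk
      exact hH t (by simp [ht])
    have hUk : ∀ k ∈ st'.2.1, HK B N f k := by
      intro k hk
      obtain ⟨t, ht, rfl⟩ := eqL_spec he k hk
      exact hH t (by simp [ht])
    rcases hgood f hf hfV hMk with h | ⟨p, hp, hpk⟩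
    · exact h
    rcases checkS_spec hS p hp with ⟨k, hk, r, hr, hcf⟩ | ⟨st, hst, s, hs⟩
    · exact (conf_false hT hf (hpk k hk) (hUk r hr) hcf).elim
    · simp only [okMap, Bool.and_eq_true] at hs
      obtain ⟨hp1, hp2⟩ := perm_spec hs.1
      obtain ⟨hl2, hih⟩ := ih st hst
      refine hih (fun i => f (pt s i)) ?_ (fun i hi => hfV _ (hp1 i hi)) ?_
      · intro a ha b hb h
        exact hp2 ha hb (hf (hp1 a ha) (hp1 b hb) h)
      · refine okMap_spec hs.2 ?_ ?_
        · intro t ht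
          rcases List.mem_append.1 ht with ht | ht
          · exact hMN t ht
          · exact hl2 t ht
        · intro k hk
          rcases List.mem_append.1 hk with hk | hk
          · exact hpk k hk
          · rcases List.mem_append.1 hk with hk | hk
            · exact hUk k hk
            · exact hMk k hk

theorem blocks_list {V : Finset α} {B : Finset (Finset α)} (hT : IsPSTS V B) (a0 : α) :
    ∀ (k : ℕ) (P : Finset (Finset α)), P ⊆ B → P.card = k →
      (P : Set (Finset α)).Pairwise Disjoint →
      ∃ l : List α, l.Nodup ∧ l.length = 3 * k ∧ l.toFinset = P.biUnion id ∧
        ∀ j, j < k →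
          ({l.getD (3 * j) a0, l.getD (3 * j + 1) a0, l.getD (3 * j + 2) a0} : Finset α) ∈ B := by
  intro k
  induction k with
  | zero =>
    intro P _ hc _
    rw [Finset.card_eq_zero] at hc
    subst hc
    exact ⟨[], by simp⟩
  | succ k ih =>
    intro P hP hc hd
    obtain ⟨b, hb⟩ : P.Nonempty := by rw [← Finset.card_pos]; omega
    obtain ⟨l, hl1, hl2, hl3, hl4⟩ := ih (P.erase b) ((Finset.erase_subset _ _).trans hP)
      (by rw [Finset.card_erase_of_mem hb]; omega) (hd.mono (by simp))
    obtain ⟨x, y, z, hxy, hxz, hyz, rfl⟩ := Finset.card_eq_three.1 (hT.1 b (hP hb)).2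
    have hdis : ∀ v ∈ ({x, y, z} : Finset α), v ∉ l := by
      intro v hv hvl
      rw [← List.mem_toFinset, hl3] at hvl
      obtain ⟨c, hc, hvc⟩ := Finset.mem_biUnion.1 hvl
      rw [Finset.mem_erase] at hc
      exact Finset.disjoint_left.1 (hd hc.2 hb hc.1) hvc hv
    refine ⟨x :: y :: z :: l, ?_, ?_, ?_, ?_⟩
    · have h1 := hdis x (by simp)
      have h2 := hdis y (by simp)
      have h3 := hdis z (by simp)
      simp [hl1, hxy, hxz, hyz, h1, h2, h3]
    · simp only [List.length_cons, hl2]; ring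
    · rw [← Finset.insert_erase hb, Finset.biUnion_insert, ← hl3]
      ext v
      simp
    · intro j hj
      cases j with
      | zero => simpa using hP hb
      | succ j =>
        have := hl4 j (by omega)
        rw [show 3 * (j + 1) = 3 * j + 1 + 1 + 1 by ring,
          show 3 * j + 1 + 1 + 1 + 1 = 3 * j + 1 + 1 + 1 + 1 by ring,
          show 3 * j + 1 + 1 + 1 + 2 = 3 * j + 2 + 1 + 1 + 1 by ring]
        simpa only [List.getD_cons_succ] using this

theorem finish {V : Finset α} {B : Finset (Finset α)} (hT : IsPSTS V B) {k : ℕ} (hk1 : 1 ≤ k)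
    (hk : HasDisjointBlocks B k) (h4 : ¬ HasDisjointBlocks B (k + 1))
    {N : ℕ} {Mc M seq : List ℕ} {pats : List (List ℕ)} {sts : List St}
    (hS : check N Mc M pats sts = true) (hW : checkW (k + 1) M seq pats = true)
    (hMM : M = Mc.map msk) (hMN : ∀ t ∈ Mc, ltN N t = true)
    (hMc : ∀ t ∈ Mc, ∃ j, j < k ∧ msk t = mk (3 * j) (3 * j + 1) (3 * j + 2))
    (hnd : seq.Nodup) (hmem : ∀ x, x ∈ seq ↔ x < N) (h3k : 3 * k ≤ N)
    (hst : ∃ st ∈ sts, st.1 = [])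
    (hrest : V.card = N ∨ N ≤ V.card ∧ ∀ q, 1 ≤ q → q < k + 1 →
      3 * q < N ∧ dj M (k + 1 - q) (orL (seq.take (3 * q - 1))) = true) :
    Sequenceable V B := by
  have hNV : N ≤ V.card := by
    rcases hrest with h | h
    · exact h.ge
    · exact h.1
  obtain ⟨P, hP, hPc, hd⟩ := hk
  obtain ⟨a0, ha0⟩ : V.Nonempty := by rw [← Finset.card_pos]; omega
  obtain ⟨l, hl1, hl2, hl3, hl4⟩ := blocks_list hT a0 k P hP hPc hd
  have hlV : l.toFinset ⊆ V := by
    rw [hl3]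
    intro v hv
    obtain ⟨b, hb, hvb⟩ := Finset.mem_biUnion.1 hv
    exact (hT.1 b (hP hb)).1 hvb
  set L := l ++ (V \ l.toFinset).toList with hL
  have hLnd : L.Nodup := by
    refine List.Nodup.append hl1 (Finset.nodup_toList _) ?_
    intro v hv hv'
    simp only [Finset.mem_toList, Finset.mem_sdiff, List.mem_toFinset] at hv'
    exact hv'.2 hv
  have hLV : L.toFinset = V := by
    rw [hL, List.toFinset_append, Finset.toList_toFinset]
    exact Finset.union_sdiff_of_subset hlV
  have hLlen : L.length = V.card := by
    rw [← List.toFinset_card_of_nodup hLnd, hLV]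
  have hget : ∀ i, ∀ h : i < N, L.getD i a0 = L[i]'(by omega) := by
    intro i h
    exact List.getD_eq_getElem _ _ (by omega)
  have hinj : Set.InjOn (fun i => L.getD i a0) (Set.Iio N) := by
    intro a ha b hb h
    simp only at h
    rw [hget a ha, hget b hb] at h
    exact (hLnd.getElem_inj_iff).1 h
  have hmV : ∀ i, i < N → L.getD i a0 ∈ V := by
    intro i hi
    rw [hget i hi]
    exact (Finset.ext_iff.1 hLV _).1 (List.mem_toFinset.2 (List.getElem_mem _))
  obtain ⟨st, hst, hst0⟩ := hst
  refine (engine hT hMM hMN ?_ sts hS st hst).2 (fun i => L.getD i a0) hinj hmV ?_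
  · intro f hf hfV hM
    exact good hT h4 hW hnd hmem (hrest.imp id (fun h => h.2)) hf hfV hM
  · intro t ht
    rw [hst0, List.append_nil] at ht
    obtain ⟨j, hj, hjt⟩ := hMc t ht
    refine ⟨3 * j, 3 * j + 1, 3 * j + 2, by omega, by omega, by omega, hjt, ?_⟩
    have e : ∀ i, i < 3 * k → L.getD i a0 = l.getD i a0 := by
      intro i hi
      rw [hL, List.getD_append _ _ _ _ (by omega)]
    simp only
    rw [e _ (by omega), e _ (by omega), e _ (by omega)]
    exact hl4 j hj

theorem no_blocks {V : Finset α} {B : Finset (Finset α)} (h : ¬ HasDisjointBlocks B 1) :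
    Sequenceable V B := by
  have hB : B = ∅ := by
    rw [Finset.eq_empty_iff_forall_notMem]
    intro b hb
    exact h ⟨{b}, by simpa using hb, by simp, by simp⟩
  refine ⟨V.toList, Finset.nodup_toList _, Finset.toList_toFinset _, ?_⟩
  rintro i m hne - ⟨P, hP, -, hU⟩
  rw [hB, Finset.subset_empty] at hP
  subst hP
  rw [Finset.biUnion_empty] at hU
  exact hne (by simpa using hU.symm)

end

def pats30 : List (List ℕ) := [
  [84]]

def sts30 : List St := [
  ([], [], [
    (0, 36344906256)]),
  ([566], [76], [
])]

def seq30 : List ℕ := [0, 1, 3, 2, 4, 6, 5, 7, 8]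

theorem cW30 : checkW 4 [7, 56, 448] seq30 pats30 = true := by decide +kernel

theorem cS30 : check 9 [18, 837, 1656] [7, 56, 448] pats30 sts30 = true := by decide +kernel

def pats31 : List (List ℕ) := [
  [73, 146, 548], [73, 530, 164], [73, 162, 532], [73, 546, 148], [137, 82, 548],
  [137, 530, 100], [137, 98, 532], [521, 82, 164], [521, 146, 100], [521, 98, 148],
  [81, 138, 548], [81, 162, 524], [81, 546, 140], [145, 74, 548], [145, 98, 524],
  [145, 546, 76], [529, 74, 164], [529, 138, 100], [529, 98, 140], [529, 162, 76],
  [97, 138, 532], [97, 146, 524], [97, 530, 140], [545, 74, 148], [545, 82, 140],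
  [545, 146, 76], [74, 148, 800], [74, 276, 672], [74, 532], [74, 164, 784], [74, 292, 656],
  [138, 276, 608], [138, 100, 784], [138, 292, 592], [266, 148, 608], [266, 100, 656],
  [266, 164, 592], [522], [82, 140, 800], [82, 268, 672], [82, 524], [82, 164, 776],
  [82, 292, 648], [146, 76, 800], [146, 268, 608], [146, 100, 776], [146, 292, 584],
  [274, 76, 672], [274, 140, 608], [274, 100, 648], [274, 164, 584], [530, 76], [98, 140, 784],
  [98, 268, 656], [98, 148, 776], [98, 276, 648], [162, 76, 784], [162, 268, 592],
  [162, 276, 584], [290, 76, 656], [290, 140, 592], [290, 148, 584], [84]]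

def sts31 : List St := [
  ([], [], [
    (1, 654820258305), (0, 654820258320), (0, 654820258080), (1, 654820258305),
    (0, 654819275040), (0, 654820258320), (0, 654820258080), (1, 654820196880),
    (0, 654820196865), (0, 654820196865), (0, 654819275040), (0, 654820196640),
    (0, 654819275280), (1, 654820258320), (0, 654820196640), (1, 654820258080),
    (1, 654820258320), (0, 654820258305), (0, 654820258305), (1, 654820258080),
    (0, 654820258080), (0, 654820196640), (0, 654820258320), (1, 654820258320),
    (0, 654819275265), (1, 654820258080), (1, 654820258320), (1, 654820258320),
    (1, 654820258320), (1, 654820258320), (1, 654820258320), (1, 654568600080),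
    (1, 654819152160), (1, 654568600080), (1, 654568538400), (1, 654819152160),
    (1, 654567493920), (0, 654820196880), (1, 654820196880), (1, 654820196880),
    (1, 654820196880), (1, 654820196880), (1, 654820196880), (1, 654820258080),
    (1, 654568538640), (1, 654819152160), (1, 654568538640), (1, 654820258080),
    (1, 654568599840), (1, 654819152160), (1, 654567493920), (0, 654820258320),
    (1, 654819152400), (1, 654819152400), (1, 654819152400), (1, 654819152400),
    (1, 654820258080), (1, 654567494160), (1, 654567494160), (1, 654820258080),
    (1, 654568599840), (1, 654568538400), (1, 654820196640)]),
  ([329], [530], [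
    (0, 654820258305), (0, 654819152160), (0, 654819152400), (0, 654820196865),
    (0, 654820196865), (0, 654820258320), (0, 654819152400), (0, 654819152385),
    (0, 654820258320), (0, 654820258320), (0, 654820258320), (0, 654568600080),
    (0, 654568538400), (0, 654820258080), (0, 654819152400), (0, 654819152400),
    (0, 654567494160), (0, 654568538400), (0, 654820196640)]),
  ([310], [74], [
    (0, 641083011330), (1, 654818169360), (1, 654818230800), (0, 637056479520),
    (0, 637056541200), (0, 641083072530), (1, 654818169360), (0, 641083011360),
    (0, 637056540690), (0, 650790311220), (0, 654816843060), (0, 641083073040),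
    (0, 650790310965), (0, 654816842805), (1, 654818169360), (1, 654818169360),
    (1, 650791637520), (1, 650791637520), (1, 654818230800), (1, 650791698960),
    (1, 641075382375)]),
  ([310, 633], [74, 644], [
    (0, 654815798580), (0, 654818169360), (0, 654818169360), (0, 654818169360),
    (0, 654818230800), (0, 641075382375)]),
  ([327, 342], [146, 98], [
    (0, 640822618230), (0, 636544428135), (0, 636546517095), (0, 640824707190),
    (2, 654818168865), (3, 632778289440), (0, 641081966625), (0, 646262894625),
    (0, 637054451745), (0, 650290409505), (1, 654818230800)]),
  ([72, 87, 326, 905], [273, 161, 82, 776], [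
    (0, 650793664770), (0, 650288381970)]),
  ([311, 326, 566], [138, 82, 76], [
    (1, 619037750100), (1, 641083011360), (0, 640822679670), (1, 641074275975),
    (1, 654814815060), (0, 654568599585)]),
  ([54, 71, 88, 311, 1129], [73, 145, 289, 138, 592], [
    (5, 654816904245)]),
  ([566, 583, 649], [76, 148, 772], [
    (1, 640830431265), (1, 641081045025), (0, 646263816225), (1, 640830431520),
    (0, 650290409505), (1, 641081045280)]),
  ([70, 311, 328, 361, 1417], [81, 138, 274, 578, 800], [
]),
  ([311, 329, 342, 633], [138, 530, 98, 644], [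
    (2, 654567617040), (0, 650792620560)]),
  ([310, 328, 345, 598, 649], [74, 274, 546, 100, 772], [
    (1, 636553224480), (0, 650793726465)]),
  ([54, 71, 89, 598, 633, 905], [73, 145, 545, 100, 644, 776], [
]),
  ([310, 327, 345, 567, 617], [74, 146, 546, 140, 580], [
    (0, 619033475175)]),
  ([55, 86, 310, 344, 377, 1129], [137, 97, 74, 290, 642, 592], [
])]

def seq31 : List ℕ := [0, 9, 1, 3, 2, 4, 6, 5, 7, 8]

theorem cW31 : checkW 4 [7, 56, 448] seq31 pats31 = true := by decide +kernel

theorem cS31 : check 10 [18, 837, 1656] [7, 56, 448] pats31 sts31 = true := by decide +kernel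

def pats32 : List (List ℕ) := [
  [73, 146, 548], [73, 530, 164], [73, 530, 1060], [73, 1042, 548], [73, 162, 532],
  [73, 546, 148], [73, 546, 1044], [73, 1058, 532], [137, 82, 548], [137, 530, 100],
  [137, 98, 532], [521, 82, 164], [521, 82, 1060], [521, 146, 100], [521, 1042, 100],
  [521, 98, 148], [521, 98, 1044], [1033, 82, 548], [1033, 530, 100], [1033, 98, 532],
  [81, 138, 548], [81, 1034, 548], [81, 162, 524], [81, 546, 140], [81, 546, 1036],
  [81, 1058, 524], [145, 74, 548], [145, 98, 524], [145, 546, 76], [529, 74, 164],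
  [529, 74, 1060], [529, 138, 100], [529, 1034, 100], [529, 98, 140], [529, 98, 1036],
  [529, 162, 76], [529, 1058, 76], [1041, 74, 548], [1041, 98, 524], [1041, 546, 76],
  [97, 138, 532], [97, 1034, 532], [97, 146, 524], [97, 530, 140], [97, 530, 1036],
  [97, 1042, 524], [545, 74, 148], [545, 74, 1044], [545, 82, 140], [545, 82, 1036],
  [545, 146, 76], [545, 1042, 76], [1537], [74, 148, 800], [74, 276, 672], [74, 532],
  [74, 164, 784], [74, 292, 656], [138, 276, 608], [138, 100, 784], [138, 292, 592],
  [266, 148, 608], [266, 100, 656], [266, 164, 592], [522], [82, 140, 800], [82, 268, 672],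
  [82, 524], [82, 164, 776], [82, 292, 648], [146, 76, 800], [146, 268, 608], [146, 100, 776],
  [146, 292, 584], [274, 76, 672], [274, 140, 608], [274, 100, 648], [274, 164, 584],
  [530, 76], [98, 140, 784], [98, 268, 656], [98, 148, 776], [98, 276, 648], [162, 76, 784],
  [162, 268, 592], [162, 276, 584], [290, 76, 656], [290, 140, 592], [290, 148, 584], [84],
  [1544], [1600]]

def sts32 : List St := [
  ([], [], [
    (4, 11649936536065), (1, 11649936536080), (1, 11649936536080), (4, 11649936536065),
    (1, 11649936535840), (4, 11649936536065), (4, 11649936536065), (1, 11649936535840),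
    (1, 11649935552800), (1, 11649936536080), (1, 11649936535840), (4, 11649936474640),
    (4, 11649936474640), (1, 11649936474625), (1, 11649936474625), (1, 11649936474625),
    (1, 11649936474625), (1, 11649935552800), (1, 11649936536080), (1, 11649936535840),
    (1, 11649935552800), (1, 11649935552800), (1, 11649936474400), (1, 11649935553040),
    (1, 11649935553040), (1, 11649936474400), (4, 11649936536080), (1, 11649936474400),
    (4, 11649936535840), (4, 11649936536080), (4, 11649936536080), (1, 11649936536065),
    (1, 11649936536065), (1, 11649936536065), (1, 11649936536065), (4, 11649936535840),
    (4, 11649936535840), (4, 11649936536080), (1, 11649936474400), (4, 11649936535840),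
    (1, 11649936535840), (1, 11649936535840), (1, 11649936474400), (1, 11649936536080),
    (1, 11649936536080), (1, 11649936474400), (4, 11649936536080), (4, 11649936536080),
    (1, 11649935553025), (1, 11649935553025), (4, 11649936535840), (4, 11649936535840),
    (0, 11649933120835), (4, 11649936536080), (4, 11649936536080), (4, 11649936536080),
    (4, 11649936536080), (4, 11649936536080), (4, 11649684877840), (4, 11649935429920),
    (4, 11649684877840), (4, 11649684816160), (4, 11649935429920), (4, 11649683771680),
    (1, 11649936474640), (4, 11649936474640), (4, 11649936474640), (4, 11649936474640),
    (4, 11649936474640), (4, 11649936474640), (4, 11649936535840), (4, 11649684816400),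
    (4, 11649935429920), (4, 11649684816400), (4, 11649936535840), (4, 11649684877600),
    (4, 11649935429920), (4, 11649683771680), (1, 11649936536080), (4, 11649935430160),
    (4, 11649935430160), (4, 11649935430160), (4, 11649935430160), (4, 11649936535840),
    (4, 11649683771920), (4, 11649683771920), (4, 11649936535840), (4, 11649684877600),
    (4, 11649684816160), (4, 11649936474400), (0, 11649936474640), (0, 11636199289360)]),
  ([1178], [1552], [
    (10, 11649936536080), (10, 11649936535840), (0, 11649935552800), (2, 11649936535585),
    (2, 11649936535585), (10, 11649936536080), (10, 11649936535840), (0, 11649935552800),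
    (0, 11649935552800), (0, 11649935552800), (2, 11649936536080), (0, 11649935553040),
    (0, 11649935553040), (2, 11649936536080), (3, 11649936536080), (2, 11649936536080),
    (3, 11649936535840), (2, 11649936536080), (3, 11649936536080), (0, 11649935553025),
    (0, 11649935553025), (10, 11649936536080), (3, 11649936536080), (3, 11649936536080),
    (10, 11645910004000), (10, 11649936535840), (2, 11649936535840), (3, 11649936474640),
    (3, 11649936474640), (2, 11649936536080), (3, 11649936474640), (3, 11649936474640),
    (10, 11649936536080), (10, 11649936536080), (10, 11649936536080), (10, 11649936536080),
    (3, 11649936535840), (10, 11645910004240), (3, 11649935429920), (10, 11645910004240),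
    (10, 11649936535840), (3, 11649935430160), (10, 11645910004000), (10, 11649936535840),
    (3, 11649936474400)]),
  ([329], [530], [
    (4, 11649936536080), (4, 11649936536080), (2, 11649935429920), (2, 11649935430160),
    (2, 11649935430160), (2, 11649935429920), (2, 11649936474625), (2, 11649936474625),
    (4, 11649936474400), (4, 11649936474400), (2, 11649936536080), (2, 11649935430160),
    (2, 11649936536080), (2, 11649935430160), (2, 11649935430145), (2, 11649935430145),
    (2, 11649936536080), (2, 11649936536080), (1, 11649933120595), (2, 11649936536080),
    (2, 11649936536080), (2, 11649684877840), (2, 11649684816160), (2, 11649936535840),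
    (2, 11649935430160), (2, 11649935430160), (2, 11649683771920), (2, 11649684816160),
    (2, 11649936474400), (1, 11649936474400), (0, 11635947631120)]),
  ([361, 1178], [578, 1552], [
    (8, 11649936536080), (8, 11649936536080), (1, 11649936474625), (1, 11649936474625),
    (0, 11649936536080), (0, 11649936536080), (0, 11649936536080), (8, 11649936536080),
    (8, 11649936536080), (8, 11649936536080), (1, 11649936535840), (1, 11649935429920),
    (1, 11649936474400)]),
  ([569, 1178], [524, 1552], [
    (7, 11649936535840), (2, 11649936474400), (2, 11649936474400), (7, 11649936536065),
    (7, 11649936536080), (0, 11649936536080), (0, 11649936536080), (0, 11649936536080),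
    (9, 11649936536080), (7, 11649936535840), (0, 11649936474640), (0, 11649936474400)]),
  ([310], [74], [
    (10, 11649936474640), (10, 11649936474640), (10, 11649936474640), (10, 11649936474640),
    (1, 11649936474400), (1, 11649934508560), (1, 11649934508560), (1, 11649936474400),
    (1, 11649935552545), (1, 11649936536065), (1, 11649936536065), (1, 11649935552545),
    (10, 11649936474130), (10, 11649936474130), (10, 11649936474130), (10, 11649936474130),
    (1, 11649935553025), (1, 11649935553025), (0, 11649933120820), (1, 11622206170195),
    (1, 11622207153235), (1, 11649936535585), (1, 11622206170435), (1, 11622207153475),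
    (10, 11636199289360), (10, 11649936474640), (10, 11636198244880), (10, 11649936474640),
    (10, 11636199289360), (10, 11636198244880), (10, 11649935430160), (6, 11649684816400),
    (6, 11635947631120)]),
  ([310, 1178], [74, 1552], [
    (5, 11649936536080), (10, 11649936536080), (0, 11649934508560), (0, 11649934508560),
    (0, 11649936474400), (5, 11649936536065), (5, 11649936536080), (5, 11649936535840),
    (5, 11649936535840), (5, 11645910004000), (5, 11649936536080), (5, 11649936536080),
    (5, 11645910004240), (9, 11649936474640), (9, 11649935430160)]),
  ([54, 329], [73, 530], [
    (3, 11645910004225), (0, 11649684877330), (8, 11649936474370), (8, 11649936474370),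
    (4, 11649681462580), (8, 11636198244610), (8, 11636199289090), (8, 11649936474370),
    (8, 11649936474370), (8, 11649935430145), (4, 11649684816385), (4, 11635947631105)]),
  ([90, 329, 567], [1057, 530, 140], [
    (0, 11631669502480), (0, 11636199288865), (14, 11645910003970), (2, 10619143402000),
    (10, 11645909021200), (7, 11617927856965), (3, 11649936474400), (1, 11636190553720)]),
  ([106, 121, 310, 393, 583, 650], [1089, 641, 74, 770, 148, 1284], [
    (2, 11649684816400)]),
  ([310, 666, 1145, 1418], [74, 1540, 656, 1312], [
    (5, 11649936474640), (5, 11649935429650), (13, 11649934447105), (5, 11649935430160)]),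
  ([73, 310, 600], [529, 74, 292], [
    (4, 11649936474130), (4, 11649936474130), (7, 11649934447120), (4, 11649935430160),
    (0, 11649684816400), (0, 11635947631120)]),
  ([327, 1178], [146, 1552], [
    (0, 11645910004225), (0, 11645907914785), (17, 11649936535810), (17, 11649936535810),
    (17, 11649936535810), (17, 11649936535810), (0, 11645907915265), (0, 11645910003745),
    (17, 11641631814160), (1, 11645910004000), (0, 11617925609575), (0, 11617925609095),
    (0, 11617923520615), (0, 11617923520135), (17, 11641631814160), (17, 11649936535840)]),
  ([72, 310, 601, 1178], [273, 74, 548, 1552], [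
    (2, 11649935430160)]),
  ([569, 584, 1178], [524, 276, 1552], [
    (16, 11649935429665), (16, 11649935429665), (16, 11649683771425), (16, 11649683771680),
    (0, 11622206170165), (0, 11622205125685), (16, 11649935429920)]),
  ([89, 310, 393, 584, 666], [545, 74, 770, 276, 1540], [
]),
  ([326, 598], [82, 100], [
    (6, 11641630707970), (6, 11641631752705), (9, 11627642970640), (9, 11627894628640),
    (6, 11641626432340), (2, 10601373898375), (6, 11641626370885), (2, 10605399385735),
    (0, 11627887859815), (2, 11641378128160), (2, 11641629786400), (2, 11632166049415),
    (2, 11641378066960), (2, 11641629725200), (2, 11636191536775), (2, 11636199350800),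
    (2, 11636198367760), (0, 11614150674535), (13, 11627894567440)]),
  ([310, 343, 1178], [74, 162, 1552], [
    (5, 11641628398915), (5, 11645906588485), (5, 11645904622405), (1, 11645404598560),
    (1, 11645908898080), (0, 11645910003730), (0, 11614150735975)]),
  ([86, 310, 327, 1178], [97, 74, 146, 1552], [
    (4, 11641628398675), (11, 11641631814160), (11, 11649936535840)]),
  ([568, 599, 873], [268, 164, 584], [
    (3, 11645908898050), (0, 10600876368385), (3, 11645908897810), (0, 10600876368400),
    (1, 11649680417620), (3, 11622205064275), (3, 11622202693255), (6, 11645905544245)]),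
  ([54, 377, 583, 598, 650, 890], [73, 642, 148, 100, 1284, 1160], [
    (0, 10600869537640), (5, 11632172818465), (9, 11632172757505)]),
  ([310, 568, 633, 1178], [74, 268, 644, 1552], [
    (1, 11641626432595), (1, 11617925609590), (0, 11641631813920)]),
  ([311, 328, 361, 568, 1178], [138, 274, 578, 268, 1552], [
    (7, 11645910003970), (7, 11645910004000)]),
  ([56, 89, 328, 566], [265, 545, 274, 76], [
    (2, 11631668396545), (1, 11614152983605), (7, 11649934508545), (0, 11618426836600)]),
  ([72, 86, 599, 666, 873], [273, 97, 164, 1540, 584], [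
    (5, 11649932199235)]),
  ([137, 312, 327, 361, 566], [769, 266, 146, 578, 76], [
    (4, 11645909942560)]),
  ([56, 311, 361, 566], [265, 138, 578, 76], [
    (1, 11645908898050), (0, 11645406687265), (1, 11645909942530), (0, 11645405704225),
    (2, 10615114437940), (1, 11622202693255), (1, 11622203737735), (3, 11649936474400)]),
  ([56, 90, 121, 311, 566, 585], [265, 1057, 641, 138, 76, 532], [
    (2, 11649936474400), (1, 10587640067380)]),
  ([57, 70, 327, 342, 584, 617], [521, 81, 146, 98, 276, 580], [
]),
  ([312, 327, 342, 874, 1178], [266, 146, 98, 1096, 1552], [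
    (0, 11641631814160), (0, 11649936535840)]),
  ([326, 583, 1178], [82, 148, 1552], [
    (0, 11641630831120), (0, 11645909020960), (0, 10615116869920), (0, 11645909020960),
    (0, 10615116747040), (0, 11617924626280), (0, 11641630708240), (0, 11622202816120),
    (0, 11645908898080), (0, 11622202693240), (0, 11617924503400)]),
  ([329, 344, 598, 1434], [530, 290, 100, 1568], [
    (4, 11641626432340), (1, 10618889311540), (0, 11617927980115)]),
  ([57, 310, 328, 410, 598, 649], [521, 74, 274, 1538, 100, 772], [
]),
  ([58, 329, 568, 599, 666], [1033, 530, 268, 164, 1540], [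
    (0, 11641375819075)]),
  ([58, 70, 328, 345, 583, 1178], [1033, 81, 274, 546, 148, 1552], [
    (0, 11649932076355)]),
  ([74, 121, 311, 326, 344, 410, 566, 601], [1041, 641, 138, 82, 290, 1538, 76, 548], [
]),
  ([57, 311, 328, 410, 598], [521, 138, 274, 1538, 100], [
])]

def seq32 : List ℕ := [10, 0, 9, 1, 3, 2, 4, 6, 5, 7, 8]

theorem cW32 : checkW 4 [7, 56, 448] seq32 pats32 = true := by decide +kernel

theorem cS32 : check 11 [18, 837, 1656] [7, 56, 448] pats32 sts32 = true := by decide +kernel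

def pats33 : List (List ℕ) := [
  [73, 146, 548], [73, 530, 164], [73, 530, 1060], [73, 530, 3076], [73, 1042, 548],
  [73, 1042, 2564], [73, 2066, 1540], [73, 162, 532], [73, 546, 148], [73, 546, 1044],
  [73, 1058, 532], [73, 1538, 2068], [73, 2562, 1044], [73, 3074, 532], [137, 82, 548],
  [137, 530, 100], [137, 98, 532], [521, 82, 164], [521, 82, 1060], [521, 82, 3076],
  [521, 146, 100], [521, 1042, 100], [521, 1042, 2116], [521, 2066, 1092], [521, 98, 148],
  [521, 98, 1044], [521, 1090, 2068], [521, 2114, 1044], [521, 3074], [1033, 82, 548],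
  [1033, 82, 2564], [1033, 530, 100], [1033, 530, 2116], [1033, 2066, 580], [1033, 98, 532],
  [1033, 578, 2068], [1033, 2114, 532], [1033, 2562], [2057, 82, 1540], [2057, 530, 1092],
  [2057, 1042, 580], [2057, 578, 1044], [2057, 1090, 532], [2057, 1538], [81, 138, 548],
  [81, 1034, 548], [81, 1034, 2564], [81, 2058, 1540], [81, 162, 524], [81, 546, 140],
  [81, 546, 1036], [81, 1058, 524], [81, 1538, 2060], [81, 2562, 1036], [81, 3074, 524],
  [145, 74, 548], [145, 98, 524], [145, 546, 76], [529, 74, 164], [529, 74, 1060],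
  [529, 74, 3076], [529, 138, 100], [529, 1034, 100], [529, 1034, 2116], [529, 2058, 1092],
  [529, 98, 140], [529, 98, 1036], [529, 162, 76], [529, 1058, 76], [529, 1090, 2060],
  [529, 2114, 1036], [529, 3074, 76], [1041, 74, 548], [1041, 74, 2564], [1041, 2058, 580],
  [1041, 98, 524], [1041, 546, 76], [1041, 578, 2060], [1041, 2114, 524], [1041, 2562, 76],
  [2065, 74, 1540], [2065, 1034, 580], [2065, 578, 1036], [2065, 1090, 524], [2065, 1538, 76],
  [97, 138, 532], [97, 1034, 532], [97, 146, 524], [97, 530, 140], [97, 530, 1036],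
  [97, 1042, 524], [545, 74, 148], [545, 74, 1044], [545, 82, 140], [545, 82, 1036],
  [545, 146, 76], [545, 1042, 76], [577, 1034, 2068], [577, 2058, 1044], [577, 1042, 2060],
  [577, 2066, 1036], [1089, 2058, 532], [1089, 530, 2060], [1089, 2066, 524],
  [2113, 1034, 532], [2113, 530, 1036], [2113, 1042, 524], [1537], [2561, 74, 1044],
  [2561, 1034], [2561, 82, 1036], [2561, 1042, 76], [3073], [74, 148, 800], [74, 276, 672],
  [74, 532], [74, 164, 784], [74, 292, 656], [138, 276, 608], [138, 100, 784], [138, 292, 592],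
  [266, 148, 608], [266, 100, 656], [266, 164, 592], [522], [82, 140, 800], [82, 268, 672],
  [82, 524], [82, 164, 776], [82, 292, 648], [146, 76, 800], [146, 268, 608], [146, 100, 776],
  [146, 292, 584], [274, 76, 672], [274, 140, 608], [274, 100, 648], [274, 164, 584],
  [530, 76], [98, 140, 784], [98, 268, 656], [98, 148, 776], [98, 276, 648], [162, 76, 784],
  [162, 268, 592], [162, 276, 584], [290, 76, 656], [290, 140, 592], [290, 148, 584], [84],
  [584, 3088], [1096, 2576], [2120, 1552], [1544], [2568, 1104], [3080, 592], [1600]]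

def sts33 : List St := [
  ([], [], [
    (12, 205163983024641), (3, 205163983024656), (3, 205163983024656), (3, 205163983024656),
    (12, 205163983024641), (12, 205163983024641), (12, 205163983024641), (3, 205163983024416),
    (12, 205163983024641), (12, 205163983024641), (3, 205163983024416), (12, 205163983024641),
    (12, 205163983024641), (3, 205163983024416), (3, 205163982041376), (3, 205163983024656),
    (3, 205163983024416), (12, 205163982963216), (12, 205163982963216), (12, 205163982963216),
    (3, 205163982963201), (3, 205163982963201), (3, 205163982963201), (3, 205163982963201),
    (3, 205163982963201), (3, 205163982963201), (3, 205163982963201), (3, 205163982963201),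
    (3, 205163982963201), (3, 205163982041376), (12, 205163982963216), (3, 205163983024656),
    (3, 205163983024656), (4, 205163981918496), (3, 205163983024416), (4, 205163981918736),
    (3, 205163983024416), (3, 204133190812161), (12, 205163982963216), (3, 205163983024656),
    (4, 205163980935201), (4, 205163980935186), (3, 205163983024416), (3, 186609724244481),
    (3, 205163982041376), (3, 205163982041376), (12, 205163982963201), (12, 205163982963201),
    (3, 205163982962976), (3, 205163982041616), (3, 205163982041616), (3, 205163982962976),
    (12, 205163982963201), (12, 205163982963201), (3, 205163982962976), (12, 205163983024656),
    (3, 205163982962976), (12, 205163983024416), (12, 205163983024656), (12, 205163983024656),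
    (12, 205163983024656), (3, 205163983024641), (3, 205163983024641), (3, 205163983024641),
    (3, 205163983024641), (3, 205163983024641), (3, 205163983024641), (12, 205163983024416),
    (12, 205163983024416), (3, 205163983024641), (3, 205163983024641), (12, 205163983024416),
    (12, 205163983024656), (12, 205163983024656), (4, 205163980935456), (3, 205163982962976),
    (12, 205163983024416), (4, 205163980935696), (3, 205163982962976), (12, 205163983024416),
    (12, 205163983024656), (4, 205163981918241), (4, 205163981918226), (3, 205163982962976),
    (12, 205163983024416), (3, 205163983024416), (3, 205163983024416), (3, 205163982962976),
    (3, 205163983024656), (3, 205163983024656), (3, 205163982962976), (12, 205163983024656),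
    (12, 205163983024656), (3, 205163982041601), (3, 205163982041601), (12, 205163983024416),
    (12, 205163983024416), (4, 205163981918721), (4, 205163980935426), (4, 205163980935681),
    (4, 205163981918466), (3, 205163983024416), (3, 205163983024656), (3, 205163982962976),
    (3, 205163983024416), (3, 205163983024656), (3, 205163982962976), (0, 205163979609411),
    (12, 205163983024656), (3, 204133190812176), (12, 205163982963216), (12, 205163983024416),
    (0, 171147838625091), (12, 205163983024656), (12, 205163983024656), (12, 205163983024656),
    (12, 205163983024656), (12, 205163983024656), (12, 205163731366416), (12, 205163981918496),
    (12, 205163731366416), (12, 205163731304736), (12, 205163981918496), (12, 205163730260256),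
    (3, 205163982963216), (12, 205163982963216), (12, 205163982963216), (12, 205163982963216),
    (12, 205163982963216), (12, 205163982963216), (12, 205163983024416), (12, 205163731304976),
    (12, 205163981918496), (12, 205163731304976), (12, 205163983024416), (12, 205163731366176),
    (12, 205163981918496), (12, 205163730260256), (3, 205163983024656), (12, 205163981918736),
    (12, 205163981918736), (12, 205163981918736), (12, 205163981918736), (12, 205163983024416),
    (12, 205163730260496), (12, 205163730260496), (12, 205163983024416), (12, 205163731366176),
    (12, 205163731304736), (12, 205163982962976), (0, 171147842040336), (0, 188671308608016),
    (0, 205163983024656), (0, 205163982963216), (0, 188671308546576), (0, 171147841978896),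
    (0, 205150245777936)]),
  ([1178], [1552], [
    (11, 205163983024641), (11, 205163983024641), (30, 205163983024656), (30, 205163983024656),
    (30, 205163983024656), (30, 205163983024656), (2, 205163982963201), (2, 205163982963201),
    (2, 205163982963201), (2, 205163982963201), (2, 205163982963201), (30, 205163983024656),
    (30, 205163983024656), (5, 205163983024416), (5, 205163983024656), (0, 188671308607776),
    (30, 205163983024641), (30, 205163983024641), (30, 205163983024641), (30, 205163983024641),
    (30, 205163983024641), (30, 205163983024641), (30, 205163983024641), (30, 205163983024641),
    (30, 205163983024641), (11, 205163983024656), (2, 205163982962976), (11, 205163983024416),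
    (5, 205163983024416), (5, 205163983024656), (2, 205163982962976), (2, 205163982962976),
    (11, 205163983024656), (30, 205163983024656), (30, 205163983024656), (11, 205163983024416),
    (5, 205163983024641), (5, 205163983024641), (2, 205163982962976), (0, 188671308607521),
    (30, 205163983024656), (0, 171147842039841), (11, 205163983024656), (11, 205163983024656),
    (8, 205163980935696), (8, 205163980935696), (2, 205163982963216), (30, 205163983024656),
    (30, 205163983024656), (30, 205163983024656), (30, 205163983024656), (30, 205163983024656),
    (11, 205163983024416), (8, 205163980935696), (11, 205163981918496), (8, 205163983024656),
    (11, 205163983024416), (8, 205163980935696), (11, 205163981918496), (8, 205163983024656),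
    (11, 205163981918736), (11, 205163981918736), (8, 205163983024656), (8, 205163983024656),
    (30, 205163983024416), (2, 186582246520116)]),
  ([666, 1179], [1540, 2576], [
    (10, 205163983024641), (10, 205163982963216), (1, 205163982963201), (1, 205163982963201),
    (1, 205163982963201), (1, 205163982963201), (1, 205163982963201), (10, 205163982963216),
    (10, 205163982963201), (1, 205163982041616), (10, 205163983024416), (10, 205163983024416),
    (2, 205163980935696), (10, 205163983024656), (1, 205163982041601), (10, 205163983024416),
    (10, 205163983024416), (2, 205163980935681), (0, 204133185492291), (10, 205163983024656),
    (10, 205163983024656), (33, 205159954465056), (33, 205163980996896), (1, 205163982963216),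
    (10, 205163982963216), (10, 205163982963216), (10, 205163982963216), (10, 205163982963216),
    (10, 205163983024416), (31, 205163980935681), (10, 205163981918496), (31, 205163983024641),
    (10, 205163983024416), (31, 205159954403841), (10, 205163981918496), (31, 205159956492801),
    (10, 205163981918736), (10, 205163981918736), (31, 205159956492546), (31, 205163983024386),
    (10, 205163982962976), (4, 204133186536756)]),
  ([427, 1178, 1435], [3074, 1552, 2592], [
    (28, 205163983024656), (28, 205163983024656), (0, 205163982963201), (0, 205163982963201),
    (0, 205163982963201), (3, 205163983024656), (28, 205163983024641), (28, 205163983024641),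
    (0, 205163982962976), (3, 205163983024656), (0, 205163982962976), (0, 205163982963216),
    (28, 205163983024656), (28, 205163983024656), (28, 205163983024656), (9, 205163981918496),
    (6, 205163983024656), (9, 205163981918496), (6, 205163983024656), (9, 205163981918736),
    (9, 205163981918736), (6, 205163983024656), (6, 205163983024656), (28, 205163983024416),
    (6, 186609723322896)]),
  ([329], [530], [
    (15, 205163983024656), (15, 205163983024656), (3, 205163983024656), (8, 205163981918496),
    (8, 205163981918736), (8, 205163981918736), (0, 204133189767696), (0, 186609723200016),
    (3, 205163982962946), (8, 205163981918496), (0, 186609722216481), (0, 204133188784161),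
    (8, 205163982963201), (8, 205163982963201), (8, 205163982963201), (8, 205163982963201),
    (15, 205163982962976), (15, 205163982962976), (3, 205163982962976), (8, 205163983024656),
    (8, 205163981918736), (8, 205163983024656), (8, 205163983024656), (0, 205163980935456),
    (8, 205163981918736), (0, 186609723199506), (8, 205163983024656), (0, 205163981918241),
    (0, 204133189767186), (8, 205163981918721), (8, 205163981918721), (8, 205163983024656),
    (8, 205163983024656), (0, 205163981918721), (0, 205163980935426), (0, 204133188784641),
    (0, 186609722216961), (5, 205149987412086), (8, 205163983024656), (3, 204133190811666),
    (3, 205163983024146), (8, 205163983024656), (8, 205163983024656), (8, 205163731366416),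
    (8, 205163731304736), (8, 205163983024416), (8, 205163981918736), (8, 205163981918736),
    (8, 205163730260496), (8, 205163731304736), (8, 205163982962976), (3, 205136505238581),
    (5, 205136250226806), (3, 204105713087301), (2, 205149994119696)]),
  ([74, 361, 603], [1041, 578, 2084], [
    (7, 205163983024641), (14, 205163983024416), (14, 205163983024416), (2, 205163983024416),
    (0, 204133187458371), (2, 205163982962946), (7, 205163981918721), (7, 205163981918721),
    (14, 205163981918496), (7, 205163983024416), (0, 188671304270661), (2, 204133190811666),
    (7, 205163983024416), (7, 205163983024416), (7, 205163983024416), (7, 205163983024416),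
    (7, 205163982962976), (1, 188671308608016), (1, 205163982963216)]),
  ([74, 315, 329, 603, 874, 1385], [1041, 2058, 530, 2084, 1096, 608], [
    (6, 205163982962976)]),
  ([361, 1178], [578, 1552], [
    (5, 205163983024641), (5, 205163981918496), (2, 205136501946486), (0, 205163982962946),
    (2, 204105709795446), (24, 205163983024641), (24, 205163983024641), (24, 205163983024641),
    (24, 205163983024641), (24, 205163983024641), (24, 205163983024641), (2, 204101179947126),
    (12, 205163981918496), (5, 205163983024416), (2, 205131972098166), (0, 204133190811666),
    (0, 205150245777426), (5, 205163983024416), (5, 205163981918496), (5, 205163983024416),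
    (5, 205163981918496), (24, 205163983024416), (0, 186582246519861)]),
  ([329, 683], [530, 3076], [
    (11, 205163983024656), (11, 205163983024656), (4, 205163981918496), (4, 205163981918736),
    (4, 205163981918496), (4, 205163982963201), (4, 205163982963201), (11, 205163982962976),
    (11, 205163982962976), (4, 205163983024656), (4, 205163981918736), (4, 205163983024656),
    (1, 171133845506166), (4, 205163981918736), (1, 170117044507971), (1, 171134096119926),
    (1, 171147836659011), (4, 205163981918721), (4, 205163983024656), (1, 205149987412086),
    (1, 188657312995446), (4, 205163983024656), (4, 205163983024656), (4, 205163731366416),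
    (4, 205163731304736), (4, 205163983024416), (4, 205163981918736), (4, 205163981918736),
    (4, 205163730260496), (4, 205163731304736), (4, 205163982962976), (1, 205136250226806),
    (0, 171133845506151), (0, 205128200516931)]),
  ([361, 1178, 1963], [578, 1552, 3200], [
    (3, 205163983024641), (3, 205163981918496), (0, 171115834467651), (0, 204105709795446),
    (22, 205163983024641), (22, 205163983024641), (22, 205163983024641), (22, 205163983024641),
    (22, 205163983024641), (0, 204101179947126), (10, 205163981918496), (3, 205163983024416),
    (0, 171120364315971), (0, 188671305192771), (3, 205163983024416), (3, 205163981918496),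
    (3, 205163983024416), (3, 205163981918496), (22, 205163983024416), (0, 170103312704016)]),
  ([873, 1178], [584, 1552], [
    (21, 205163983024656), (21, 205163983024656), (21, 205163983024656), (0, 204133190873106),
    (21, 205163983024641), (21, 205163983024641), (21, 205163983024641), (21, 205163983024641),
    (21, 205163983024641), (21, 205163983024641), (21, 205163983024656), (21, 205163983024656),
    (0, 204133190873346), (21, 205163983024656), (1, 205163983024641), (21, 205163983024656),
    (21, 205163983024656), (21, 205163731366416), (2, 205163730260256), (2, 205163730260496),
    (21, 205163731366176), (21, 205163983024416)]),
  ([427, 569, 874, 1178], [3074, 524, 1096, 1552], [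
    (20, 205163983024641), (20, 205163983024641), (1, 205163981918736), (8, 205163981918496),
    (0, 205163980935696), (0, 205163980935696), (20, 205163983024656), (20, 205163983024416)]),
  ([427, 873, 1178], [3074, 584, 1552], [
    (19, 205163983024656), (19, 205163983024656), (19, 205163983024656), (19, 205163983024641),
    (19, 205163983024641), (19, 205163983024641), (19, 205163983024656), (19, 205163983024656),
    (19, 205163983024656), (19, 205163983024656), (19, 205163983024656), (19, 205163731366416),
    (0, 205163730260256), (0, 205163730260496), (19, 205163731366176), (19, 205163983024416)]),
  ([310], [74], [
    (50, 205163982041121), (50, 205163982041121), (50, 205163982041121), (0, 170117046473781),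
    (0, 171147838624821), (25, 205155674886996), (50, 205163982041121), (0, 186609720890421),
    (0, 188671305192501), (18, 188671305254196), (0, 204133187458101), (0, 205163979609141),
    (18, 205163979670836), (50, 205163983024641), (50, 205163983024641), (50, 205163983024641),
    (50, 205163983024641), (50, 205163983024641), (50, 205163983024641), (50, 205163983024641),
    (6, 205163982041121), (6, 205163983024641), (6, 205163983024641), (6, 205163983024641),
    (6, 205163982041121), (6, 204133190873601), (6, 186609724305921), (50, 205163982041601),
    (50, 205163982041601), (50, 205163982041601), (50, 205163982041601), (6, 205163982041601),
    (6, 205163982041601), (0, 205163977643061), (0, 188671303226421), (0, 204133185492021),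
    (0, 171147836658741), (0, 186609718924341), (0, 170117044507701), (1, 205163979609396),
    (6, 204133190873121), (1, 171147838625076), (6, 205136252658771), (6, 205136253641811),
    (6, 205163983024161), (6, 205136252659011), (6, 205136253642051), (50, 205150244855841),
    (50, 205163982041121), (50, 205150245838881), (50, 205163982041121), (50, 205150244855841),
    (50, 205150245838881), (50, 205163983024161), (18, 205163982963216), (18, 188671308546576),
    (18, 171147841978896), (18, 205150245777936)]),
  ([310, 331, 570, 1385], [74, 2066, 1036, 608], [
    (17, 205163979670836), (5, 205163983024641), (5, 204133190873601), (0, 205163979609396),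
    (0, 171147838625076), (5, 205163983024161), (5, 186609470558226), (5, 186605192368146),
    (49, 205163983024161), (34, 205163982041601)]),
  ([310, 1178], [74, 1552], [
    (52, 205163983024656), (0, 171112056178806), (17, 205163983024656), (0, 188635522746486),
    (17, 204133190873616), (16, 205163983024641), (16, 205163983024641), (16, 205163983024641),
    (16, 205163983024641), (16, 205163983024641), (17, 205163983024656), (4, 205163982041121),
    (52, 205163983024656), (4, 205163982041601), (0, 188643575810166), (0, 171120109242486),
    (1, 204133190873616), (16, 205163731366176), (16, 205159453176096), (52, 205163983024656),
    (52, 205163983024656), (52, 205159956492816), (48, 205163982041121), (16, 205163983024416)]),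
  ([70, 121, 874, 923, 1163], [81, 641, 1096, 2568, 2320], [
    (3, 205163980996896), (3, 205163980997136), (16, 188671308546561), (17, 205159955386881),
    (17, 205159955386626)]),
  ([155, 310, 1178], [2561, 74, 1552], [
    (1, 186609720890451), (14, 205163983024641), (14, 205163983024641), (14, 205163983024641),
    (14, 205163983024641), (15, 205163983024656), (2, 205163982041121), (50, 205163983024656),
    (0, 188671305192756), (14, 205163731366176), (14, 205159453176096), (50, 205163983024656),
    (50, 205163983024656), (50, 205159956492816), (46, 205163982041121), (14, 205163983024416)]),
  ([58, 155, 310, 345, 1131, 1178], [1033, 2561, 74, 546, 2128, 1552], [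
    (49, 205163983024656), (49, 205163983024656), (45, 205163982041121)]),
  ([54, 75, 569, 683, 1178, 1386], [73, 2065, 524, 3076, 1552, 1120], [
    (0, 205163982041616), (12, 205163983024656), (12, 205163983024416)]),
  ([54, 329], [73, 530], [
    (8, 205159956492816), (5, 188671306580226), (2, 205163978564661), (49, 205163983024641),
    (1, 188657571422466), (49, 205163983024641), (0, 205136250288246), (1, 205150245839106),
    (0, 188643575871606), (11, 205163979609396), (11, 188671305192756), (11, 171147838625076),
    (43, 205150245839376), (43, 205150244856336), (49, 205163983024641), (49, 205163983024641),
    (43, 205163983024416), (11, 205163982963201), (11, 188671308546561), (11, 205150245777921)]),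
  ([55, 107, 905, 1129, 1146], [137, 2113, 776, 592, 1168], [
    (10, 205163727951156), (42, 205150245839361), (42, 205150245839106), (27, 204132939215376)]),
  ([57, 310, 379, 618, 633], [521, 74, 2178, 1092, 644], [
    (41, 205163983024641), (0, 205150239131496), (9, 171147841978896)]),
  ([326, 601, 939], [82, 548, 3080], [
    (40, 205163983024656), (40, 205163983024656), (5, 205159954464801), (40, 205163983024146),
    (40, 205163983024146), (40, 205163983024146), (40, 205163983024146), (0, 205163980996641),
    (1, 205128196241526), (40, 205163983024146), (40, 205149993197601), (40, 205163983024146),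
    (40, 205149994180641), (8, 205149994119696)]),
  ([54, 329, 666, 1451], [73, 530, 1540, 3104], [
    (4, 205159956492816), (8, 171147841057281), (8, 170112518013216), (8, 170116796203296),
    (45, 205163983024641), (45, 205163983024641), (39, 205163983024416), (7, 188671308546561)]),
  ([86, 873, 939, 1145], [97, 584, 3080, 656], [
    (60, 205163982041601), (7, 170117048783361), (38, 205163980997121), (38, 205145715990816),
    (38, 205145715991056), (38, 205163980996866)]),
  ([75, 342, 569], [2065, 98, 524], [
    (49, 205163983024656), (49, 205163983024656), (49, 205163983024656), (49, 205163983024656),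
    (0, 170117045429571), (5, 188671305253971), (0, 205163978687796), (1, 205163979608916),
    (2, 186609472647681), (2, 186609470558466), (37, 205163980996626), (1, 205163980935696),
    (1, 170117048782866), (5, 205145715929616)]),
  ([59, 74, 329, 347, 598, 873], [2057, 1041, 530, 2082, 100, 584], [
]),
  ([75, 310, 601, 1178], [2065, 74, 548, 1552], [
    (4, 205163983024656), (4, 204133190873616), (3, 205163983024416)]),
  ([54, 329, 600], [73, 530, 292], [
    (2, 171143307854931), (35, 205163983024656), (1, 204129163358721), (40, 205163983024641),
    (0, 188653543907841), (1, 186605696791041), (0, 205146218324481), (2, 205163979609396),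
    (2, 188671305192756), (2, 171147838625076), (52, 205163983024161), (40, 205163983024641),
    (34, 205163983024416), (2, 205163982963201), (2, 188671308546561), (2, 205150245777921)]),
  ([58, 137, 310, 395, 583, 617], [1033, 769, 74, 2306, 148, 580], [
    (33, 205163983024641), (1, 188671308546576)]),
  ([59, 90, 310, 345, 583, 618], [2057, 1057, 74, 546, 148, 1092], [
    (32, 205163983024641), (0, 205163982963216)]),
  ([326, 1178], [82, 1552], [
    (31, 205163983024656), (1, 188635269060726), (1, 188643827529846), (1, 188643827529846),
    (0, 170117044507971), (1, 188643827529846), (1, 188635269060726), (0, 186609718924611),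
    (1, 171120360962166), (31, 205163983024146), (16, 171120109242486), (1, 188643825440886),
    (1, 188643825440886), (16, 171120109242486), (0, 186609720890691), (0, 186609720890691),
    (0, 170117046474051), (35, 205163731366416), (35, 205159453176336), (16, 188643575810166),
    (1, 188666776670721), (1, 188671054860801), (1, 188635271149686), (1, 188666778759681),
    (1, 188671056949761), (76, 205163731365921), (76, 205159453175841), (6, 186578216633991)]),
  ([310, 427, 1178], [74, 3074, 1552], [
    (34, 205163983024656), (10, 205163983024146), (10, 205163983024656), (30, 205163983024641),
    (30, 205163983024641), (10, 205163983024656), (0, 188639295592551), (10, 205163983024656),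
    (0, 188639798909031), (0, 188662750138626), (0, 188663001796866), (34, 205163983024656),
    (34, 205163983024656), (34, 205159956492816), (30, 205163982041121), (30, 205163983024161)]),
  ([71, 873, 1179], [145, 584, 2576], [
    (14, 205163982963201), (14, 205163982963201), (14, 170089568749671), (14, 205163982963201),
    (14, 205163982963201), (1, 205163982963201), (0, 188671305253941), (14, 205163982963201),
    (14, 205163982963201), (29, 205163729338656), (29, 205163729338896), (14, 205163982962946)]),
  ([361, 567, 666, 939], [578, 140, 1540, 3080], [
    (73, 171143312130336), (28, 205163731365906), (32, 171147840934176), (13, 188657563609191),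
    (73, 171147841978386), (28, 205163731365906), (32, 171147841978656)]),
  ([311, 410, 923, 1129], [138, 1538, 2568, 592], [
    (12, 205163983024656), (12, 205163983024386), (0, 205159449822261), (1, 205155421201491),
    (12, 205163983024386)]),
  ([328, 411, 633, 939, 1178], [274, 2562, 644, 3080, 1552], [
    (11, 170103052310376), (73, 205163731365921)]),
  ([71, 155, 310, 649, 1178], [145, 2561, 74, 772, 1552], [
    (70, 205163983024656), (70, 205163983024656), (25, 205163983024161)]),
  ([568, 585, 939], [268, 532, 3080], [
    (69, 171147590320416), (69, 171147590320416), (69, 171147841978656), (25, 205155677196546),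
    (5, 205136501946246), (25, 205159955386626), (28, 171143814402336), (5, 205136501946246),
    (5, 205136501946246), (69, 171147841978401), (4, 205159448716341), (69, 171147590320161),
    (5, 205136250288006), (0, 205131975451461), (0, 205131975390021), (40, 205163731366416),
    (40, 205163983024656), (1, 205131974346036)]),
  ([73, 312, 361, 598, 683], [529, 266, 578, 100, 3076], [
    (8, 204133186413621), (8, 186609719845941), (2, 205163981918736), (2, 188671307502096)]),
  ([105, 310, 427, 1178], [577, 74, 3074, 1552], [
    (1, 205159956492546), (0, 188657312994936), (0, 188657312994951), (26, 205163983024656),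
    (22, 205163982041121), (22, 205163983024161)]),
  ([137, 342, 567, 585, 939, 1691], [769, 98, 140, 532, 3080, 2624], [
    (3, 188635274441541)]),
  ([89, 328, 361, 566, 683, 1178], [545, 274, 578, 76, 3076, 1552], [
]),
  ([310, 427, 569, 1178], [74, 3074, 524, 1552], [
    (19, 205163983024641), (19, 205163983024641), (23, 205163983024656), (4, 188639297620071),
    (8, 205136252658741), (8, 205136253641781), (19, 205163983024161)]),
  ([312, 873, 939, 1161], [266, 584, 3080, 784], [
    (40, 205159956492816), (63, 171147841978386), (40, 205159956492816), (0, 205159449760581),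
    (34, 205163982041376), (44, 205163982041121), (1, 205136250226536)]),
  ([361, 566, 633, 683, 1178], [578, 76, 644, 3076, 1552], [
    (0, 205146210572406), (2, 204119444891766), (0, 205146210572406)]),
  ([57, 70, 312, 329, 1195], [521, 81, 266, 530, 3088], [
    (16, 205163980997136), (61, 171143312191776), (16, 205163983024386), (0, 188635525178691)]),
  ([70, 137, 312, 361, 427, 923], [81, 769, 266, 578, 3074, 2568], [
    (0, 204119446919016), (15, 205163980996896)]),
  ([54, 923, 1129], [73, 2568, 592], [
    (3, 188662998504261), (0, 188671305254196), (1, 186609719968581), (3, 188662998442821),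
    (0, 188671304271156), (1, 186609720951621), (10, 188671308546576), (6, 205163979670851),
    (59, 188666778698256), (59, 188671056888336), (59, 188671056888096), (59, 188666778698016)]),
  ([75, 105, 310, 410, 601], [2065, 577, 74, 1538, 548], [
    (13, 205163983024161), (9, 205163979670851)]),
  ([345, 362, 566, 666, 1195], [546, 1090, 76, 1540, 3088], [
    (12, 205163983024386), (0, 171147839950866), (52, 171147842039826), (52, 171143815507986)]),
  ([86, 155, 315, 361, 583, 1178], [97, 2561, 2058, 578, 148, 1552], [
    (15, 205163983024416)]),
  ([73, 310, 393, 600, 666], [529, 74, 770, 292, 1540], [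
    (1, 205146211616646), (10, 205163983024161), (0, 205150238148726)]),
  ([86, 122, 584, 601, 889, 1178, 1691], [97, 1153, 276, 548, 648, 1552, 2624], [
]),
  ([86, 327, 345, 905, 939, 1178], [97, 146, 546, 776, 3080, 1552], [
    (8, 205163980996866)]),
  ([54, 155, 361, 939], [73, 2561, 578, 3080], [
    (2, 188663003824146), (0, 188671308608001), (1, 188657564653686), (2, 188663002779666),
    (0, 188671307624961), (7, 205163982041376), (7, 205163982041376), (7, 205163982041376),
    (7, 205163982041376), (7, 205163983024416)]),
  ([75, 105, 310, 410, 601, 939], [2065, 577, 74, 1538, 548, 3080], [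
    (6, 205163983024161)]),
  ([57, 70, 890, 1178, 1435, 1707], [521, 81, 1160, 1552, 2592, 3136], [
    (5, 205163980996896), (5, 205163980997136)]),
  ([89, 310, 393, 584, 666, 1195], [545, 74, 770, 276, 1540, 3088], [
]),
  ([70, 155, 873, 1178], [81, 2561, 584, 1552], [
    (0, 188663000470836), (1, 204132935861061), (0, 188662999426356), (1, 204132934878021),
    (1, 204132935861061), (48, 205159453176336), (48, 205163731366416), (48, 205163731366176),
    (48, 205159453176096)]),
  ([72, 155, 310, 393, 601, 1178], [273, 2561, 74, 770, 548, 1552], [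
    (2, 205163983024161)]),
  ([311, 410, 585, 634, 939], [138, 1538, 532, 1156, 3080], [
    (48, 171143312130081), (0, 171147840934401), (5, 171147841978896), (48, 171143312130081)]),
  ([71, 155, 310, 603, 633, 1178], [145, 2561, 74, 2084, 644, 1552], [
    (0, 205163983024161)]),
  ([54, 326], [73, 82], [
    (5, 205163978687796), (5, 205163982041601), (5, 205163982041601), (11, 188671306580481),
    (5, 186609719969076), (5, 204133186536756), (5, 205163978687796), (5, 205163980935456),
    (5, 205163980935456), (21, 205149987473511), (21, 205149987473511), (21, 204119195322471),
    (21, 204119446919271), (5, 205163980997136), (5, 205163980997136), (3, 205149987412071),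
    (31, 188663000470611), (5, 204133185492291), (3, 171133846427751), (0, 205136253580371),
    (5, 205136251614516), (0, 205136252535891), (5, 205136251553076), (21, 205150239070311),
    (2, 205136252658516), (2, 205136253641556), (5, 205163977643331), (0, 205136250226566),
    (0, 205136250226806), (3, 205136250226791), (44, 205145715929616)]),
  ([54, 71, 329, 600], [73, 145, 530, 292], [
    (0, 171147588354561), (4, 205163983024641), (59, 204128658936321), (59, 186605192368641),
    (43, 171143308776771), (4, 205163979670836), (2, 205163731304961), (2, 188671056888321),
    (2, 205149994119681)]),
  ([59, 310, 343, 584, 666], [2057, 74, 162, 276, 1540], [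
    (3, 205163980935681)]),
  ([54, 329, 567, 600], [73, 530, 140, 292], [
    (41, 171147837703251), (18, 205163978564916), (18, 205163978564916), (0, 205163726906676),
    (0, 188671052490036), (0, 171147585922356), (2, 205163979670836), (41, 205159453114656),
    (41, 188666778698016), (0, 205131975390516)]),
  ([310, 327, 1178], [74, 146, 1552], [
    (1, 205163978564691), (40, 171143308838211), (40, 188666775405891), (1, 205163980997121),
    (1, 205163980997121), (40, 205159453176336), (40, 205159453176336), (40, 205159453176336),
    (1, 205163978687571), (0, 204133190873616), (40, 205163983024161), (4, 205163983024656),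
    (1, 205136251614531), (40, 205159453175826)]),
  ([155, 310, 327, 1178], [2561, 74, 146, 1552], [
    (0, 205163980997121), (0, 205163980997121), (39, 205159453176336), (39, 205159453176336),
    (0, 205163978687571), (39, 205163983024161), (3, 205163983024656), (0, 205136251614531),
    (39, 205159453175826)]),
  ([73, 86, 310], [529, 97, 74], [
    (15, 204115420448871), (25, 188663000532291), (15, 186591953881191), (25, 205155674948931),
    (11, 205155676213776), (5, 171147839951376), (4, 171147837703476), (11, 205155672921171),
    (5, 188671308608001), (9, 205149986489991), (0, 204132937187616), (0, 204128658997536),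
    (15, 205141933426791), (2, 205136500840551), (2, 188643826423911), (38, 205149994119681)]),
  ([58, 71, 310, 599, 1162], [1033, 145, 74, 164, 1296], [
    (4, 188671056888096), (4, 186609472586016), (3, 188671053595731), (14, 205141933303926),
    (10, 204105460507476), (0, 205131975390291)]),
  ([72, 122, 310, 567, 602, 1178], [273, 1153, 74, 140, 1060, 1552], [
    (0, 171147584939316), (36, 205163731366146)]),
  ([310, 327, 1178, 1385], [74, 146, 1552, 608], [
    (35, 171143308838211), (35, 188666775405891), (35, 205159453176336), (35, 205159453176336),
    (35, 205159453176336), (0, 205163983024146), (8, 205131971115126), (35, 205159453175826)]),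
  ([310, 327, 683, 1178, 1385], [74, 146, 3076, 1552, 608], [
    (34, 188666775405891), (34, 205159453176336), (7, 205131971115126), (34, 205159453175826)]),
  ([59, 342, 566, 1178], [2057, 98, 76, 1552], [
    (20, 205155678302736), (20, 205155678302736), (20, 205155678302736), (6, 205155674887221),
    (10, 204115418421351), (10, 205146210572391), (6, 205131974468421), (6, 205131975451461),
    (6, 186601415124051), (6, 186601163465811)]),
  ([54, 75, 342, 569], [73, 2065, 98, 524], [
    (5, 205155676213761), (2, 170117048783106), (1, 170117045552211), (0, 205163979609396),
    (3, 186587674707591), (5, 205131970009206), (5, 205131970008966), (9, 205150238025831),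
    (3, 205127945565831), (32, 205149994119696)]),
  ([75, 90, 326, 345, 566, 923], [2065, 1057, 82, 546, 76, 2568], [
    (31, 205145715929106)]),
  ([54, 75, 342, 569, 603, 1178], [73, 2065, 98, 524, 2084, 1552], [
    (17, 205155676213506)]),
  ([58, 75, 326, 345, 566, 603], [1033, 2065, 82, 546, 76, 2084], [
    (2, 205155678302466), (6, 204119193233511), (29, 205145715929106)]),
  ([568, 599, 873, 939], [268, 164, 584, 3080], [
    (1, 205159954403586), (1, 205159954403346), (0, 205163730260001), (3, 205163983024386),
    (1, 205136248198791), (5, 205159956492576)]),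
  ([310, 328, 666, 1145, 1195], [74, 274, 1540, 656, 3088], [
    (27, 188671053595971), (0, 205155677319681), (2, 205163729338881), (3, 205163977643091),
    (27, 171147590381586)]),
  ([56, 73, 344, 566], [265, 529, 290, 76], [
    (0, 205155423229236), (1, 205141933426296), (9, 205163982962976), (3, 205146212538246),
    (32, 205163731304736), (32, 188671056888096), (2, 205132477662531)]),
  ([73, 326, 344, 566, 939], [529, 82, 290, 76, 3080], [
    (25, 171143312130306), (2, 205159954403856), (2, 205150237104231), (0, 205155426644226),
    (25, 205145715929106)]),
  ([56, 87, 584, 873, 939], [265, 161, 276, 584, 3080], [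
    (10, 205163983024416), (10, 205163983024416), (11, 171147841978896), (11, 171147841978896),
    (24, 205163979609141), (1, 205155425538561)]),
  ([54, 71, 361, 568, 1178], [73, 145, 578, 268, 1552], [
    (23, 188666775344451), (23, 171143308776771), (23, 205163983024656), (23, 205159453176066)]),
  ([311, 326, 873], [138, 82, 584], [
    (0, 188671308608016), (17, 188671303226676), (22, 188666775405876), (17, 205163977643316),
    (22, 205159449822516), (1, 205159953077556), (1, 205159951111476), (0, 188671308607506),
    (17, 205163979609396), (17, 188671305192756), (11, 171147838624821), (3, 205146219307041),
    (3, 205159956492321), (5, 205131975451971), (9, 171116334430086)]),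
  ([59, 311, 326, 601, 873], [2057, 138, 82, 548, 584], [
    (21, 205159449822516), (16, 205163979609396), (4, 205131975451971), (8, 171116334430086)]),
  ([54, 73, 312, 361, 598], [73, 529, 266, 578, 100], [
    (0, 171133845383016), (0, 170103053231976), (7, 171125793364086), (20, 205163731304976),
    (20, 188671056888336)]),
  ([87, 312, 327, 347, 939, 1131, 1385], [161, 266, 146, 2082, 3080, 2128, 608], [
    (6, 205159953077301)]),
  ([56, 70, 311, 873, 1417], [265, 81, 138, 584, 800], [
    (13, 205159953138996), (13, 188667278722356), (18, 205163727951156), (18, 171147586966836),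
    (0, 204097155663171), (5, 171112056240246)]),
  ([56, 74, 87, 311, 328, 570, 598], [265, 1041, 161, 138, 274, 1036, 100], [
    (12, 204119200924161)]),
  ([57, 72, 312, 326, 600], [521, 273, 266, 82, 292], [
    (1, 171130069587816), (3, 171147838686291), (2, 205146212599656), (0, 205155421262931),
    (22, 188671056949776), (22, 205163731366416), (11, 205150244733441)]),
  ([54, 89, 326, 393, 568, 583, 598], [73, 545, 82, 770, 268, 148, 100], [
    (1, 205141681768326), (15, 205163731304736), (15, 205150245777441)]),
  ([54, 71, 88, 312, 1178, 1387], [73, 145, 289, 266, 1552, 2144], [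
    (16, 205159453176336), (39, 205163979670341), (14, 205159453176321), (14, 205159453176066)]),
  ([56, 70, 87, 328, 873, 939], [265, 81, 161, 274, 584, 3080], [
    (13, 171147841978881), (13, 171147841978626), (13, 205163979609141)]),
  ([59, 72, 568, 1178], [2057, 273, 268, 1552], [
    (12, 205163983024386), (0, 171120109242216), (12, 205163983024386), (0, 188643575809896),
    (12, 205163731366401), (12, 205163983024641), (12, 205163983024386), (12, 205163731366146)]),
  ([55, 72, 923, 1129, 1146], [137, 273, 2568, 592, 1168], [
    (11, 205163979609411), (11, 171147838625091), (11, 188671308546576), (11, 188671308546336)]),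
  ([311, 363, 566, 1178], [138, 2114, 76, 1552], [
    (1, 188667282014241), (0, 188667282014241), (2, 170113023356946), (0, 188643575810166),
    (1, 188643575810166)]),
  ([72, 89, 106, 326, 568, 923], [273, 545, 1089, 82, 268, 2568], [
]),
  ([72, 106, 326, 345, 566, 923], [273, 1089, 82, 546, 76, 2568], [
]),
  ([54, 312, 361, 666, 1195], [73, 266, 578, 1540, 3088], [
    (0, 205136250287976), (1, 205146211616616)]),
  ([54, 311, 344, 361, 585, 1195, 2202], [73, 138, 290, 578, 532, 3088, 1792], [
]),
  ([86, 310, 328, 345, 1178, 2219], [97, 74, 274, 546, 1552, 3328], [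
    (5, 205163731365906)]),
  ([54, 311, 361, 1178], [73, 138, 578, 1552], [
    (0, 205163731366176), (1, 205163983024146), (2, 205132475414406)]),
  ([55, 75, 314, 566, 633, 1178], [137, 2065, 1034, 76, 644, 1552], [
    (1, 205136501945991), (1, 205136501945991)]),
  ([311, 361, 566, 683, 1178], [138, 578, 76, 3076, 1552], [
    (0, 205131972097926), (0, 205155678302721)]),
  ([54, 71, 137, 568, 1178], [73, 145, 769, 268, 1552], [
    (1, 171143308776771), (0, 188662752166176), (1, 205159453176321), (1, 205163983024656),
    (1, 205159453176066)]),
  ([55, 72, 105, 326, 585, 923], [137, 273, 577, 82, 532, 2568], [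
    (0, 171147838625091), (0, 188671308546336)]),
  ([71, 328, 1178], [145, 274, 1552], [
    (7, 205163980935426), (5, 205159956492816), (7, 204133188784386), (1, 205163983024641),
    (0, 205159956492801), (0, 205159954403841), (5, 205163980935681), (5, 204133190873601),
    (1, 205159956492816), (1, 204129164341776), (5, 205163983024641), (15, 204097156768581),
    (0, 205131972097671), (15, 204097156769091), (0, 205131970008711), (24, 186609724244481),
    (4, 205136501946486)]),
  ([54, 71, 328, 601, 1178], [73, 145, 274, 548, 1552], [
    (2, 205163983024656), (0, 204129164341776), (4, 205163983024641), (4, 205155676213266)]),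
  ([72, 155, 327, 1178], [273, 2561, 146, 1552], [
    (1, 205159956492816), (3, 204133190873616), (1, 205159954403856), (3, 204129164341761),
    (3, 205159956492801), (13, 204097155785541), (0, 205131972097656), (13, 204097155786051),
    (0, 205131970008696), (22, 186609724244496), (2, 205136501946246)]),
  ([54, 71, 328, 601, 1178, 1947], [73, 145, 274, 548, 1552, 2688], [
    (1, 171147837580341), (2, 205163983024641), (2, 205155676213266)]),
  ([54, 71, 155, 328, 601, 1178], [73, 145, 2561, 274, 548, 1552], [
    (1, 204133190873601), (1, 205163983024641), (1, 205155676213266)]),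
  ([59, 326, 583, 1178], [2057, 82, 148, 1552], [
    (0, 204128661024786), (0, 205132473325686), (0, 205155426644001), (0, 205136499857511),
    (0, 205159453175826), (13, 186609472585746), (13, 186609724244001)]),
  ([57, 72, 327, 1178], [521, 273, 146, 1552], [
    (9, 204133186413891), (1, 205159954403586), (3, 205163983024146), (5, 205150239131256),
    (9, 204097155785541), (0, 205159954403841), (18, 186609724244496), (12, 186582243165816)]),
  ([72, 327, 345, 599, 873, 1178], [273, 146, 546, 164, 584, 1552], [
    (2, 204129164341506), (2, 205159954403586), (17, 186609724244496)]),
  ([75, 327, 345, 584, 618, 1178], [2065, 146, 546, 276, 1092, 1552], [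
    (3, 205141680723591), (7, 204133186536771), (0, 186609718924101)]),
  ([58, 311, 328, 345, 427, 617, 1131], [1033, 138, 274, 546, 3074, 580, 2128], [
]),
  ([327, 427, 569, 584, 1178], [146, 3074, 524, 276, 1552], [
    (14, 186609724243986), (5, 204133186536771), (0, 205136253580341), (8, 186573686785656)]),
  ([57, 326, 393, 566, 600, 666, 1707], [521, 82, 770, 76, 292, 1540, 3136], [
]),
  ([55, 327, 873, 939, 1946], [137, 146, 584, 3080, 1664], [
    (0, 205159956492801), (3, 204097152309366), (1, 205163982041616)]),
  ([72, 86, 312, 585, 873, 939, 2202], [273, 97, 266, 532, 584, 3080, 1792], [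
    (0, 205159956492321)]),
  ([55, 343, 598, 873, 939, 1946], [137, 162, 100, 584, 3080, 1664], [
    (0, 170089316046696), (1, 204097153353846)]),
  ([312, 331, 566, 583, 683, 1178, 1387], [266, 2066, 76, 148, 3076, 1552, 2144], [
]),
  ([74, 328, 343, 410, 566], [1041, 274, 162, 1538, 76], [
    (1, 204129164341536), (0, 204129158898996)]),
  ([71, 89, 106, 310, 411, 584, 1178], [145, 545, 1089, 74, 2562, 276, 1552], [
]),
  ([59, 73, 310, 583, 600, 666], [2057, 529, 74, 148, 292, 1540], [
]),
  ([54, 311, 585, 939, 1130], [73, 138, 532, 3080, 1104], [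
    (3, 171147836658996), (0, 205163731365921)]),
  ([54, 329, 567, 666, 939, 1146], [73, 530, 140, 1540, 3080, 1168], [
    (0, 171147841978896)]),
  ([70, 315, 566, 583, 667, 889, 1178], [81, 2058, 76, 148, 2564, 648, 1552], [
    (0, 170089320506421)]),
  ([312, 331, 361, 567, 584, 683, 1946, 2203], [266, 2066, 578, 140, 276, 3076, 1664, 2816], [
]),
  ([75, 105, 311, 342, 410, 569], [2065, 577, 138, 98, 1538, 524], [
    (0, 204124882797891)]),
  ([70, 90, 315, 344, 584, 906, 1178], [81, 1057, 2058, 290, 276, 1288, 1552], [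
    (8, 204129164341761)]),
  ([56, 311, 566, 939], [265, 138, 76, 3080], [
    (4, 205155677196306), (4, 205159955386401), (4, 205163982962976), (4, 205159955386401),
    (0, 188671308608016), (0, 205163983024656), (4, 205155678240786), (4, 205163981918496),
    (0, 205159956492801), (0, 188667282076161), (4, 205136500840326), (4, 205136501884806),
    (4, 205132474308231), (4, 205159956430881), (4, 205132475352711), (4, 205136501884806),
    (0, 205132475414631)]),
  ([56, 311, 410, 566, 939], [265, 138, 1538, 76, 3080], [
    (3, 205155677196306), (0, 205163982041106), (3, 205155678240786), (5, 205136500962936),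
    (5, 205136501945976), (3, 205132474308231), (3, 205132475352711), (5, 205136501945976)]),
  ([54, 311, 410, 568, 603, 939], [73, 138, 1538, 268, 2084, 3080], [
    (2, 205132474308711), (2, 205132475353191), (0, 170117049827616), (2, 205128197163126)]),
  ([70, 310, 328, 345, 583, 683, 1178], [81, 74, 274, 546, 148, 3076, 1552], [
    (0, 205131975451971)]),
  ([56, 73, 311, 326, 344, 410, 566, 649, 1707], [265, 529, 138, 82, 290, 1538, 76, 772, 3136], [
]),
  ([57, 72, 326, 583, 1195], [521, 273, 82, 148, 3088], [
    (2, 171147590381856), (0, 205136499857286), (0, 205132473325191), (1, 205163731304466)]),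
  ([57, 71, 326, 343, 584, 1195, 1385], [521, 145, 82, 162, 276, 3088, 608], [
    (1, 171143312191776)]),
  ([54, 311, 568, 585, 939, 1946], [73, 138, 268, 532, 3080, 1664], [
    (0, 171147590320146)]),
  ([59, 72, 326, 345, 583, 1178], [2057, 273, 82, 546, 148, 1552], [
    (1, 205155678302466), (0, 205155674948691)]),
  ([59, 105, 329, 343, 567, 584, 598, 666], [2057, 577, 530, 162, 140, 276, 100, 1540], [
]),
  ([57, 70, 315, 327, 584, 601, 1178], [521, 81, 2058, 146, 276, 548, 1552], [
    (0, 170117045429061)]),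
  ([59, 312, 326, 343, 427, 587, 601, 1178], [2057, 266, 82, 162, 3074, 2068, 548, 1552], [
])]

def seq33 : List ℕ := [11, 10, 0, 9, 1, 3, 2, 4, 6, 5, 7, 8]

theorem cW33 : checkW 4 [7, 56, 448] seq33 pats33 = true := by decide +kernel

theorem cS33 : check 12 [18, 837, 1656] [7, 56, 448] pats33 sts33 = true := by decide +kernel

def pats20 : List (List ℕ) := [
]

def sts20 : List St := [
  ([], [], [
])]

def seq20 : List ℕ := [0, 1, 3, 2, 4, 5]

theorem cW20 : checkW 3 [7, 56] seq20 pats20 = true := by decide +kernel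

theorem cS20 : check 6 [18, 837] [7, 56] pats20 sts20 = true := by decide +kernel

def pats21 : List (List ℕ) := [
  [74]]

def sts21 : List St := [
  ([], [], [
    (0, 106181121)]),
  ([54], [73], [
])]

def seq21 : List ℕ := [0, 6, 1, 3, 2, 4, 5]

theorem cW21 : checkW 3 [7, 56] seq21 pats21 = true := by decide +kernel

theorem cS21 : check 7 [18, 837] [7, 56] pats21 sts21 = true := by decide +kernel

def pats22 : List (List ℕ) := [
  [193], [74], [200]]

def sts22 : List St := [
  ([], [], [
    (0, 1985229313), (1, 1985229313), (0, 1981875508)]),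
  ([359], [194], [
]),
  ([54], [73], [
])]

def seq22 : List ℕ := [7, 0, 6, 1, 3, 2, 4, 5]

theorem cW22 : checkW 3 [7, 56] seq22 pats22 = true := by decide +kernel

theorem cS22 : check 8 [18, 837] [7, 56] pats22 sts22 = true := by decide +kernel

def pats23 : List (List ℕ) := [
  [73, 386], [137, 322], [265, 194], [193], [321, 138], [385], [74], [200]]

def sts23 : List St := [
  ([], [], [
    (2, 36344967696), (0, 32318435856), (0, 36344967696), (0, 36344967681), (0, 32318435841),
    (0, 28040245761), (2, 36344967681), (0, 36341613876)]),
  ([359], [194], [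
    (1, 31815119376), (0, 36093309456)]),
  ([104, 359], [321, 194], [
]),
  ([54], [73], [
    (0, 36344967456), (1, 36341613891)]),
  ([54, 632], [73, 388], [
]),
  ([54, 888], [73, 392], [
])]

def seq23 : List ℕ := [8, 7, 0, 6, 1, 3, 2, 4, 5]

theorem cW23 : checkW 3 [7, 56] seq23 pats23 = true := by decide +kernel

theorem cS23 : check 9 [18, 837] [7, 56] pats23 sts23 = true := by decide +kernel

def pats10 : List (List ℕ) := [
]

def sts10 : List St := [
  ([], [], [
])]

def seq10 : List ℕ := [0, 1, 2]

theorem cW10 : checkW 2 [7] seq10 pats10 = true := by decide +kernel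

theorem cS10 : check 3 [18] [7] pats10 sts10 = true := by decide +kernel

def pats11 : List (List ℕ) := [
]

def sts11 : List St := [
  ([], [], [
])]

def seq11 : List ℕ := [0, 1, 3, 2]

theorem cW11 : checkW 2 [7] seq11 pats11 = true := by decide +kernel

theorem cS11 : check 4 [18] [7] pats11 sts11 = true := by decide +kernel

def pats12 : List (List ℕ) := [
]

def sts12 : List St := [
  ([], [], [
])]

def seq12 : List ℕ := [4, 0, 1, 3, 2]

theorem cW12 : checkW 2 [7] seq12 pats12 = true := by decide +kernel

theorem cS12 : check 5 [18] [7] pats12 sts12 = true := by decide +kernel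

def pats13 : List (List ℕ) := [
  [49]]

def sts13 : List St := [
  ([], [], [
    (0, 3490320)]),
  ([52], [25], [
])]

def seq13 : List ℕ := [5, 4, 0, 1, 3, 2]

theorem cW13 : checkW 2 [7] seq13 pats13 = true := by decide +kernel

theorem cS13 : check 6 [18] [7] pats13 sts13 = true := by decide +kernel

theorem fin30 {α : Type*} [DecidableEq α] {V : Finset α} {B : Finset (Finset α)}
    (hT : IsPSTS V B) (hk : HasDisjointBlocks B 3) (h4 : ¬ HasDisjointBlocks B 4)
    (hc : V.card = 9) : Sequenceable V B :=
  finish hT (by norm_num) hk h4 cS30 cW30 (by decide) (by decide)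
    (by decide) (by decide)
    (by intro x; simp only [seq30, List.mem_cons, List.not_mem_nil, or_false]; omega)
    (by norm_num) ⟨_, List.mem_cons_self, rfl⟩ (Or.inl hc)

theorem fin31 {α : Type*} [DecidableEq α] {V : Finset α} {B : Finset (Finset α)}
    (hT : IsPSTS V B) (hk : HasDisjointBlocks B 3) (h4 : ¬ HasDisjointBlocks B 4)
    (hc : V.card = 10) : Sequenceable V B :=
  finish hT (by norm_num) hk h4 cS31 cW31 (by decide) (by decide)
    (by decide) (by decide)
    (by intro x; simp only [seq31, List.mem_cons, List.not_mem_nil, or_false]; omega)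
    (by norm_num) ⟨_, List.mem_cons_self, rfl⟩ (Or.inl hc)

theorem fin32 {α : Type*} [DecidableEq α] {V : Finset α} {B : Finset (Finset α)}
    (hT : IsPSTS V B) (hk : HasDisjointBlocks B 3) (h4 : ¬ HasDisjointBlocks B 4)
    (hc : V.card = 11) : Sequenceable V B :=
  finish hT (by norm_num) hk h4 cS32 cW32 (by decide) (by decide)
    (by decide) (by decide)
    (by intro x; simp only [seq32, List.mem_cons, List.not_mem_nil, or_false]; omega)
    (by norm_num) ⟨_, List.mem_cons_self, rfl⟩ (Or.inl hc)

theorem fin33 {α : Type*} [DecidableEq α] {V : Finset α} {B : Finset (Finset α)}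
    (hT : IsPSTS V B) (hk : HasDisjointBlocks B 3) (h4 : ¬ HasDisjointBlocks B 4)
    (hc : 12 ≤ V.card) : Sequenceable V B :=
  finish hT (by norm_num) hk h4 cS33 cW33 (by decide) (by decide)
    (by decide) (by decide)
    (by intro x; simp only [seq33, List.mem_cons, List.not_mem_nil, or_false]; omega)
    (by norm_num) ⟨_, List.mem_cons_self, rfl⟩ (Or.inr ⟨hc, by decide⟩)

theorem fin20 {α : Type*} [DecidableEq α] {V : Finset α} {B : Finset (Finset α)}
    (hT : IsPSTS V B) (hk : HasDisjointBlocks B 2) (h4 : ¬ HasDisjointBlocks B 3)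
    (hc : V.card = 6) : Sequenceable V B :=
  finish hT (by norm_num) hk h4 cS20 cW20 (by decide) (by decide)
    (by decide) (by decide)
    (by intro x; simp only [seq20, List.mem_cons, List.not_mem_nil, or_false]; omega)
    (by norm_num) ⟨_, List.mem_cons_self, rfl⟩ (Or.inl hc)

theorem fin21 {α : Type*} [DecidableEq α] {V : Finset α} {B : Finset (Finset α)}
    (hT : IsPSTS V B) (hk : HasDisjointBlocks B 2) (h4 : ¬ HasDisjointBlocks B 3)
    (hc : V.card = 7) : Sequenceable V B :=
  finish hT (by norm_num) hk h4 cS21 cW21 (by decide) (by decide)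
    (by decide) (by decide)
    (by intro x; simp only [seq21, List.mem_cons, List.not_mem_nil, or_false]; omega)
    (by norm_num) ⟨_, List.mem_cons_self, rfl⟩ (Or.inl hc)

theorem fin22 {α : Type*} [DecidableEq α] {V : Finset α} {B : Finset (Finset α)}
    (hT : IsPSTS V B) (hk : HasDisjointBlocks B 2) (h4 : ¬ HasDisjointBlocks B 3)
    (hc : V.card = 8) : Sequenceable V B :=
  finish hT (by norm_num) hk h4 cS22 cW22 (by decide) (by decide)
    (by decide) (by decide)
    (by intro x; simp only [seq22, List.mem_cons, List.not_mem_nil, or_false]; omega)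
    (by norm_num) ⟨_, List.mem_cons_self, rfl⟩ (Or.inl hc)

theorem fin23 {α : Type*} [DecidableEq α] {V : Finset α} {B : Finset (Finset α)}
    (hT : IsPSTS V B) (hk : HasDisjointBlocks B 2) (h4 : ¬ HasDisjointBlocks B 3)
    (hc : 9 ≤ V.card) : Sequenceable V B :=
  finish hT (by norm_num) hk h4 cS23 cW23 (by decide) (by decide)
    (by decide) (by decide)
    (by intro x; simp only [seq23, List.mem_cons, List.not_mem_nil, or_false]; omega)
    (by norm_num) ⟨_, List.mem_cons_self, rfl⟩ (Or.inr ⟨hc, by decide⟩)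

theorem fin10 {α : Type*} [DecidableEq α] {V : Finset α} {B : Finset (Finset α)}
    (hT : IsPSTS V B) (hk : HasDisjointBlocks B 1) (h4 : ¬ HasDisjointBlocks B 2)
    (hc : V.card = 3) : Sequenceable V B :=
  finish hT (by norm_num) hk h4 cS10 cW10 (by decide) (by decide)
    (by decide) (by decide)
    (by intro x; simp only [seq10, List.mem_cons, List.not_mem_nil, or_false]; omega)
    (by norm_num) ⟨_, List.mem_cons_self, rfl⟩ (Or.inl hc)

theorem fin11 {α : Type*} [DecidableEq α] {V : Finset α} {B : Finset (Finset α)}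
    (hT : IsPSTS V B) (hk : HasDisjointBlocks B 1) (h4 : ¬ HasDisjointBlocks B 2)
    (hc : V.card = 4) : Sequenceable V B :=
  finish hT (by norm_num) hk h4 cS11 cW11 (by decide) (by decide)
    (by decide) (by decide)
    (by intro x; simp only [seq11, List.mem_cons, List.not_mem_nil, or_false]; omega)
    (by norm_num) ⟨_, List.mem_cons_self, rfl⟩ (Or.inl hc)

theorem fin12 {α : Type*} [DecidableEq α] {V : Finset α} {B : Finset (Finset α)}
    (hT : IsPSTS V B) (hk : HasDisjointBlocks B 1) (h4 : ¬ HasDisjointBlocks B 2)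
    (hc : V.card = 5) : Sequenceable V B :=
  finish hT (by norm_num) hk h4 cS12 cW12 (by decide) (by decide)
    (by decide) (by decide)
    (by intro x; simp only [seq12, List.mem_cons, List.not_mem_nil, or_false]; omega)
    (by norm_num) ⟨_, List.mem_cons_self, rfl⟩ (Or.inl hc)

theorem fin13 {α : Type*} [DecidableEq α] {V : Finset α} {B : Finset (Finset α)}
    (hT : IsPSTS V B) (hk : HasDisjointBlocks B 1) (h4 : ¬ HasDisjointBlocks B 2)
    (hc : 6 ≤ V.card) : Sequenceable V B :=
  finish hT (by norm_num) hk h4 cS13 cW13 (by decide) (by decide)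
    (by decide) (by decide)
    (by intro x; simp only [seq13, List.mem_cons, List.not_mem_nil, or_false]; omega)
    (by norm_num) ⟨_, List.mem_cons_self, rfl⟩ (Or.inr ⟨hc, by decide⟩)

theorem card_ge {α : Type*} [DecidableEq α] {V : Finset α} {B : Finset (Finset α)}
    (hT : IsPSTS V B) {k : ℕ} (hk : HasDisjointBlocks B k) : 3 * k ≤ V.card := by
  obtain ⟨P, hP, hPc, hd⟩ := hk
  have h1 : (P.biUnion id).card = P.card * 3 := by
    rw [Finset.card_biUnion (t := id) (fun x hx y hy hxy => hd hx hy hxy)]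
    exact Finset.sum_const_nat (fun b hb => (hT.1 b (hP hb)).2)
  have h2 : P.biUnion id ⊆ V := by
    intro v hv
    obtain ⟨b, hb, hvb⟩ := Finset.mem_biUnion.1 hv
    exact (hT.1 b (hP hb)).1 hvb
  have := Finset.card_le_card h2
  omega

end PSeq

/-- Every partial Steiner triple system with at most three pairwise disjoint
blocks (i.e. without four pairwise disjoint blocks) is sequenceable. -/
theorem sequenceable_of_at_most_three_disjoint_blocks {α : Type*} [DecidableEq α]
    (V : Finset α) (B : Finset (Finset α)) (hT : IsPSTS V B)
    (h : ¬ HasDisjointBlocks B 4) :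
    Sequenceable V B := by
  by_cases h3 : HasDisjointBlocks B 3
  · have hc := PSeq.card_ge hT h3
    rcases (by omega : V.card = 9 ∨ V.card = 10 ∨ V.card = 11 ∨ 12 ≤ V.card) with e | e | e | e
    · exact PSeq.fin30 hT h3 h e
    · exact PSeq.fin31 hT h3 h e
    · exact PSeq.fin32 hT h3 h e
    · exact PSeq.fin33 hT h3 h e
  by_cases h2 : HasDisjointBlocks B 2
  · have hc := PSeq.card_ge hT h2
    rcases (by omega : V.card = 6 ∨ V.card = 7 ∨ V.card = 8 ∨ 9 ≤ V.card) with e | e | e | e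
    · exact PSeq.fin20 hT h2 h3 e
    · exact PSeq.fin21 hT h2 h3 e
    · exact PSeq.fin22 hT h2 h3 e
    · exact PSeq.fin23 hT h2 h3 e
  by_cases h1 : HasDisjointBlocks B 1
  · have hc := PSeq.card_ge hT h1
    rcases (by omega : V.card = 3 ∨ V.card = 4 ∨ V.card = 5 ∨ 6 ≤ V.card) with e | e | e | e
    · exact PSeq.fin10 hT h1 h2 e
    · exact PSeq.fin11 hT h1 h2 e
    · exact PSeq.fin12 hT h1 h2 e
    · exact PSeq.fin13 hT h1 h2 e
  exact PSeq.no_blocks h1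
end

section
/- Let k ≥ 1 be an integer. Every partial Steiner triple system that has k pairwise disjoint blocks, does not have k+1 pairwise disjoint blocks, and has order at least 15k − 5, is sequenceable. -/
lemma psq_count {Y : Type*} [DecidableEq Y] (S : Finset Y) (R : Y → Y → Prop) [DecidableRel R]
    (hs : ∀ x y, R x y → R y x) (hi : ∀ x, ¬ R x x)
    (hf : ∀ x y z, R x y → R x z → y = z) :
    ((S ×ˢ S).filter (fun p => R p.1 p.2)).card ≤ 2 * (S.card / 2) := by
  set F := (S ×ˢ S).filter (fun p => R p.1 p.2) with hF
  have h1 : F.card ≤ S.card := by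
    apply Finset.card_le_card_of_injOn Prod.fst
    · intro p hp
      simp [hF] at hp
      simpa using hp.1.1
    · rintro ⟨a, b⟩ hp ⟨c, d⟩ hq h
      simp [hF] at hp hq h
      subst h
      rw [hf _ _ _ hp.2 hq.2]
  have h2 : ((F.card : ℕ) : ZMod 2) = 0 := by
    have : ∑ p ∈ F, (1 : ZMod 2) = 0 := by
      apply Finset.sum_involution (fun p _ => p.swap)
      · intros; decide
      · rintro ⟨a, b⟩ hp _ h
        simp [hF] at hp h
        obtain ⟨h, -⟩ := h
        subst h
        exact hi _ hp.2
      · rintro ⟨a, b⟩ hp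
        rfl
      · rintro ⟨a, b⟩ hp
        simp [hF] at hp ⊢
        exact ⟨⟨hp.1.2, hp.1.1⟩, hs _ _ hp.2⟩
    simpa using this
  have h3 := (ZMod.natCast_eq_zero_iff_even).1 h2
  obtain ⟨t, ht⟩ := h3
  omega

lemma psq_arith (m : ℕ) (hm : 1 ≤ m) : 2 * (m / 2) * (2 * ((m - 1) / 2) + 1) ≤ m * (m - 1) := by
  obtain ⟨t, rfl | rfl⟩ := Nat.even_or_odd' m
  · obtain ⟨t, rfl⟩ : ∃ s, t = s + 1 := ⟨t - 1, by omega⟩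
    have h1 : 2 * (t + 1) / 2 = t + 1 := by omega
    have h2 : (2 * (t + 1) - 1) / 2 = t := by omega
    have h3 : 2 * (t + 1) - 1 = 2 * t + 1 := by omega
    rw [h1, h2, h3]
  · have h1 : (2 * t + 1) / 2 = t := by omega
    have h2 : (2 * t + 1 - 1) / 2 = t := by omega
    have h3 : 2 * t + 1 - 1 = 2 * t := by omega
    rw [h1, h2, h3, mul_comm]

lemma psq_fiber {X Y : Type*} [Fintype X] [Fintype Y] [DecidableEq X] [DecidableEq Y]
    (r : ℕ) (f : Fin r ↪ X) (h h' : Fin r ↪ Y) :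
    (Finset.univ.filter (fun g : X ≃ Y => f.trans g.toEmbedding = h)).card ≤
    (Finset.univ.filter (fun g : X ≃ Y => f.trans g.toEmbedding = h')).card := by
  obtain ⟨τ, hτ⟩ : ∃ τ : Equiv.Perm Y, τ • h = h' := by
    have := (Equiv.Perm.isMultiplyPretransitive Y r)
    exact this.exists_smul_eq h h'
  apply Finset.card_le_card_of_injOn (fun g => g.trans τ)
  · intro g hg
    simp at hg ⊢
    ext i
    rw [← hτ, ← hg]
    simp
  · intro g _ g' _ hgg
    ext x
    have := congrArg (fun e => e x) hgg
    simpa using this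

lemma psq_avg {X Y : Type*} [Fintype X] [Fintype Y] [DecidableEq X] [DecidableEq Y]
    (r : ℕ) (f : Fin r ↪ X) (Q : (Fin r ↪ Y) → Prop) [DecidablePred Q] :
    (Finset.univ.filter (fun g : X ≃ Y => Q (f.trans g.toEmbedding))).card *
      (Fintype.card Y).descFactorial r =
    Fintype.card (X ≃ Y) * (Finset.univ.filter Q).card := by
  have key : ∀ h : Fin r ↪ Y,
      (Finset.univ.filter (fun g : X ≃ Y => f.trans g.toEmbedding = h)).card *
      (Fintype.card Y).descFactorial r = Fintype.card (X ≃ Y) := by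
    intro h
    have h1 : Fintype.card (X ≃ Y) = ∑ h' : Fin r ↪ Y,
      (Finset.univ.filter (fun g : X ≃ Y => f.trans g.toEmbedding = h')).card := by
      rw [← Finset.card_univ]
      apply Finset.card_eq_sum_card_fiberwise
      intro g _
      simp
    rw [h1, Finset.sum_congr rfl (fun h' _ => le_antisymm (psq_fiber r f h' h) (psq_fiber r f h h'))]
    simp [Fintype.card_embedding_eq, mul_comm]
  have h2 : (Finset.univ.filter (fun g : X ≃ Y => Q (f.trans g.toEmbedding))).card =
      ∑ h' ∈ Finset.univ.filter Q,
      (Finset.univ.filter (fun g : X ≃ Y => f.trans g.toEmbedding = h')).card := by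
    rw [Finset.card_eq_sum_card_fiberwise (f := fun g : X ≃ Y => f.trans g.toEmbedding)
      (t := Finset.univ.filter Q)]
    · apply Finset.sum_congr rfl
      intro h' hh
      simp at hh
      congr 1
      ext g
      simp only [Finset.mem_filter, Finset.mem_univ, true_and]
      constructor
      · exact fun h => h.2
      · intro h
        exact ⟨h ▸ hh, h⟩
    · intro g hg
      simpa using hg
  rw [h2, Finset.sum_mul, Finset.sum_congr rfl (fun h' _ => key h')]
  simp [mul_comm]

lemma psq_pair {X Y : Type*} [Fintype X] [Fintype Y] [DecidableEq X] [DecidableEq Y]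
    (m : ℕ) (hm : Fintype.card Y = m) (hm4 : 4 ≤ m) (x y : X) (hxy : x ≠ y)
    (R : Y → Y → Prop) [DecidableRel R]
    (hs : ∀ x y, R x y → R y x) (hi : ∀ x, ¬ R x x)
    (hf : ∀ x y z, R x y → R x z → y = z) :
    (Finset.univ.filter (fun g : X ≃ Y => R (g x) (g y))).card * (2 * ((m - 1) / 2) + 1) ≤
      Fintype.card (X ≃ Y) := by
  have hinj : Function.Injective ![x, y] := by
    intro i j; fin_cases i <;> fin_cases j <;> simp [hxy, hxy.symm]
  have h := psq_avg (Y := Y) 2 ⟨![x, y], hinj⟩ (fun h => R (h 0) (h 1))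
  simp only [Function.Embedding.trans_apply, Function.Embedding.coeFn_mk, Matrix.cons_val_zero,
    Matrix.cons_val_one, Equiv.coe_toEmbedding] at h
  set c := (Finset.univ.filter (fun h : Fin 2 ↪ Y => R (h 0) (h 1))).card
  have hc : c ≤ 2 * (m / 2) := by
    rw [← hm, ← Finset.card_univ]
    refine le_trans ?_ (psq_count Finset.univ R hs hi hf)
    apply Finset.card_le_card_of_injOn (fun h => (h 0, h 1))
    · intro h hh
      simpa using hh
    · intro h _ h' _ hh
      simp at hh
      ext i
      fin_cases i
      · exact hh.1
      · exact hh.2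
  have ha := psq_arith m (by omega)
  have hd : m.descFactorial 2 = m * (m - 1) := by
    simp [Nat.descFactorial, mul_comm]
  rw [hm, hd] at h
  have hpos : 0 < m * (m - 1) := Nat.mul_pos (by omega) (by omega)
  refine Nat.le_of_mul_le_mul_right ?_ hpos
  calc _ = (Finset.univ.filter (fun g : X ≃ Y => R (g x) (g y))).card * (m * (m - 1)) * (2 * ((m - 1) / 2) + 1) := by ring
    _ = Fintype.card (X ≃ Y) * (c * (2 * ((m - 1) / 2) + 1)) := by rw [h]; ring
    _ ≤ _ := Nat.mul_le_mul_left _ ((Nat.mul_le_mul_right _ hc).trans ha)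

lemma psq_quad {X Y : Type*} [Fintype X] [Fintype Y] [DecidableEq X] [DecidableEq Y]
    (m : ℕ) (hm : Fintype.card Y = m) (hm4 : 4 ≤ m) (x y z w : X)
    (hn : [x, y, z, w].Nodup)
    (R R' : Y → Y → Prop) [DecidableRel R] [DecidableRel R']
    (hs : ∀ x y, R x y → R y x) (hi : ∀ x, ¬ R x x)
    (hf : ∀ x y z, R x y → R x z → y = z)
    (hs' : ∀ x y, R' x y → R' y x) (hi' : ∀ x, ¬ R' x x)
    (hf' : ∀ x y z, R' x y → R' x z → y = z) :
    (Finset.univ.filter (fun g : X ≃ Y => R (g x) (g y) ∧ R' (g z) (g w))).card *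
      ((2 * ((m - 1) / 2) + 1) * (2 * ((m - 3) / 2) + 1)) ≤
      Fintype.card (X ≃ Y) := by
  have hinj : Function.Injective ![x, y, z, w] := by
    simp at hn
    intro i j; fin_cases i <;> fin_cases j <;> simp <;> grind
  have h := psq_avg (Y := Y) 4 ⟨![x, y, z, w], hinj⟩ (fun h => R (h 0) (h 1) ∧ R' (h 2) (h 3))
  simp only [Function.Embedding.trans_apply, Function.Embedding.coeFn_mk, Matrix.cons_val_zero,
    Matrix.cons_val_one, Matrix.cons_val, Equiv.coe_toEmbedding] at h
  set c := (Finset.univ.filter (fun h : Fin 4 ↪ Y => R (h 0) (h 1) ∧ R' (h 2) (h 3))).card with hcd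
  set F := ((Finset.univ ×ˢ Finset.univ).filter (fun p : Y × Y => R p.1 p.2)) with hF
  have hFc : F.card ≤ 2 * (m / 2) := by
    have := psq_count Finset.univ R hs hi hf
    rwa [Finset.card_univ, hm] at this
  have hc : c ≤ 2 * (m / 2) * (2 * ((m - 2) / 2)) := by
    have h1 : c ≤ (F.sigma (fun p => (((Finset.univ \ {p.1, p.2}) ×ˢ (Finset.univ \ {p.1, p.2})).filter
        (fun q : Y × Y => R' q.1 q.2)))).card := by
      apply Finset.card_le_card_of_injOn (fun h => ⟨(h 0, h 1), (h 2, h 3)⟩)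
      · intro h hh
        simp at hh
        have : ∀ i j : Fin 4, i ≠ j → h i ≠ h j := fun i j hij e => hij (h.injective e)
        simp [hF, hh]
      · intro h _ h' _ hh
        simp at hh
        ext i
        fin_cases i
        · exact hh.1.1
        · exact hh.1.2
        · exact hh.2.1
        · exact hh.2.2
    rw [Finset.card_sigma] at h1
    refine h1.trans ((Finset.sum_le_card_nsmul F _ (2 * ((m - 2) / 2)) ?_).trans ?_)
    · rintro ⟨a, b⟩ hp
      simp [hF] at hp
      have hab : a ≠ b := by rintro rfl; exact hi _ hp
      have := psq_count (Finset.univ \ {a, b}) R' hs' hi' hf'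
      rwa [Finset.card_sdiff_of_subset (Finset.subset_univ _), Finset.card_univ, hm, Finset.card_pair hab] at this
    · rw [smul_eq_mul]
      exact Nat.mul_le_mul_right _ hFc
  have ha := psq_arith m (by omega)
  have ha' := psq_arith (m - 2) (by omega)
  have e1 : m - 2 - 1 = m - 3 := by omega
  rw [e1] at ha'
  have hd : m.descFactorial 4 = (m * (m - 1)) * ((m - 2) * (m - 3)) := by
    simp [Nat.descFactorial]; ring
  rw [hm, hd] at h
  have hpos : 0 < (m * (m - 1)) * ((m - 2) * (m - 3)) :=
    Nat.mul_pos (Nat.mul_pos (by omega) (by omega)) (Nat.mul_pos (by omega) (by omega))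
  refine Nat.le_of_mul_le_mul_right ?_ hpos
  have hfin : c * ((2 * ((m - 1) / 2) + 1) * (2 * ((m - 3) / 2) + 1)) ≤
      (m * (m - 1)) * ((m - 2) * (m - 3)) :=
    calc _ ≤ (2 * (m / 2) * (2 * ((m - 2) / 2))) * ((2 * ((m - 1) / 2) + 1) * (2 * ((m - 3) / 2) + 1)) :=
          Nat.mul_le_mul_right _ hc
      _ = (2 * (m / 2) * (2 * ((m - 1) / 2) + 1)) * ((2 * ((m - 2) / 2)) * (2 * ((m - 3) / 2) + 1)) := by ring
      _ ≤ _ := Nat.mul_le_mul ha ha'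
  calc _ = ((Finset.univ.filter (fun g : X ≃ Y => R (g x) (g y) ∧ R' (g z) (g w))).card * ((m * (m - 1)) * ((m - 2) * (m - 3)))) * ((2 * ((m - 1) / 2) + 1) * (2 * ((m - 3) / 2) + 1)) := by ring
    _ = Fintype.card (X ≃ Y) * (c * ((2 * ((m - 1) / 2) + 1) * (2 * ((m - 3) / 2) + 1))) := by rw [h]; ring
    _ ≤ _ := Nat.mul_le_mul_left _ hfin

def psqPos (r n c : ℕ) : ℕ := if c = r - 1 then n - 1 else 5 * c - 1

def psqE2 (r n : ℕ) : Finset (ℕ × ℕ × ℕ) :=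
  {(0, 1, 2), (n - 1, n - 3, n - 2)} ∪ (Finset.Ico 1 (r - 1)).biUnion (fun c =>
    {(5 * c - 1, 5 * c - 3, 5 * c - 2), (5 * c - 1, 5 * c - 2, 5 * c),
      (5 * c - 1, 5 * c, 5 * c + 1)})

def psqE4 (r n : ℕ) : Finset ((ℕ × ℕ × ℕ) × (ℕ × ℕ × ℕ)) :=
  {((0, 1, 3), (4, 2, 5)), ((0, 2, 3), (4, 1, 5)), ((0, 2, 5), (4, 1, 3)), ((0, 3, 5), (4, 1, 2))} ∪
  (Finset.Ico 1 (r - 1)).biUnion (fun c =>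
    {((5 * c - 1, 5 * c, 5 * c + 2), (psqPos r n (c + 1), 5 * c + 1, 5 * c + 3)),
     ((5 * c - 1, 5 * c, 5 * c + 3), (psqPos r n (c + 1), 5 * c + 1, 5 * c + 2)),
     ((5 * c - 1, 5 * c + 1, 5 * c + 2), (psqPos r n (c + 1), 5 * c, 5 * c + 3)),
     ((5 * c - 1, 5 * c + 1, 5 * c + 3), (psqPos r n (c + 1), 5 * c, 5 * c + 2)),
     ((5 * c - 1, 5 * c + 2, 5 * c + 3), (psqPos r n (c + 1), 5 * c, 5 * c + 1))})

lemma psqE2_card (r n : ℕ) (hr : 3 ≤ r) : (psqE2 r n).card ≤ 3 * r - 4 := by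
  unfold psqE2
  refine (Finset.card_union_le _ _).trans ?_
  have h1 : ({(0, 1, 2), (n - 1, n - 3, n - 2)} : Finset (ℕ × ℕ × ℕ)).card ≤ 2 := Finset.card_le_two
  have h2 := Finset.card_biUnion_le_card_mul (Finset.Ico 1 (r - 1)) (fun c : ℕ =>
    ({(5 * c - 1, 5 * c - 3, 5 * c - 2), (5 * c - 1, 5 * c - 2, 5 * c),
      (5 * c - 1, 5 * c, 5 * c + 1)} : Finset (ℕ × ℕ × ℕ))) 3 (fun c _ => Finset.card_le_three)
  rw [Nat.card_Ico] at h2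
  omega

lemma psqE4_card (r n : ℕ) (hr : 3 ≤ r) : (psqE4 r n).card ≤ 5 * r - 6 := by
  unfold psqE4
  refine (Finset.card_union_le _ _).trans ?_
  have h1 : ({((0, 1, 3), (4, 2, 5)), ((0, 2, 3), (4, 1, 5)), ((0, 2, 5), (4, 1, 3)), ((0, 3, 5), (4, 1, 2))} :
    Finset ((ℕ × ℕ × ℕ) × (ℕ × ℕ × ℕ))).card ≤ 4 := Finset.card_le_four
  have h2 := Finset.card_biUnion_le_card_mul (Finset.Ico 1 (r - 1)) (fun c : ℕ =>
    ({((5 * c - 1, 5 * c, 5 * c + 2), (psqPos r n (c + 1), 5 * c + 1, 5 * c + 3)),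
     ((5 * c - 1, 5 * c, 5 * c + 3), (psqPos r n (c + 1), 5 * c + 1, 5 * c + 2)),
     ((5 * c - 1, 5 * c + 1, 5 * c + 2), (psqPos r n (c + 1), 5 * c, 5 * c + 3)),
     ((5 * c - 1, 5 * c + 1, 5 * c + 3), (psqPos r n (c + 1), 5 * c, 5 * c + 2)),
     ((5 * c - 1, 5 * c + 2, 5 * c + 3), (psqPos r n (c + 1), 5 * c, 5 * c + 1))} :
     Finset ((ℕ × ℕ × ℕ) × (ℕ × ℕ × ℕ)))) 5 (fun c _ => Finset.card_le_five)
  rw [Nat.card_Ico] at h2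
  omega

lemma psqPos_gap (r n : ℕ) (hr : 3 ≤ r) (hn : 5 * (r - 1) ≤ n) (c c' : ℕ) (h : c ≤ c') (hc : c' < r) :
    psqPos r n c + 5 * (c' - c) ≤ psqPos r n c' + 1 := by
  unfold psqPos
  split_ifs <;> omega

lemma psqPos_lt (r n : ℕ) (hr : 3 ≤ r) (hn : 5 * (r - 1) ≤ n) (c : ℕ) (hc : c < r) :
    psqPos r n c < n := by
  unfold psqPos
  split_ifs <;> omega

lemma psq_dec0 : ∀ Q ∈ Finset.powersetCard 3 (Finset.range 6), 0 ∈ Q → 4 ∉ Q →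
    (Q, Finset.range 6 \ Q) ∈ ({({0, 1, 2}, {4, 3, 5}), ({0, 1, 3}, {4, 2, 5}), ({0, 1, 5}, {4, 2, 3}),
      ({0, 2, 3}, {4, 1, 5}), ({0, 2, 5}, {4, 1, 3}), ({0, 3, 5}, {4, 1, 2})} :
      Finset (Finset ℕ × Finset ℕ)) := by
  decide

lemma psq_dec1 : ∀ Q ∈ Finset.powersetCard 3 (Finset.range 6), 0 ∈ Q → 5 ∉ Q →
    (Q, Finset.range 6 \ Q) ∈ ({({0, 1, 2}, {5, 3, 4}), ({0, 1, 3}, {5, 2, 4}), ({0, 1, 4}, {5, 2, 3}),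
      ({0, 2, 3}, {5, 1, 4}), ({0, 2, 4}, {5, 1, 3}), ({0, 3, 4}, {5, 1, 2})} :
      Finset (Finset ℕ × Finset ℕ)) := by
  decide

set_option maxHeartbeats 2000000 in
lemma psq_window {α : Type*} [DecidableEq α] (B : Finset (Finset α)) (r n : ℕ) (hr : 3 ≤ r)
    (hn : 5 * (r - 1) ≤ n) (t : ℕ → α) (hinj : ∀ x < n, ∀ y < n, t x = t y → x = y)
    (hB3 : ∀ b ∈ B, b.card = 3)
    (hhit : ∀ b ∈ B, ∃ c < r, t (psqPos r n c) ∈ b)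
    (h2 : ∀ e ∈ psqE2 r n, ({t e.1, t e.2.1, t e.2.2} : Finset α) ∉ B)
    (h4 : ∀ e ∈ psqE4 r n, ¬ (({t e.1.1, t e.1.2.1, t e.1.2.2} : Finset α) ∈ B ∧
      ({t e.2.1, t e.2.2.1, t e.2.2.2} : Finset α) ∈ B))
    (i L : ℕ) (hL : 0 < L) (hiL : i + L ≤ n) :
    ¬ IsBlockPartition B ((Finset.Ico i (i + L)).image t) := by
  rintro ⟨P, hPB, hPd, hPU⟩
  have hL3 : L = 3 * P.card := by
    have h := congrArg Finset.card hPU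
    rw [Finset.card_biUnion (t := id) (fun x hx y hy hxy => hPd hx hy hxy), Finset.card_image_of_injOn] at h
    · rw [Finset.sum_congr rfl (fun b hb => show (id b).card = 3 from hB3 b (hPB hb))] at h
      simp at h
      omega
    · intro x hx y hy hxy
      simp at hx hy
      exact hinj _ (by omega) _ (by omega) hxy
  have hsub : ∀ b ∈ P, b ⊆ (Finset.Ico i (i + L)).image t := by
    intro b hb
    rw [← hPU]
    exact Finset.subset_biUnion_of_mem id hb
  have hpos : ∀ b ∈ P, ∀ x < n, t x ∈ b → i ≤ x ∧ x < i + L := by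
    intro b hb x hx hxb
    have := hsub b hb hxb
    simp only [Finset.mem_image, Finset.mem_Ico] at this
    obtain ⟨y, hy, hyx⟩ := this
    have := hinj y (by omega) x hx hyx
    omega
  -- indices in the window
  set C := (Finset.range r).filter (fun c => i ≤ psqPos r n c ∧ psqPos r n c < i + L) with hC
  have hch : ∀ b : Finset α, ∃ c, b ∈ P → c < r ∧ t (psqPos r n c) ∈ b := by
    intro b
    by_cases hb : b ∈ P
    · obtain ⟨c, hc⟩ := hhit b (hPB hb)
      exact ⟨c, fun _ => hc⟩
    · exact ⟨0, fun h => absurd h hb⟩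
  choose φ hφ using hch
  have hφC : ∀ b ∈ P, φ b ∈ C := by
    intro b hb
    obtain ⟨h1, h2⟩ := hφ b hb
    simp only [hC, Finset.mem_filter, Finset.mem_range]
    exact ⟨h1, hpos b hb _ (psqPos_lt r n hr hn _ h1) h2⟩
  have hφi : Set.InjOn φ P := by
    intro b hb b' hb' h
    by_contra hne
    have := hPd hb hb' hne
    have h1 := (hφ b hb).2
    have h2 := (hφ b' hb').2
    rw [← h] at h2
    exact (Finset.disjoint_left.1 this) h1 h2
  have hPC : P.card ≤ C.card := Finset.card_le_card_of_injOn φ hφC hφi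
  have hCne : C.Nonempty := by
    rw [← Finset.card_pos]; omega
  set c := C.min' hCne with hc
  set c' := C.max' hCne with hc'
  have hcC : c ∈ C := Finset.min'_mem _ _
  have hcC' : c' ∈ C := Finset.max'_mem _ _
  have hcc : c ≤ c' := Finset.min'_le _ _ hcC'
  have hCI : C ⊆ Finset.Icc c c' := by
    intro x hx
    exact Finset.mem_Icc.2 ⟨Finset.min'_le _ _ hx, Finset.le_max' _ _ hx⟩
  have hCc := Finset.card_le_card hCI
  rw [Nat.card_Icc] at hCc
  clear_value c c'
  simp only [hC, Finset.mem_filter, Finset.mem_range] at hcC hcC'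
  have hgap := psqPos_gap r n hr hn c c' hcc hcC'.1
  have hcases : (P.card = 1 ∧ c' = c) ∨ (P.card = 2 ∧ c' = c + 1) := by omega
  rcases hcases with ⟨hP1, rfl⟩ | ⟨hP2, rfl⟩
  · obtain ⟨b, rfl⟩ := Finset.card_eq_one.1 hP1
    have hL' : L = 3 := by omega
    subst hL'
    have hb : (Finset.Ico i (i + 3)).image t ∈ B := by
      rw [← hPU]; simpa using hPB (Finset.mem_singleton_self b)
    have hI : Finset.Ico i (i + 3) = {i, i + 1, i + 2} := by
      ext x; simp; omega
    rw [hI] at hb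
    simp only [Finset.image_insert, Finset.image_singleton] at hb
    by_cases h0 : c' = 0
    · have : i = 0 := by
        have := hcC.2.1
        unfold psqPos at this
        split_ifs at this <;> omega
      subst this
      exact h2 (0, 1, 2) (by simp [psqE2]) hb
    by_cases h1 : c' = r - 1
    · have : i = n - 3 := by
        have := hcC.2.2
        unfold psqPos at this
        split_ifs at this; omega
      have e1 : i + 1 = n - 2 := by omega
      have e2 : i + 2 = n - 1 := by omega
      rw [e1, e2, this] at hb
      refine h2 (n - 1, n - 3, n - 2) (by simp [psqE2]) ?_
      convert hb using 1
      ext x; simp; tauto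
    have hp : psqPos r n c' = 5 * c' - 1 := by unfold psqPos; split_ifs; rfl
    rw [hp] at hcC
    have hmem : c' ∈ Finset.Ico 1 (r - 1) := by simp; omega
    have h3 : i = 5 * c' - 1 ∨ i = 5 * c' - 2 ∨ i = 5 * c' - 3 := by omega
    rcases h3 with h3 | h3 | h3
    · refine h2 (5 * c' - 1, 5 * c', 5 * c' + 1) ?_ ?_
      · refine Finset.mem_union_right _ (Finset.mem_biUnion.2 ⟨c', hmem, by simp⟩)
      · have e1 : i + 1 = 5 * c' := by omega
        have e2 : i + 2 = 5 * c' + 1 := by omega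
        rw [e1, e2, h3] at hb
        exact hb
    · refine h2 (5 * c' - 1, 5 * c' - 2, 5 * c') ?_ ?_
      · refine Finset.mem_union_right _ (Finset.mem_biUnion.2 ⟨c', hmem, by simp⟩)
      · have e1 : i + 1 = 5 * c' - 1 := by omega
        have e2 : i + 2 = 5 * c' := by omega
        rw [e1, e2, h3] at hb
        convert hb using 1
        ext x; simp; tauto
    · refine h2 (5 * c' - 1, 5 * c' - 3, 5 * c' - 2) ?_ ?_
      · refine Finset.mem_union_right _ (Finset.mem_biUnion.2 ⟨c', hmem, by simp⟩)
      · have e1 : i + 1 = 5 * c' - 2 := by omega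
        have e2 : i + 2 = 5 * c' - 1 := by omega
        rw [e1, e2, h3] at hb
        convert hb using 1
        ext x; simp; tauto
  · have hL' : L = 6 := by omega
    subst hL'
    have himg : P.image φ = {c, c + 1} := by
      apply Finset.eq_of_subset_of_card_le
      · intro x hx
        obtain ⟨b, hb, rfl⟩ := Finset.mem_image.1 hx
        have := hCI (hφC b hb)
        simp at this ⊢
        omega
      · rw [Finset.card_image_of_injOn hφi, hP2]
        exact Finset.card_le_two
    obtain ⟨b, hb, hbc⟩ : ∃ b ∈ P, φ b = c := by
      have : c ∈ P.image φ := by rw [himg]; simp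
      simpa using this
    obtain ⟨b', hb', hbc'⟩ : ∃ b ∈ P, φ b = c + 1 := by
      have : c + 1 ∈ P.image φ := by rw [himg]; simp
      simpa using this
    have hne : b ≠ b' := by rintro rfl; omega
    have hPe : P = {b, b'} := by
      symm
      apply Finset.eq_of_subset_of_card_le
      · intro x hx
        simp at hx
        rcases hx with rfl | rfl <;> assumption
      · rw [hP2, Finset.card_pair hne]
    have hbp := (hφ b hb).2
    have hbp' := (hφ b' hb').2
    rw [hbc] at hbp
    rw [hbc'] at hbp'
    have hdis : Disjoint b b' := hPd hb hb' hne
    have hU : b ∪ b' = (Finset.range 6).image (fun q => t (i + q)) := by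
      rw [hPe] at hPU
      simp at hPU
      rw [hPU]
      ext x
      simp only [Finset.mem_image, Finset.mem_Ico, Finset.mem_range]
      constructor
      · rintro ⟨y, hy, rfl⟩
        exact ⟨y - i, by omega, by congr 1; omega⟩
      · rintro ⟨y, hy, rfl⟩
        exact ⟨i + y, by omega, rfl⟩
    have hinj6 : ∀ x < 6, ∀ y < 6, t (i + x) = t (i + y) → x = y := by
      intro x hx y hy h
      have := hinj _ (by omega) _ (by omega) h
      omega
    set Q := (Finset.range 6).filter (fun q => t (i + q) ∈ b) with hQ
    have hQb : Q.image (fun q => t (i + q)) = b := by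
      ext x
      simp only [hQ, Finset.mem_image, Finset.mem_filter, Finset.mem_range]
      constructor
      · rintro ⟨q, hq, rfl⟩; exact hq.2
      · intro hx
        have : x ∈ b ∪ b' := Finset.mem_union_left _ hx
        rw [hU] at this
        simp only [Finset.mem_image, Finset.mem_range] at this
        obtain ⟨q, hq, rfl⟩ := this
        exact ⟨q, ⟨hq, hx⟩, rfl⟩
    have hQb' : (Finset.range 6 \ Q).image (fun q => t (i + q)) = b' := by
      ext x
      simp only [hQ, Finset.mem_image, Finset.mem_sdiff, Finset.mem_filter, Finset.mem_range]
      constructor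
      · rintro ⟨q, hq, rfl⟩
        have : t (i + q) ∈ b ∪ b' := by
          rw [hU]; exact Finset.mem_image.2 ⟨q, Finset.mem_range.2 hq.1, rfl⟩
        rcases Finset.mem_union.1 this with h | h
        · exact absurd ⟨hq.1, h⟩ hq.2
        · exact h
      · intro hx
        have : x ∈ b ∪ b' := Finset.mem_union_right _ hx
        rw [hU] at this
        simp only [Finset.mem_image, Finset.mem_range] at this
        obtain ⟨q, hq, rfl⟩ := this
        exact ⟨q, ⟨hq, fun h => Finset.disjoint_left.1 hdis h.2 hx⟩, rfl⟩
    have hQc : Q.card = 3 := by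
      rw [← hB3 b (hPB hb), ← hQb, Finset.card_image_of_injOn]
      intro x hx y hy h
      simp [hQ] at hx hy
      exact hinj6 x hx.1 y hy.1 h
    have hQm : Q ∈ Finset.powersetCard 3 (Finset.range 6) :=
      Finset.mem_powersetCard.2 ⟨Finset.filter_subset _ _, hQc⟩
    have hbB := hPB hb
    have hbB' := hPB hb'
    by_cases h0 : c = 0
    · subst h0
      have hp0 : psqPos r n 0 = 0 := by unfold psqPos; split_ifs <;> omega
      have hp1 : psqPos r n (0 + 1) = 4 := by unfold psqPos; split_ifs <;> omega
      rw [hp0] at hbp hcC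
      rw [hp1] at hbp'
      have hi : i = 0 := by omega
      subst hi
      have hQ0 : 0 ∈ Q := by simp [hQ, hbp]
      have hQ4 : 4 ∉ Q := by
        simp only [hQ, Finset.mem_filter, not_and]
        intro _ h
        rw [zero_add] at h
        exact Finset.disjoint_left.1 hdis h hbp'
      have := psq_dec0 Q hQm hQ0 hQ4
      have hmem : 1 ∈ Finset.Ico 1 (r - 1) := by simp; omega
      clear_value Q
      simp only [Finset.mem_insert, Finset.mem_singleton, Prod.mk.injEq] at this
      rcases this with ⟨e, e'⟩ | ⟨e, e'⟩ | ⟨e, e'⟩ | ⟨e, e'⟩ | ⟨e, e'⟩ | ⟨e, e'⟩ <;>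
        (rw [e'] at hQb'; rw [e] at hQb; simp only [Finset.image_insert, Finset.image_singleton, zero_add] at hQb hQb'
         rw [← hQb] at hbB; rw [← hQb'] at hbB')
      · exact h2 (0, 1, 2) (by simp [psqE2]) hbB
      · exact h4 ((0, 1, 3), (4, 2, 5)) (by simp [psqE4]) ⟨hbB, hbB'⟩
      · exact h2 (4, 2, 3) (Finset.mem_union_right _ (Finset.mem_biUnion.2 ⟨1, hmem, by simp⟩)) hbB'
      · exact h4 ((0, 2, 3), (4, 1, 5)) (by simp [psqE4]) ⟨hbB, hbB'⟩
      · exact h4 ((0, 2, 5), (4, 1, 3)) (by simp [psqE4]) ⟨hbB, hbB'⟩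
      · exact h4 ((0, 3, 5), (4, 1, 2)) (by simp [psqE4]) ⟨hbB, hbB'⟩
    · have hp0 : psqPos r n c = 5 * c - 1 := by unfold psqPos; split_ifs <;> omega
      have hp1' : 5 * c + 4 ≤ psqPos r n (c + 1) := by unfold psqPos; split_ifs <;> omega
      have hi : i = 5 * c - 1 := by omega
      have hp1 : i + 5 = psqPos r n (c + 1) := by omega
      have hQ0 : 0 ∈ Q := by simp [hQ, hi, ← hp0, hbp]
      have hQ5 : 5 ∉ Q := by
        simp only [hQ, Finset.mem_filter, not_and]
        intro _ h
        rw [hp1] at h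
        exact Finset.disjoint_left.1 hdis h hbp'
      have := psq_dec1 Q hQm hQ0 hQ5
      have hmem : c ∈ Finset.Ico 1 (r - 1) := by simp; omega
      clear_value Q
      have i1 : i + 1 = 5 * c := by omega
      have i2 : i + 2 = 5 * c + 1 := by omega
      have i3 : i + 3 = 5 * c + 2 := by omega
      have i4 : i + 4 = 5 * c + 3 := by omega
      simp only [Finset.mem_insert, Finset.mem_singleton, Prod.mk.injEq] at this
      rcases this with ⟨e, e'⟩ | ⟨e, e'⟩ | ⟨e, e'⟩ | ⟨e, e'⟩ | ⟨e, e'⟩ | ⟨e, e'⟩ <;>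
        (rw [e'] at hQb'; rw [e] at hQb; simp only [Finset.image_insert, Finset.image_singleton, add_zero, i1, i2, i3, i4, hp1] at hQb hQb'
         rw [← hQb, hi] at hbB; rw [← hQb'] at hbB')
      · exact h2 (5 * c - 1, 5 * c, 5 * c + 1) (Finset.mem_union_right _ (Finset.mem_biUnion.2 ⟨c, hmem, by simp⟩)) hbB
      · exact h4 ((5 * c - 1, 5 * c, 5 * c + 2), (psqPos r n (c + 1), 5 * c + 1, 5 * c + 3)) (Finset.mem_union_right _ (Finset.mem_biUnion.2 ⟨c, hmem, by simp⟩)) ⟨hbB, hbB'⟩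
      · exact h4 ((5 * c - 1, 5 * c, 5 * c + 3), (psqPos r n (c + 1), 5 * c + 1, 5 * c + 2)) (Finset.mem_union_right _ (Finset.mem_biUnion.2 ⟨c, hmem, by simp⟩)) ⟨hbB, hbB'⟩
      · exact h4 ((5 * c - 1, 5 * c + 1, 5 * c + 2), (psqPos r n (c + 1), 5 * c, 5 * c + 3)) (Finset.mem_union_right _ (Finset.mem_biUnion.2 ⟨c, hmem, by simp⟩)) ⟨hbB, hbB'⟩
      · exact h4 ((5 * c - 1, 5 * c + 1, 5 * c + 3), (psqPos r n (c + 1), 5 * c, 5 * c + 2)) (Finset.mem_union_right _ (Finset.mem_biUnion.2 ⟨c, hmem, by simp⟩)) ⟨hbB, hbB'⟩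
      · exact h4 ((5 * c - 1, 5 * c + 2, 5 * c + 3), (psqPos r n (c + 1), 5 * c, 5 * c + 1)) (Finset.mem_union_right _ (Finset.mem_biUnion.2 ⟨c, hmem, by simp⟩)) ⟨hbB, hbB'⟩

lemma psqE2_valid (r n : ℕ) (hr : 3 ≤ r) (hn : 5 * (r - 1) ≤ n) (Ap Wp : Finset ℕ)
    (hA : Ap = (Finset.range r).image (psqPos r n)) (hW : Wp = Finset.range n \ Ap)
    (e : ℕ × ℕ × ℕ) (he : e ∈ psqE2 r n) :
    e.1 ∈ Ap ∧ e.2.1 ∈ Wp ∧ e.2.2 ∈ Wp ∧ e.2.1 ≠ e.2.2 := by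
  have hAm : ∀ x, x ∈ Ap ↔ ∃ c < r, psqPos r n c = x := by intro x; simp [hA]
  have hWm : ∀ x, (x < n ∧ ∀ c < r, psqPos r n c ≠ x) → x ∈ Wp := by
    rintro x ⟨h1, h2⟩
    simp only [hW, Finset.mem_sdiff, Finset.mem_range, hAm]
    exact ⟨h1, fun ⟨c, hc, h⟩ => h2 c hc h⟩
  simp only [psqE2, Finset.mem_union, Finset.mem_insert, Finset.mem_singleton, Finset.mem_biUnion,
    Finset.mem_Ico] at he
  rcases he with (rfl | rfl) | ⟨c, hc, rfl | rfl | rfl⟩ <;> dsimp only <;>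
    refine ⟨(hAm _).2 ?_, hWm _ ⟨by omega, fun d hd => ?_⟩, hWm _ ⟨by omega, fun d hd => ?_⟩, by omega⟩ <;>
    first
    | (unfold psqPos; split_ifs <;> omega)
    | (refine ⟨0, ?_, ?_⟩ <;> (try unfold psqPos) <;> (try split_ifs) <;> omega)
    | (refine ⟨r - 1, ?_, ?_⟩ <;> (try unfold psqPos) <;> (try split_ifs) <;> omega)
    | (refine ⟨c, ?_, ?_⟩ <;> (try unfold psqPos) <;> (try split_ifs) <;> omega)

lemma psqE4_valid (r n : ℕ) (hr : 3 ≤ r) (hn : 5 * (r - 1) ≤ n) (Ap Wp : Finset ℕ)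
    (hA : Ap = (Finset.range r).image (psqPos r n)) (hW : Wp = Finset.range n \ Ap)
    (e : (ℕ × ℕ × ℕ) × (ℕ × ℕ × ℕ)) (he : e ∈ psqE4 r n) :
    e.1.1 ∈ Ap ∧ e.2.1 ∈ Ap ∧ e.1.2.1 ∈ Wp ∧ e.1.2.2 ∈ Wp ∧ e.2.2.1 ∈ Wp ∧ e.2.2.2 ∈ Wp ∧
      [e.1.2.1, e.1.2.2, e.2.2.1, e.2.2.2].Nodup := by
  have hAm : ∀ x, x ∈ Ap ↔ ∃ c < r, psqPos r n c = x := by intro x; simp [hA]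
  have hWm : ∀ x, (x < n ∧ ∀ c < r, psqPos r n c ≠ x) → x ∈ Wp := by
    rintro x ⟨h1, h2⟩
    simp only [hW, Finset.mem_sdiff, Finset.mem_range, hAm]
    exact ⟨h1, fun ⟨c, hc, h⟩ => h2 c hc h⟩
  simp only [psqE4, Finset.mem_union, Finset.mem_insert, Finset.mem_singleton, Finset.mem_biUnion,
    Finset.mem_Ico] at he
  rcases he with (rfl | rfl | rfl | rfl) | ⟨c, hc, rfl | rfl | rfl | rfl | rfl⟩ <;> dsimp only <;>
    refine ⟨(hAm _).2 ?_, (hAm _).2 ?_, hWm _ ⟨by omega, fun d hd => ?_⟩, hWm _ ⟨by omega, fun d hd => ?_⟩,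
      hWm _ ⟨by omega, fun d hd => ?_⟩, hWm _ ⟨by omega, fun d hd => ?_⟩, by simp⟩ <;>
    first
    | (unfold psqPos; split_ifs <;> omega)
    | (refine ⟨c + 1, ?_, rfl⟩; omega)
    | (refine ⟨0, ?_, ?_⟩ <;> (try unfold psqPos) <;> (try split_ifs) <;> omega)
    | (refine ⟨1, ?_, ?_⟩ <;> (try unfold psqPos) <;> (try split_ifs) <;> omega)
    | (refine ⟨c, ?_, ?_⟩ <;> (try unfold psqPos) <;> (try split_ifs) <;> omega)

lemma psq_final (k m : ℕ) (hk : 1 ≤ k) (hm : 12 * k - 5 ≤ m) (N e2 e4 b2 b4 : ℕ) (hN : 0 < N)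
    (h2 : e2 ≤ 3 * (3 * k) - 4) (h4 : e4 ≤ 5 * (3 * k) - 6)
    (hb2 : b2 * (2 * ((m - 1) / 2) + 1) ≤ e2 * N)
    (hb4 : b4 * ((2 * ((m - 1) / 2) + 1) * (2 * ((m - 3) / 2) + 1)) ≤ e4 * N) : b2 + b4 < N := by
  obtain ⟨j, rfl⟩ : ∃ j, k = j + 1 := ⟨k - 1, by omega⟩
  obtain ⟨d, hd1, hd2⟩ : ∃ d, 2 * ((m - 1) / 2) + 1 = 12 * j + 7 + d ∧
      2 * ((m - 3) / 2) + 1 = 12 * j + 5 + d :=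
    ⟨2 * ((m - 1) / 2) + 1 - (12 * j + 7), by omega, by omega⟩
  rw [hd1] at hb2 hb4
  rw [hd2] at hb4
  have g2 : e2 ≤ 9 * j + 5 := by omega
  have g4 : e4 ≤ 15 * j + 9 := by omega
  by_contra hcon
  push Not at hcon
  have t1 : (b2 + b4) * ((12 * j + 7 + d) * (12 * j + 5 + d)) ≤
      N * ((9 * j + 5) * (12 * j + 5 + d) + (15 * j + 9)) := by
    calc (b2 + b4) * ((12 * j + 7 + d) * (12 * j + 5 + d))
        = b2 * (12 * j + 7 + d) * (12 * j + 5 + d) + b4 * ((12 * j + 7 + d) * (12 * j + 5 + d)) := by ring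
      _ ≤ e2 * N * (12 * j + 5 + d) + e4 * N := Nat.add_le_add (Nat.mul_le_mul_right _ hb2) hb4
      _ ≤ (9 * j + 5) * N * (12 * j + 5 + d) + (15 * j + 9) * N := by gcongr
      _ = _ := by ring
  have t2 : N * ((12 * j + 7 + d) * (12 * j + 5 + d)) ≤
      N * ((9 * j + 5) * (12 * j + 5 + d) + (15 * j + 9)) := (Nat.mul_le_mul_right _ hcon).trans t1
  have t3 := Nat.le_of_mul_le_mul_left t2 hN
  nlinarith

theorem sequenceable_of_large_order {α : Type*} [DecidableEq α]
    (V : Finset α) (B : Finset (Finset α)) (hT : IsPSTS V B)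
    (k : ℕ) (hk : 1 ≤ k)
    (hkB : HasDisjointBlocks B k) (hk1B : ¬ HasDisjointBlocks B (k + 1))
    (hcard : 15 * k - 5 ≤ V.card) :
    Sequenceable V B := by
  classical
  obtain ⟨P, hPB, hPk, hPd⟩ := hkB
  obtain ⟨hT1, hT2⟩ := hT
  set n := V.card with hnV
  set r := 3 * k with hrk
  have hr : 3 ≤ r := by omega
  have hn : 5 * (r - 1) ≤ n := by omega
  set A := P.biUnion id with hA
  have hAV : A ⊆ V := by
    intro x hx
    obtain ⟨b, hb, hxb⟩ := Finset.mem_biUnion.1 hx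
    exact (hT1 b (hPB hb)).1 hxb
  have hAc : A.card = r := by
    rw [hA, Finset.card_biUnion (t := id) (fun x hx y hy hxy => hPd hx hy hxy),
      Finset.sum_congr rfl (fun b hb => show (id b).card = 3 from (hT1 b (hPB hb)).2)]
    simp; omega
  have hhitA : ∀ b ∈ B, ∃ x ∈ A, x ∈ b := by
    intro b hb
    by_contra hcon
    push Not at hcon
    have hdis : ∀ p ∈ P, Disjoint p b := by
      intro p hp
      rw [Finset.disjoint_left]
      intro x hx
      exact hcon x (Finset.mem_biUnion.2 ⟨p, hp, hx⟩)
    have hbP : b ∉ P := by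
      intro h
      have h1 := hdis b h
      rw [disjoint_self] at h1
      have h2 := (hT1 b hb).2
      rw [h1] at h2
      simp at h2
    apply hk1B
    refine ⟨insert b P, Finset.insert_subset hb hPB, by rw [Finset.card_insert_of_notMem hbP, hPk], ?_⟩
    rw [Finset.coe_insert]
    apply hPd.insert
    intro p hp _
    exact ⟨(hdis p hp).symm, hdis p hp⟩
  set Ap := (Finset.range r).image (psqPos r n) with hAp
  have hApc : Ap.card = r := by
    rw [hAp, Finset.card_image_of_injOn, Finset.card_range]
    intro x hx y hy h
    simp at hx hy
    rcases le_total x y with hxy | hxy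
    · have := psqPos_gap r n hr hn x y hxy hy
      omega
    · have := psqPos_gap r n hr hn y x hxy hx
      omega
  have hApn : Ap ⊆ Finset.range n := by
    intro x hx
    obtain ⟨c, hc, rfl⟩ := Finset.mem_image.1 hx
    exact Finset.mem_range.2 (psqPos_lt r n hr hn c (Finset.mem_range.1 hc))
  set Wp := Finset.range n \ Ap with hWp
  set W := V \ A with hW
  have hWpc : Wp.card = n - r := by
    rw [hWp, Finset.card_sdiff_of_subset hApn, hApc, Finset.card_range]
  have hWc : W.card = n - r := by
    rw [hW, Finset.card_sdiff_of_subset hAV, hAc]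
  let eA : Ap ≃ A := Finset.equivOfCardEq (by rw [hApc, hAc])
  let eW : Wp ≃ W := Finset.equivOfCardEq (by rw [hWpc, hWc])
  obtain ⟨a0, ha0⟩ : V.Nonempty := Finset.card_pos.1 (by omega)
  let t : (Wp ≃ W) → ℕ → α := fun g q =>
    if h : q ∈ Ap then (eA ⟨q, h⟩ : α) else if h : q ∈ Wp then (g ⟨q, h⟩ : α) else a0
  have htA : ∀ g q (h : q ∈ Ap), t g q = eA ⟨q, h⟩ := by
    intro g q h; simp [t, h]
  have htW : ∀ g q (h : q ∈ Wp), t g q = g ⟨q, h⟩ := by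
    intro g q h
    have h' : q ∉ Ap := (Finset.mem_sdiff.1 h).2
    simp only [t, h', h, dite_true, dite_false]
  -- relation facts
  have hRs : ∀ a : α, ∀ x y : W, ({a, (x : α), (y : α)} : Finset α) ∈ B →
      ({a, (y : α), (x : α)} : Finset α) ∈ B := by
    intro a x y h
    rwa [Finset.pair_comm]
  have hRi : ∀ a : α, ∀ x : W, ¬ ({a, (x : α), (x : α)} : Finset α) ∈ B := by
    intro a x h
    have h1 := (hT1 _ h).2
    have h2 : ({a, (x : α), (x : α)} : Finset α).card ≤ 2 := by
      simpa using (Finset.card_le_two (a := a) (b := (x : α)))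
    omega
  have hRf : ∀ a ∈ A, ∀ x y z : W, ({a, (x : α), (y : α)} : Finset α) ∈ B →
      ({a, (x : α), (z : α)} : Finset α) ∈ B → y = z := by
    intro a ha x y z h1 h2
    have hax : a ≠ x := by
      rintro rfl
      exact (Finset.mem_sdiff.1 x.2).2 ha
    have haz : a ≠ z := by
      rintro rfl
      exact (Finset.mem_sdiff.1 z.2).2 ha
    by_cases heq : ({a, (x : α), (y : α)} : Finset α) = {a, (x : α), (z : α)}
    · have hz : (z : α) ∈ ({a, (x : α), (y : α)} : Finset α) := by rw [heq]; simp
      simp only [Finset.mem_insert, Finset.mem_singleton] at hz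
      rcases hz with hz | hz | hz
      · exact absurd hz.symm haz
      · exfalso
        have hzx : z = x := Subtype.ext hz
        rw [hzx] at h2
        exact hRi a x h2
      · exact (Subtype.ext hz).symm
    · exfalso
      have h3 := hT2 _ h1 _ h2 heq
      have h4 : ({a, (x : α)} : Finset α) ⊆ ({a, (x : α), (y : α)} : Finset α) ∩ {a, (x : α), (z : α)} := by
        intro u hu
        simp at hu ⊢
        tauto
      have h5 := Finset.card_le_card h4
      rw [Finset.card_pair hax] at h5
      omega
  set m := n - r with hm
  have hmc : Fintype.card W = m := by simp [hWc]
  have hm4 : 4 ≤ m := by omega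
  set N := Fintype.card (Wp ≃ W) with hN
  have hNpos : 0 < N := Fintype.card_pos_iff.2 ⟨eW⟩
  let bad2 : ℕ × ℕ × ℕ → Finset (Wp ≃ W) := fun e => Finset.univ.filter (fun g =>
    ({t g e.1, t g e.2.1, t g e.2.2} : Finset α) ∈ B)
  let bad4 : (ℕ × ℕ × ℕ) × (ℕ × ℕ × ℕ) → Finset (Wp ≃ W) := fun e => Finset.univ.filter (fun g =>
    ({t g e.1.1, t g e.1.2.1, t g e.1.2.2} : Finset α) ∈ B ∧
    ({t g e.2.1, t g e.2.2.1, t g e.2.2.2} : Finset α) ∈ B)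
  have hbad2 : ∀ e ∈ psqE2 r n, (bad2 e).card * (2 * ((m - 1) / 2) + 1) ≤ N := by
    rintro ⟨p, x, y⟩ he
    obtain ⟨v1, v2, v3, v4⟩ := psqE2_valid r n hr hn Ap Wp hAp hWp _ he
    dsimp only at v1 v2 v3 v4
    have := psq_pair (X := Wp) (Y := W) m hmc hm4 ⟨x, v2⟩ ⟨y, v3⟩ (by simpa using v4)
      (fun u v => ({(eA ⟨p, v1⟩ : α), (u : α), (v : α)} : Finset α) ∈ B)
      (hRs _) (hRi _) (hRf _ (eA ⟨p, v1⟩).2)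
    have hset : bad2 (p, x, y) = Finset.univ.filter (fun g : Wp ≃ W =>
        ({(eA ⟨p, v1⟩ : α), (g ⟨x, v2⟩ : α), (g ⟨y, v3⟩ : α)} : Finset α) ∈ B) := by
      apply Finset.filter_congr
      intro g _
      simp only [htA g p v1, htW g x v2, htW g y v3]
    rw [hset]
    exact this
  have hbad4 : ∀ e ∈ psqE4 r n, (bad4 e).card *
      ((2 * ((m - 1) / 2) + 1) * (2 * ((m - 3) / 2) + 1)) ≤ N := by
    rintro ⟨⟨p, x, y⟩, ⟨p', z, w⟩⟩ he
    obtain ⟨v1, v1', v2, v3, v4, v5, v6⟩ := psqE4_valid r n hr hn Ap Wp hAp hWp _ he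
    dsimp only at v1 v1' v2 v3 v4 v5 v6
    have := psq_quad (X := Wp) (Y := W) m hmc hm4 ⟨x, v2⟩ ⟨y, v3⟩ ⟨z, v4⟩ ⟨w, v5⟩ (by simpa using v6)
      (fun u v => ({(eA ⟨p, v1⟩ : α), (u : α), (v : α)} : Finset α) ∈ B)
      (fun u v => ({(eA ⟨p', v1'⟩ : α), (u : α), (v : α)} : Finset α) ∈ B)
      (hRs _) (hRi _) (hRf _ (eA ⟨p, v1⟩).2)
      (hRs _) (hRi _) (hRf _ (eA ⟨p', v1'⟩).2)
    have hset : bad4 ((p, x, y), (p', z, w)) = Finset.univ.filter (fun g : Wp ≃ W =>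
        ({(eA ⟨p, v1⟩ : α), (g ⟨x, v2⟩ : α), (g ⟨y, v3⟩ : α)} : Finset α) ∈ B ∧
        ({(eA ⟨p', v1'⟩ : α), (g ⟨z, v4⟩ : α), (g ⟨w, v5⟩ : α)} : Finset α) ∈ B) := by
      apply Finset.filter_congr
      intro g _
      simp only [htA g p v1, htW g x v2, htW g y v3, htA g p' v1', htW g z v4, htW g w v5]
    rw [hset]
    exact this
  obtain ⟨g, hg⟩ : ∃ g : Wp ≃ W, g ∉ (psqE2 r n).biUnion bad2 ∪ (psqE4 r n).biUnion bad4 := by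
    by_contra hcon
    push Not at hcon
    have h1 : N ≤ ((psqE2 r n).biUnion bad2 ∪ (psqE4 r n).biUnion bad4).card := by
      rw [hN, ← Finset.card_univ]
      exact Finset.card_le_card (fun g _ => hcon g)
    have h2 : N ≤ (∑ e ∈ psqE2 r n, (bad2 e).card) + ∑ e ∈ psqE4 r n, (bad4 e).card :=
      h1.trans ((Finset.card_union_le _ _).trans
        (Nat.add_le_add Finset.card_biUnion_le Finset.card_biUnion_le))
    have h3 := psq_final k m hk (by omega) N _ _ (∑ e ∈ psqE2 r n, (bad2 e).card)
      (∑ e ∈ psqE4 r n, (bad4 e).card) hNpos (psqE2_card r n hr) (psqE4_card r n hr)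
      (by rw [Finset.sum_mul, ← smul_eq_mul]; exact Finset.sum_le_card_nsmul _ _ _ hbad2)
      (by rw [Finset.sum_mul, ← smul_eq_mul (a := (psqE4 r n).card)]
          exact Finset.sum_le_card_nsmul _ _ _ hbad4)
    omega
  simp only [Finset.mem_union, Finset.mem_biUnion, not_or, not_exists, not_and] at hg
  obtain ⟨hg2, hg4⟩ := hg
  -- properties of the sequence
  have hcase : ∀ x < n, x ∈ Ap ∨ x ∈ Wp := by
    intro x hx
    by_cases h : x ∈ Ap
    · exact Or.inl h
    · exact Or.inr (Finset.mem_sdiff.2 ⟨Finset.mem_range.2 hx, h⟩)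
  have hinj : ∀ x < n, ∀ y < n, t g x = t g y → x = y := by
    intro x hx y hy h
    rcases hcase x hx with hx | hx <;> rcases hcase y hy with hy | hy
    · rw [htA g x hx, htA g y hy] at h
      simpa using eA.injective (Subtype.ext h)
    · rw [htA g x hx, htW g y hy] at h
      have h1 := (eA ⟨x, hx⟩).2
      rw [h] at h1
      exact absurd h1 (Finset.mem_sdiff.1 (g ⟨y, hy⟩).2).2
    · rw [htW g x hx, htA g y hy] at h
      have h1 := (eA ⟨y, hy⟩).2
      rw [← h] at h1
      exact absurd h1 (Finset.mem_sdiff.1 (g ⟨x, hx⟩).2).2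
    · rw [htW g x hx, htW g y hy] at h
      simpa using g.injective (Subtype.ext h)
  have himV : (Finset.range n).image (t g) = V := by
    apply Finset.eq_of_subset_of_card_le
    · intro u hu
      obtain ⟨x, hx, rfl⟩ := Finset.mem_image.1 hu
      rcases hcase x (Finset.mem_range.1 hx) with hx | hx
      · rw [htA g x hx]; exact hAV (eA ⟨x, hx⟩).2
      · rw [htW g x hx]; exact (Finset.mem_sdiff.1 (g ⟨x, hx⟩).2).1
    · rw [Finset.card_image_of_injOn, Finset.card_range]
      intro x hx y hy h
      simp at hx hy
      exact hinj x hx y hy h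
  have hhit : ∀ b ∈ B, ∃ c < r, t g (psqPos r n c) ∈ b := by
    intro b hb
    obtain ⟨x, hxA, hxb⟩ := hhitA b hb
    obtain ⟨⟨q, hq⟩, hqx⟩ := eA.surjective ⟨x, hxA⟩
    obtain ⟨c, hc, hcq⟩ := Finset.mem_image.1 hq
    refine ⟨c, Finset.mem_range.1 hc, ?_⟩
    rw [hcq, htA g q hq, hqx]
    exact hxb
  have hwin := psq_window B r n hr hn (t g) hinj (fun b hb => (hT1 b hb).2) hhit
    (fun e he h => hg2 e he (by simpa [bad2] using h))
    (fun e he h => hg4 e he (by simpa [bad4] using h))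
  refine ⟨(List.range n).map (t g), ?_, ?_, ?_⟩
  · refine List.Nodup.map_on ?_ List.nodup_range
    intro x hx y hy h
    exact hinj x (List.mem_range.1 hx) y (List.mem_range.1 hy) h
  · rw [← himV]
    ext u
    simp
  · intro i q hne _
    have hseg : (((List.range n).map (t g)).drop i).take q =
        (List.range' i (min q (n - i))).map (t g) := by
      rw [← List.map_drop, ← List.map_take, List.range_eq_range', List.drop_range']
      rcases le_total (n - i) q with h | h
      · rw [List.take_range'_of_length_le h, min_eq_right h]; simp
      · rw [List.take_range'_of_length_ge h, min_eq_left h]; simp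
    rw [hseg] at hne ⊢
    have hfin : ((List.range' i (min q (n - i))).map (t g)).toFinset =
        (Finset.Ico i (i + min q (n - i))).image (t g) := by
      ext u
      simp [List.mem_range'_1]
    rw [hfin]
    have hpos : 0 < min q (n - i) := by
      rcases Nat.eq_zero_or_pos (min q (n - i)) with h | h
      · rw [h] at hne; simp at hne
      · exact h
    exact hwin i _ hpos (by omega)
end
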